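/- (Two-Sided Ladder Theorem, t = 2, no coincidental corners) Let Y be a 2-connected ladder over a field k, with lower inside corners (a_1,b_1),…,(a_h,b_h) and upper inside corners (c_1,d_1),…,(c_k,d_k), such that (a_i,b_i) ≠ (c_j,d_j) for all 1 ≤ i ≤ h and 1 ≤ j ≤ k. Then R_2(Y) has at most two semidualizing modules up to isomorphism: among any three semidualizing R_2(Y)-modules, two are isomorphic. -/

import Mathlib

set_option maxHeartbeats 1000000
set_option synthInstance.maxHeartbeats 1000000

open CategoryTheory

namespace LadderDet

/-- The position `p` lies in the `m × n` grid `{1,…,m} × {1,…,n}`. -/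
def InGrid (m n : ℕ) (p : ℕ × ℕ) : Prop :=
  1 ≤ p.1 ∧ p.1 ≤ m ∧ 1 ≤ p.2 ∧ p.2 ≤ n

/-- `Y` is a ladder in the `m × n` grid. -/
def IsLadder (m n : ℕ) (Y : Set (ℕ × ℕ)) : Prop :=
  (∀ p ∈ Y, InGrid m n p) ∧
  ∀ i j p q : ℕ, (i, j) ∈ Y → (p, q) ∈ Y → i ≤ p → j ≤ q → (i, q) ∈ Y ∧ (p, j) ∈ Y

/-- A ladder together with the standard nontriviality assumptions:
`(1,n), (m,1) ∈ Y` and every row and every column of the grid meets `Y`. -/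
def StdLadder (m n : ℕ) (Y : Set (ℕ × ℕ)) : Prop :=
  IsLadder m n Y ∧ (1, n) ∈ Y ∧ (m, 1) ∈ Y ∧
  (∀ i, 1 ≤ i → i ≤ m → ∃ j, (i, j) ∈ Y) ∧
  (∀ j, 1 ≤ j → j ≤ n → ∃ i, (i, j) ∈ Y)

/-- Two positions differ by exactly `1` in exactly one coordinate. -/
def AdjStep (p q : ℕ × ℕ) : Prop :=
  (p.1 = q.1 ∧ (p.2 + 1 = q.2 ∨ q.2 + 1 = p.2)) ∨
  (p.2 = q.2 ∧ (p.1 + 1 = q.1 ∨ q.1 + 1 = p.1))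

/-- There is a path in `Y` from `p` to `q`. -/
def HasPath (Y : Set (ℕ × ℕ)) (p q : ℕ × ℕ) : Prop :=
  p ∈ Y ∧ q ∈ Y ∧
    Relation.ReflTransGen (fun a b => a ∈ Y ∧ b ∈ Y ∧ AdjStep a b) p q

/-- `Y` is path-connected. -/
def PathConnected (Y : Set (ℕ × ℕ)) : Prop :=
  ∀ p ∈ Y, ∀ q ∈ Y, HasPath Y p q

/-- `M` is (the set of entries of) a `t × t` minor of `Y`. -/
def IsMinor (t : ℕ) (Y : Set (ℕ × ℕ)) (M : Set (ℕ × ℕ)) : Prop :=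
  ∃ r c : Fin t → ℕ, StrictMono r ∧ StrictMono c ∧
    (∀ u v, (r u, c v) ∈ Y) ∧ M = {p | ∃ u v, p = (r u, c v)}

/-- `Y` is `t`-disconnected. -/
def TDisconnected (m n t : ℕ) (Y : Set (ℕ × ℕ)) : Prop :=
  ∃ Z₁ Z₂ : Set (ℕ × ℕ), Z₁.Nonempty ∧ Z₂.Nonempty ∧
    IsLadder m n Z₁ ∧ IsLadder m n Z₂ ∧ Z₁ ∩ Z₂ = ∅ ∧ Z₁ ∪ Z₂ = Y ∧
    ∀ M, IsMinor t Y M → M ⊆ Z₁ ∨ M ⊆ Z₂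

/-- `Y` is `t`-connected. -/
def TConnected (m n t : ℕ) (Y : Set (ℕ × ℕ)) : Prop := ¬ TDisconnected m n t Y

/-- `p` is a lower inside corner of `Y`. -/
def IsLowerCorner (Y : Set (ℕ × ℕ)) (p : ℕ × ℕ) : Prop :=
  p ∈ Y ∧ (p.1 - 1, p.2) ∈ Y ∧ (p.1, p.2 - 1) ∈ Y ∧ (p.1 - 1, p.2 - 1) ∉ Y

/-- `p` is an upper inside corner of `Y`. -/
def IsUpperCorner (Y : Set (ℕ × ℕ)) (p : ℕ × ℕ) : Prop :=
  p ∈ Y ∧ (p.1 + 1, p.2) ∈ Y ∧ (p.1, p.2 + 1) ∈ Y ∧ (p.1 + 1, p.2 + 1) ∉ Y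

/-- `Y` is one-sided: path-connected and with no lower or no upper inside corners. -/
def OneSided (Y : Set (ℕ × ℕ)) : Prop :=
  PathConnected Y ∧
  ((∀ p, ¬ IsLowerCorner Y p) ∨ (∀ p, ¬ IsUpperCorner Y p))

/-- `Y` is two-sided: path-connected with at least one lower and one upper inside corner. -/
def TwoSided (Y : Set (ℕ × ℕ)) : Prop :=
  PathConnected Y ∧ (∃ p, IsLowerCorner Y p) ∧ (∃ p, IsUpperCorner Y p)

section Algebra

variable (k : Type) [Field k]

/-- The `t × t` minor of the generic matrix determined by rows `r` and columns `c`,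
as an element of the polynomial ring `k[Y]`. -/
noncomputable def minorPoly {t : ℕ} {Y : Set (ℕ × ℕ)} (r c : Fin t → ℕ)
    (h : ∀ u v, (r u, c v) ∈ Y) : MvPolynomial Y k :=
  (Matrix.of fun u v : Fin t =>
    (MvPolynomial.X ⟨(r u, c v), h u v⟩ : MvPolynomial Y k)).det

/-- The ideal `I_t(Y) ⊆ k[Y]` generated by all `t × t` minors of `X` lying in `Y`. -/
noncomputable def minorIdeal (t : ℕ) (Y : Set (ℕ × ℕ)) : Ideal (MvPolynomial Y k) :=
  Ideal.span {f | ∃ (r c : Fin t → ℕ) (_ : StrictMono r) (_ : StrictMono c)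
    (h : ∀ u v, (r u, c v) ∈ Y), f = minorPoly k r c h}

/-- The ladder determinantal ring `R_t(Y) = k[Y]/I_t(Y)`. -/
abbrev LadderRing (t : ℕ) (Y : Set (ℕ × ℕ)) : Type :=
  MvPolynomial Y k ⧸ minorIdeal k t Y

/-- The residue `x_{ij}` of the variable `X_{ij}` in `R_t(Y)`. -/
noncomputable def xres (t : ℕ) {Y : Set (ℕ × ℕ)} (p : ℕ × ℕ) (hp : p ∈ Y) :
    LadderRing k t Y :=
  Ideal.Quotient.mk (minorIdeal k t Y) (MvPolynomial.X ⟨p, hp⟩)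

/-- The ideal of `R_2(Y)` generated by the residues of the variables in row `r`
(an ideal of type `𝔮`). -/
noncomputable def rowIdeal (Y : Set (ℕ × ℕ)) (r : ℕ) : Ideal (LadderRing k 2 Y) :=
  Ideal.span {z | ∃ q, ∃ h : (r, q) ∈ Y, z = xres k 2 (r, q) h}

/-- The ideal of `R_2(Y)` generated by the residues of the variables in column `b`
(an ideal of type `𝔮'`). -/
noncomputable def colIdeal (Y : Set (ℕ × ℕ)) (b : ℕ) : Ideal (LadderRing k 2 Y) :=
  Ideal.span {z | ∃ p, ∃ h : (p, b) ∈ Y, z = xres k 2 (p, b) h}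

/-- The ideal `𝔭` of `R_2(Y)` generated by the residues of the variables weakly
northwest of the position `(c, d)`. -/
noncomputable def cornerIdeal (Y : Set (ℕ × ℕ)) (c d : ℕ) : Ideal (LadderRing k 2 Y) :=
  Ideal.span {z | ∃ p q, ∃ h : (p, q) ∈ Y, p ≤ c ∧ q ≤ d ∧ z = xres k 2 (p, q) h}

end Algebra

/-- An ideal of `k[Y]` is a monomial ideal if it is generated by monomials. -/
def IsMonomialIdeal {k : Type} [Field k] {Y : Set (ℕ × ℕ)}
    (M : Ideal (MvPolynomial Y k)) : Prop :=
  ∃ S : Set (Y →₀ ℕ), M = Ideal.span ((fun d => MvPolynomial.monomial d (1 : k)) '' S)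

/-- A finitely generated module `C` over a commutative ring `R` is semidualizing if
the natural homothety map `R → Hom_R(C, C)` is bijective and `Ext^i_R(C, C) = 0` for
all `i ≥ 1`. -/
def IsSemidualizing {R : Type} [CommRing R] (C : ModuleCat.{0} R) : Prop :=
  Module.Finite R C ∧
  Function.Bijective (LinearMap.lsmul R C) ∧
  ∀ i : ℕ, 1 ≤ i →
    Subsingleton (((Ext R (ModuleCat.{0} R) i).obj (Opposite.op C)).obj C)

/-- `C` has finite injective dimension: for some `n`, `Ext^i_R(M, C) = 0` for all
modules `M` and all `i > n`. -/
def HasFiniteInjDim {R : Type} [CommRing R] (C : ModuleCat.{0} R) : Prop :=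
  ∃ n : ℕ, ∀ i : ℕ, n < i → ∀ M : ModuleCat.{0} R,
    Subsingleton (((Ext R (ModuleCat.{0} R) i).obj (Opposite.op M)).obj C)


section ExtPart
variable {R : Type} [CommRing R]

/-- criterion from vanishing Ext for an arbitrary projective resolution -/
lemma ext_lift_of_resolution {C N : ModuleCat.{0} R} (P : ProjectiveResolution C) (i : ℕ)
    (h : Subsingleton (((Ext R (ModuleCat.{0} R) (i+1)).obj (Opposite.op C)).obj N))
    (f : P.complex.X (i+1) ⟶ N) (hf : P.complex.d (i+2) (i+1) ≫ f = 0) :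
    ∃ g : P.complex.X i ⟶ N, P.complex.d (i+1) i ≫ g = f := by
  have h0 : Limits.IsZero ((P.complex.linearYonedaObj R N).homology (i+1)) := by
    refine Limits.IsZero.of_iso ?_ (P.isoExt (R := R) (i+1) N).symm
    exact @ModuleCat.isZero_of_subsingleton _ _ _ h
  rw [← HomologicalComplex.exactAt_iff_isZero_homology,
    HomologicalComplex.exactAt_iff' _ i (i+1) (i+2) (by simp) (by simp),
    ShortComplex.moduleCat_exact_iff] at h0
  obtain ⟨g, hg⟩ := h0 f hf
  exact ⟨g, hg⟩

lemma exists_resolution (P : ℕ → Type) [∀ i, AddCommGroup (P i)] [∀ i, Module R (P i)]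
    [∀ i, Module.Free R (P i)] (C : ModuleCat.{0} R)
    (d : ∀ i, P (i+1) →ₗ[R] P i) (ε : P 0 →ₗ[R] C) (hε : Function.Surjective ε)
    (h0 : Function.Exact (d 0) ε) (hd : ∀ i, Function.Exact (d (i+1)) (d i)) :
    ∃ Q : ProjectiveResolution C, Q.complex = ChainComplex.of (fun i => ModuleCat.of R (P i))
      (fun i => ModuleCat.ofHom (d i)) (fun i => by
        ext x; exact (hd i (d (i+1) x)).2 ⟨x, rfl⟩) := by
  let K : ChainComplex (ModuleCat.{0} R) ℕ := ChainComplex.of (fun i => ModuleCat.of R (P i))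
      (fun i => ModuleCat.ofHom (d i)) (fun i => by
        ext x; exact (hd i (d (i+1) x)).2 ⟨x, rfl⟩)
  have hw : K.d 1 0 ≫ (ModuleCat.ofHom ε : K.X 0 ⟶ C) = 0 := by
    have e0 := ChainComplex.of_d (fun i => ModuleCat.of R (P i))
      (fun i => ModuleCat.ofHom (d i)) 0
    refine (congrArg (fun t => t ≫ ModuleCat.ofHom ε) e0).trans ?_
    ext x
    exact (h0 _).2 ⟨x, rfl⟩
  have hE : ((ChainComplex.toSingle₀Equiv K C).symm ⟨ModuleCat.ofHom ε, hw⟩).f 0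
      = (ModuleCat.ofHom ε : K.X 0 ⟶ C) := ChainComplex.toSingle₀Equiv_symm_apply_f_zero _ _
  refine ⟨{ complex := K, projective := ?_, π := (ChainComplex.toSingle₀Equiv _ _).symm ⟨ModuleCat.ofHom ε, hw⟩, quasiIso := ⟨fun n => ?_⟩ }, rfl⟩
  · intro n
    exact ModuleCat.projective_of_free (Module.Free.chooseBasis R (P n))
  · cases n with
    | zero =>
      rw [ChainComplex.quasiIsoAt₀_iff, ShortComplex.quasiIso_iff_of_zeros']
      · constructor
        · rw [ShortComplex.moduleCat_exact_iff]
          intro x hx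
          obtain ⟨y, hy⟩ := (h0 x).1
            ((congrArg (fun t : K.X 0 ⟶ C => t.hom x) hE).symm.trans hx)
          refine ⟨y, ?_⟩
          have e0 := ChainComplex.of_d (fun i => ModuleCat.of R (P i))
            (fun i => ModuleCat.ofHom (d i)) 0
          exact (congrArg (fun t => t.hom y) e0).trans hy
        · rw [ModuleCat.epi_iff_surjective]
          intro c
          obtain ⟨x, hx⟩ := hε c
          refine ⟨x, ?_⟩
          exact (congrArg (fun t : K.X 0 ⟶ C => t.hom x) hE).trans hx
      all_goals rfl
    | succ n =>
      rw [quasiIsoAt_iff_exactAt']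
      · rw [HomologicalComplex.exactAt_iff' _ (n+2) (n+1) n (by simp) (by simp),
          ShortComplex.moduleCat_exact_iff]
        intro x hx
        have e1 := ChainComplex.of_d (fun i => ModuleCat.of R (P i))
          (fun i => ModuleCat.ofHom (d i)) n
        have e2 := ChainComplex.of_d (fun i => ModuleCat.of R (P i))
          (fun i => ModuleCat.ofHom (d i)) (n+1)
        have hx' : (d n) x = 0 := (congrArg (fun t => t.hom x) e1).symm.trans hx
        obtain ⟨y, hy⟩ := (hd n x).1 hx'
        refine ⟨y, ?_⟩
        exact (congrArg (fun t => t.hom y) e2).trans hy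
      · apply ChainComplex.exactAt_succ_single_obj

lemma ext_lift_free (P : ℕ → Type) [∀ i, AddCommGroup (P i)] [∀ i, Module R (P i)]
    [∀ i, Module.Free R (P i)] (C N : ModuleCat.{0} R)
    (d : ∀ i, P (i+1) →ₗ[R] P i) (ε : P 0 →ₗ[R] C) (hε : Function.Surjective ε)
    (h0 : Function.Exact (d 0) ε) (hd : ∀ i, Function.Exact (d (i+1)) (d i)) (i : ℕ)
    (h : Subsingleton (((Ext R (ModuleCat.{0} R) (i+1)).obj (Opposite.op C)).obj N))
    (f : P (i+1) →ₗ[R] N) (hf : f.comp (d (i+1)) = 0) :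
    ∃ g : P i →ₗ[R] N, g.comp (d i) = f := by
  obtain ⟨Q, hQ⟩ := exists_resolution P C d ε hε h0 hd
  have key : ∀ (K : ChainComplex (ModuleCat.{0} R) ℕ), Q.complex = K →
      ∀ f : K.X (i+1) ⟶ N, K.d (i+2) (i+1) ≫ f = 0 → ∃ g : K.X i ⟶ N, K.d (i+1) i ≫ g = f := by
    rintro K rfl f hf
    exact ext_lift_of_resolution Q i h f hf
  have e1 := ChainComplex.of_d (fun i => ModuleCat.of R (P i))
    (fun i => ModuleCat.ofHom (d i)) i
  have e2 := ChainComplex.of_d (fun i => ModuleCat.of R (P i))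
    (fun i => ModuleCat.ofHom (d i)) (i+1)
  obtain ⟨g, hg⟩ := key _ hQ (ModuleCat.ofHom f) (by
    refine (congrArg (fun t => t ≫ ModuleCat.ofHom f) e2).trans ?_
    ext x
    exact congrArg (fun t => t x) hf)
  refine ⟨g.hom, ?_⟩
  have hg2 := (congrArg (fun t => t ≫ g) e1).symm.trans hg
  ext x
  exact congrArg (fun t => t.hom x) hg2

/-- Vanishing of `Ext^1(C,C)`: maps `C → C/xC` lift. -/
lemma lift_mod_of_ext (C : ModuleCat.{0} R) (x : R) (hx : ∀ c : C, x • c = 0 → c = 0)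
    (h : Subsingleton (((Ext R (ModuleCat.{0} R) 1).obj (Opposite.op C)).obj C))
    {Q : Type} [AddCommGroup Q] [Module R Q] (π : C →ₗ[R] Q) (hπ : Function.Surjective π)
    (hker : ∀ c, π c = 0 ↔ ∃ c', c = x • c') (f : C →ₗ[R] Q) : ∃ g : C →ₗ[R] C, π.comp g = f := by
  let P := ProjectiveResolution.of C
  have hP : ∀ i, Module.Projective R (P.complex.X i) := fun i => by
    have := P.projective i
    exact (IsProjective.iff_projective (P.complex.X i)).2 this
  let e : P.complex.X 0 →ₗ[R] C := (P.π.f 0).hom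
  have he : Function.Surjective e := (ModuleCat.epi_iff_surjective (P.π.f 0)).1 inferInstance
  have hex : ∀ y, e y = 0 → ∃ z, P.complex.d 1 0 z = y := by
    have := P.exact₀
    rw [ShortComplex.moduleCat_exact_iff] at this
    exact this
  have hde : ∀ z, e (P.complex.d 1 0 z) = 0 := fun z => by
    have := congrArg (fun t => t.hom z) P.complex_d_comp_π_f_zero
    exact this
  obtain ⟨f0, hf0⟩ := @Module.projective_lifting_property _ _ _ _ _ _ _ _ _ _ _ (hP 0)
    π (f.comp e) hπ
  have hc : ∀ z, ∃ c', f0 (P.complex.d 1 0 z) = x • c' := fun z => by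
    rw [← hker, ← LinearMap.comp_apply, hf0, LinearMap.comp_apply, hde, map_zero]
  choose ψ hψ using hc
  have hinj : ∀ c c' : C, x • c = x • c' → c = c' := fun c c' hh => by
    rw [← sub_eq_zero]; apply hx; rw [smul_sub, hh, sub_self]
  let ψl : P.complex.X 1 →ₗ[R] C :=
    { toFun := ψ
      map_add' := fun a b => hinj _ _ (by rw [← hψ, map_add, map_add, hψ, hψ, smul_add])
      map_smul' := fun r a => hinj _ _ (by
        rw [← hψ, map_smul, map_smul, hψ, RingHom.id_apply, smul_comm]) }
  obtain ⟨θ, hθ⟩ := ext_lift_of_resolution P 0 h (ModuleCat.ofHom ψl) (by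
    ext z
    apply hinj
    change x • ψ (P.complex.d 2 1 z) = x • (0 : C)
    rw [← hψ, smul_zero]
    have := congrArg (fun t => t.hom z) (P.complex.d_comp_d 2 1 0)
    have h2 : P.complex.d 1 0 (P.complex.d 2 1 z) = 0 := this
    rw [h2, map_zero])
  have hθ' : ∀ z, θ (P.complex.d 1 0 z) = ψ z := fun z => congrArg (fun t => t.hom z) hθ
  let F : P.complex.X 0 →ₗ[R] C := f0 - x • θ.hom
  have hF : ∀ y, e y = 0 → F y = 0 := by
    intro y hy
    obtain ⟨z, rfl⟩ := hex y hy
    change f0 _ - x • θ (P.complex.d 1 0 z) = 0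
    rw [hθ', hψ, sub_self]
  have hle : LinearMap.ker e ≤ LinearMap.ker F := fun y hy => hF y hy
  let G : C →ₗ[R] C := ((LinearMap.ker e).liftQ F hle).comp
    (e.quotKerEquivOfSurjective he).symm.toLinearMap
  have hG : ∀ y, G (e y) = F y := by
    intro y
    have : (e.quotKerEquivOfSurjective he).symm (e y) = Submodule.Quotient.mk y := by
      rw [LinearEquiv.symm_apply_eq]; rfl
    change ((LinearMap.ker e).liftQ F hle) ((e.quotKerEquivOfSurjective he).symm (e y)) = _
    rw [this]
    rfl
  refine ⟨G, ?_⟩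
  ext c
  obtain ⟨y, rfl⟩ := he c
  rw [LinearMap.comp_apply, hG]
  change π (f0 y - x • θ y) = _
  have h3 : π (x • θ y) = 0 := (hker _).2 ⟨_, rfl⟩
  rw [map_sub, h3, sub_zero, ← LinearMap.comp_apply, hf0]
  rfl

end ExtPart

section Semidual
variable {R : Type} [CommRing R] [IsDomain R] [IsNoetherianRing R]

lemma annihilator_eq_bot_of_lsmul {C : Type} [AddCommGroup C] [Module R C]
    (h : Function.Injective (LinearMap.lsmul R C)) : Module.annihilator R C = ⊥ := by
  rw [eq_bot_iff]
  intro r hr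
  rw [Module.mem_annihilator] at hr
  refine h ?_
  ext c
  simpa using hr c

/-- if `y` is regular on `Hom(C,M)`, it is regular on `M`. -/
lemma regular_of_hom {C M : Type} [AddCommGroup C] [Module R C] [Module.Finite R C]
    [AddCommGroup M] [Module R M] [Module.Finite R M]
    (hC : Module.annihilator R C = ⊥) (y : R)
    (h : ∀ f : C →ₗ[R] M, y • f = 0 → f = 0) : ∀ c : M, y • c = 0 → c = 0 := by
  let K : Submodule R M := LinearMap.ker (LinearMap.lsmul R M y)
  have hs : Subsingleton (C →ₗ[R] K) := by
    refine ⟨fun f g => ?_⟩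
    have : K.subtype.comp (f - g) = 0 := by
      apply h
      ext c
      exact ((f - g) c).2
    rw [← sub_eq_zero]
    ext c
    exact congrArg (fun t => t c) this
  rw [IsSMulRegular.subsingleton_linearMap_iff] at hs
  obtain ⟨r, hr, hreg⟩ := hs
  rw [hC, Submodule.mem_bot] at hr
  subst hr
  intro c hc
  have : (⟨c, hc⟩ : K) = 0 := hreg (by simp)
  exact congrArg Subtype.val this

lemma semidual_ideal (C : ModuleCat.{0} R) (hC : IsSemidualizing C) :
    ∃ I : Ideal R, I ≠ ⊥ ∧ Nonempty (C ≃ₗ[R] I) ∧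
      ∀ x y : R, x ≠ 0 → (∀ r, x ∣ y * r → x ∣ r) →
        ∀ f ∈ I, ∀ f' ∈ I, y * f = x * f' → ∃ f'' ∈ I, f = x * f'' := by
  obtain ⟨hfin, hbij, hext⟩ := hC
  have hann : Module.annihilator R C = ⊥ := annihilator_eq_bot_of_lsmul hbij.1
  have htf : ∀ x : R, x ≠ 0 → ∀ c : C, x • c = 0 → c = 0 := by
    intro x hx
    refine regular_of_hom (C := C) hann x ?_
    intro f hf
    obtain ⟨r, rfl⟩ := hbij.2 f
    have : LinearMap.lsmul R C (x * r) = 0 := by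
      rw [← hf]; ext c; simp [mul_smul]
    have h0 := hbij.1 (this.trans (map_zero _).symm)
    rcases mul_eq_zero.1 h0 with h | h
    · exact absurd h hx
    · simp [h]
  have hne : ∃ ψ : C →ₗ[R] R, ψ ≠ 0 := by
    by_contra hcon
    push Not at hcon
    have hs : Subsingleton (C →ₗ[R] R) := ⟨fun f g => by rw [hcon f, hcon g]⟩
    rw [IsSMulRegular.subsingleton_linearMap_iff] at hs
    obtain ⟨r, hr, hreg⟩ := hs
    rw [hann, Submodule.mem_bot] at hr
    subst hr
    exact zero_ne_one (hreg (by simp : (0:R) • (0:R) = (0:R) • (1:R)))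
  obtain ⟨ψ, hψ⟩ := hne
  obtain ⟨c0, hc0⟩ : ∃ c0, ψ c0 ≠ 0 := by
    by_contra hcon
    push Not at hcon
    exact hψ (by ext c; simpa using hcon c)
  have hinj : Function.Injective ψ := by
    rw [← LinearMap.ker_eq_bot, eq_bot_iff]
    intro c hc
    rw [LinearMap.mem_ker] at hc
    obtain ⟨r, hr⟩ := hbij.2 (LinearMap.toSpanSingleton R C c ∘ₗ ψ)
    have h1 : r • c = 0 := by
      have h := congrArg (fun t => t c) hr
      have h' : r • c = ψ c • c := h
      rw [h', hc, zero_smul]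
    have h2 : r • c0 = ψ c0 • c := by
      have h := congrArg (fun t => t c0) hr
      exact h
    by_cases hr0 : r = 0
    · rw [hr0, zero_smul] at h2
      exact htf _ hc0 c h2.symm
    · exact htf r hr0 c h1
  let e : C ≃ₗ[R] LinearMap.range ψ := LinearEquiv.ofInjective ψ hinj
  refine ⟨LinearMap.range ψ, ?_, ⟨e⟩, ?_⟩
  · intro h
    apply hc0
    have : ψ c0 ∈ LinearMap.range ψ := ⟨c0, rfl⟩
    rw [h] at this
    simpa using this
  · rintro x y hx hreg f ⟨c, rfl⟩ f' ⟨c', rfl⟩ hff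
    let W : Submodule R C := LinearMap.range (LinearMap.lsmul R C x)
    have hker : ∀ c, W.mkQ c = 0 ↔ ∃ c', c = x • c' := by
      intro c
      rw [Submodule.mkQ_apply, Submodule.Quotient.mk_eq_zero]
      constructor
      · rintro ⟨c', h⟩; exact ⟨c', h.symm⟩
      · rintro ⟨c', h⟩; exact ⟨c', h.symm⟩
    have hmain := regular_of_hom (C := C) (M := C ⧸ W) hann y (by
      intro h hh
      obtain ⟨g, hg⟩ := lift_mod_of_ext C x (htf x hx) (hext 1 le_rfl) W.mkQ
        (Submodule.mkQ_surjective W) hker h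
      obtain ⟨r, rfl⟩ := hbij.2 g
      have h1 : ∀ c : C, ∃ c', (y * r) • c = x • c' := by
        intro c
        rw [← hker]
        have := congrArg (fun t => t c) hh
        rw [← hg] at this
        rw [mul_smul, map_smul]
        exact this
      choose ρ hρ using h1
      have hinj : ∀ c c' : C, x • c = x • c' → c = c' := fun c c' hh => by
        rw [← sub_eq_zero]; apply htf x hx; rw [smul_sub, hh, sub_self]
      let ρl : C →ₗ[R] C :=
        { toFun := ρ
          map_add' := fun a b => hinj _ _ (by rw [← hρ, smul_add, hρ, hρ, smul_add])
          map_smul' := fun s a => hinj _ _ (by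
            rw [← hρ, smul_comm, hρ, RingHom.id_apply, smul_comm]) }
      obtain ⟨r', hr'⟩ := hbij.2 ρl
      have h2 : y * r = x * r' := by
        apply hbij.1
        ext c
        have := congrArg (fun t => t c) hr'
        have h3 : r' • c = ρ c := this
        simp only [LinearMap.lsmul_apply]
        rw [hρ, mul_smul, h3]
      obtain ⟨r'', rfl⟩ := hreg r ⟨r', h2⟩
      rw [← hg]
      ext c
      simp only [LinearMap.comp_apply, LinearMap.lsmul_apply, LinearMap.zero_apply]
      rw [hker]
      exact ⟨r'' • c, by rw [mul_smul]⟩)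
    have hyc : y • c = x • c' := hinj (by rw [map_smul, map_smul]; exact hff)
    have := hmain (W.mkQ c) (by rw [← map_smul, hker]; exact ⟨_, hyc⟩)
    rw [hker] at this
    obtain ⟨c'', rfl⟩ := this
    exact ⟨ψ c'', ⟨c'', rfl⟩, by rw [map_smul]; rfl⟩

end Semidual

section MonomialIdeal
open MvPolynomial
variable {τ : Type} {k : Type} [Field k]

lemma min_mul (F : (τ →₀ ℕ) →+ ℤ) (s t : MvPolynomial τ k) (hs : s ≠ 0) (ht : t ≠ 0) :
    ∃ a ∈ s.support, ∃ b ∈ t.support, (∀ a' ∈ s.support, F a ≤ F a') ∧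
      (∀ b' ∈ t.support, F b ≤ F b') ∧ a + b ∈ (s * t).support := by
  classical
  have hs' : s.support.Nonempty := by rwa [Finset.nonempty_iff_ne_empty, Ne, support_eq_empty]
  have ht' : t.support.Nonempty := by rwa [Finset.nonempty_iff_ne_empty, Ne, support_eq_empty]
  obtain ⟨a0, ha0, ha0m⟩ := s.support.exists_min_image F hs'
  obtain ⟨b0, hb0, hb0m⟩ := t.support.exists_min_image F ht'
  let A := s.support.filter (fun v => F v = F a0)
  let B := t.support.filter (fun v => F v = F b0)
  have hA : A.Nonempty := ⟨a0, Finset.mem_filter.2 ⟨ha0, rfl⟩⟩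
  have hB : B.Nonempty := ⟨b0, Finset.mem_filter.2 ⟨hb0, rfl⟩⟩
  obtain ⟨a, ha, b, hb, hu⟩ := UniqueSums.uniqueAdd_of_nonempty hA hB
  simp only [A, Finset.mem_filter] at ha
  simp only [B, Finset.mem_filter] at hb
  refine ⟨a, ha.1, b, hb.1, fun a' h => ha.2 ▸ ha0m a' h, fun b' h => hb.2 ▸ hb0m b' h, ?_⟩
  rw [mem_support_iff, coeff_mul, Finset.sum_eq_single (a, b)]
  · exact mul_ne_zero (mem_support_iff.1 ha.1) (mem_support_iff.1 hb.1)
  · rintro ⟨x, y⟩ hxy hne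
    rw [Finset.HasAntidiagonal.mem_antidiagonal] at hxy
    by_contra hcon
    have hx : x ∈ s.support := mem_support_iff.2 (left_ne_zero_of_mul hcon)
    have hy : y ∈ t.support := mem_support_iff.2 (right_ne_zero_of_mul hcon)
    have h1 := ha0m x hx
    have h2 := hb0m y hy
    have h3 : F x + F y = F a + F b := by rw [← map_add, ← map_add]; exact congrArg F hxy
    have h4 := hu (a := x) (b := y) (by simp only [A, Finset.mem_filter]; exact ⟨hx, by omega⟩)
      (by simp only [B, Finset.mem_filter]; exact ⟨hy, by omega⟩) hxy
    exact hne (Prod.ext h4.1 h4.2)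
  · intro h
    simp at h

/-- dividing by a monomial -/
lemma exists_div_monomial (t : MvPolynomial τ k) (α : τ →₀ ℕ) (h : ∀ v ∈ t.support, α ≤ v) :
    ∃ r : MvPolynomial τ k, monomial α 1 * r = t ∧ ∀ v, v ∈ r.support ↔ α + v ∈ t.support := by
  classical
  refine ⟨t.divMonomial α, ?_, ?_⟩
  · ext v
    rw [coeff_monomial_mul']
    split_ifs with hv
    · rw [coeff_divMonomial, one_mul, add_tsub_cancel_of_le hv]
    · symm
      by_contra hc
      exact hv (h v (mem_support_iff.2 hc))
  · intro v
    rw [mem_support_iff, mem_support_iff, coeff_divMonomial]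

/-- a maximal common divisor -/
lemma exists_common_divisor (P : MvPolynomial τ k → Prop) (t0 : MvPolynomial τ k) (h0 : P t0)
    (hne : t0 ≠ 0) : ∃ g : MvPolynomial τ k, (∀ t, P t → g ∣ t) ∧
      ∀ p, Prime p → ∃ t, P t ∧ ¬ g * p ∣ t := by
  let X : Set (MvPolynomial τ k) := {h | ∃ g, (∀ t, P t → g ∣ t) ∧ t0 = g * h}
  have hX : X.Nonempty := ⟨t0, 1, fun t _ => one_dvd t, by simp⟩
  obtain ⟨h, ⟨g, hg, hgh⟩, hmin⟩ :=
    (show WellFounded (DvdNotUnit (α := MvPolynomial τ k)) from IsWellFounded.wf).has_min X hX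
  refine ⟨g, hg, fun p hp => ?_⟩
  by_contra hcon
  push Not at hcon
  obtain ⟨h', hh'⟩ := hcon t0 h0
  have hg0 : g ≠ 0 := by rintro rfl; simp [hgh] at hne
  have : h = h' * p := mul_left_cancel₀ hg0 (by rw [← hgh, hh']; ring)
  have hh0 : h' ≠ 0 := by rintro rfl; simp [hh'] at hne
  exact hmin h' ⟨g * p, hcon, hh'⟩ ⟨hh0, p, hp.not_isUnit, this⟩

/-- correspondence of ideals gives an isomorphism -/
lemma iso_of_corr {R T : Type} [CommRing R] [CommRing T] [IsDomain T] (φ : R →+* T)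
    (hφ : Function.Injective φ) (I J : Ideal R) (a b : T) (ha : a ≠ 0) (hb : b ≠ 0)
    (h1 : ∀ i ∈ I, ∃ j ∈ J, a * φ i = b * φ j) (h2 : ∀ j ∈ J, ∃ i ∈ I, a * φ i = b * φ j) :
    Nonempty (I ≃ₗ[R] J) := by
  choose! f hf hf' using h1
  have hinj : ∀ x y, b * φ x = b * φ y → x = y := fun x y h => hφ (mul_left_cancel₀ hb h)
  let L : I →ₗ[R] J :=
    { toFun := fun i => ⟨f i, hf i i.2⟩
      map_add' := fun x y => by
        ext
        apply hinj
        change b * φ (f (x + y)) = b * φ (f x + f y)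
        rw [← hf' _ (I.add_mem x.2 y.2), map_add, map_add, mul_add, mul_add, ← hf' _ x.2,
          ← hf' _ y.2]
      map_smul' := fun r x => by
        ext
        apply hinj
        change b * φ (f (r * x)) = b * φ (r * f x)
        rw [← hf' _ (I.mul_mem_left r x.2), map_mul, map_mul, mul_left_comm, hf' _ x.2]
        ring }
  refine ⟨LinearEquiv.ofBijective L ⟨?_, ?_⟩⟩
  · intro x y h
    have h' : f x = f y := congrArg Subtype.val h
    ext
    refine hφ (mul_left_cancel₀ ha ?_)
    rw [hf' _ x.2, hf' _ y.2, h']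
  · rintro ⟨j, hj⟩
    obtain ⟨i, hi, hij⟩ := h2 j hj
    refine ⟨⟨i, hi⟩, ?_⟩
    ext
    apply hinj
    change b * φ (f i) = _
    rw [← hf' i hi, hij]

end MonomialIdeal

section MonomialIdeal2
open MvPolynomial
variable {τ : Type} {k : Type} [Field k] {R : Type} [CommRing R]

/-- The (embedded) ring `R` is cut out by finitely many linear forms. -/
structure ConeData (φ : R →+* MvPolynomial τ k) (𝓕 : Finset ((τ →₀ ℕ) →+ ℤ)) (u : τ →₀ ℕ) :
    Prop where
  inj : Function.Injective φ
  range : ∀ t, (∃ r, φ r = t) ↔ ∀ v ∈ t.support, ∀ F ∈ 𝓕, 0 ≤ F v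
  le : ∀ a b : τ →₀ ℕ, (∀ F ∈ 𝓕, F b ≤ F a) → b ≤ a
  u_mem : ∀ F ∈ 𝓕, 0 ≤ F u
  u_zero : ∀ F ∈ 𝓕, F u = 0 → ∀ s, (∀ G ∈ 𝓕, 0 ≤ G s) → F s = 0

variable {φ : R →+* MvPolynomial τ k} {𝓕 : Finset ((τ →₀ ℕ) →+ ℤ)} {u : τ →₀ ℕ}

def FacetCond (𝓕 : Finset ((τ →₀ ℕ) →+ ℤ)) (u : τ →₀ ℕ) : Prop :=
  ∀ F ∈ 𝓕, 0 < F u → ∃ s, (∀ G ∈ 𝓕, 0 ≤ G s) ∧ F s = 0 ∧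
    ∀ G ∈ 𝓕, G ≠ F → 0 < G u → 0 < G s

lemma ConeData.exists_minimal (h : ConeData φ 𝓕 u) :
    ∃ 𝓖 : Finset ((τ →₀ ℕ) →+ ℤ), ConeData φ 𝓖 u ∧ FacetCond 𝓖 u ∧
      ∀ s, (∀ G ∈ 𝓖, 0 ≤ G s) ↔ (∀ G ∈ 𝓕, 0 ≤ G s) := by
  classical
  let P : Finset ((τ →₀ ℕ) →+ ℤ) → Prop := fun 𝓖 => 𝓖 ⊆ 𝓕 ∧
    ∀ a b : τ →₀ ℕ, (∀ F ∈ 𝓖, F b ≤ F a) → ∀ F ∈ 𝓕, F b ≤ F a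
  obtain ⟨𝓖, ⟨hsub, hP⟩, hmin⟩ := (wellFounded_lt (α := Finset ((τ →₀ ℕ) →+ ℤ))).has_min
    {𝓖 | P 𝓖} ⟨𝓕, subset_rfl, fun a b hh => hh⟩
  have heq : ∀ s, (∀ G ∈ 𝓖, 0 ≤ G s) ↔ (∀ G ∈ 𝓕, 0 ≤ G s) := fun s =>
    ⟨fun hs => by simpa using hP s 0 (by simpa using hs), fun hs G hG => hs G (hsub hG)⟩
  have hcone : ConeData φ 𝓖 u :=
    { inj := h.inj
      range := fun t => by
        rw [h.range]
        exact forall₂_congr fun v _ => (heq v).symm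
      le := fun a b hh => h.le a b (hP a b hh)
      u_mem := fun F hF => h.u_mem F (hsub hF)
      u_zero := fun F hF h0 s hs => h.u_zero F (hsub hF) h0 s ((heq s).1 hs) }
  refine ⟨𝓖, hcone, ?_, heq⟩
  intro F hF hFu
  have hnot : ¬ P (𝓖.erase F) := fun hP' => hmin _ hP' (Finset.erase_ssubset hF)
  have : ∃ a b : τ →₀ ℕ, (∀ G ∈ 𝓖.erase F, G b ≤ G a) ∧ ¬ (∀ G ∈ 𝓕, G b ≤ G a) := by
    by_contra hcon
    push Not at hcon
    exact hnot ⟨(Finset.erase_subset _ _).trans hsub, hcon⟩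
  obtain ⟨a, b, hab, hnab⟩ := this
  have hFab : F a < F b := by
    by_contra hcon
    push Not at hcon
    refine hnab (hP a b fun G hG => ?_)
    by_cases hGF : G = F
    · exact hGF ▸ hcon
    · exact hab G (Finset.mem_erase.2 ⟨hGF, hG⟩)
  obtain ⟨x, hx⟩ := Int.eq_ofNat_of_zero_le hFu.le
  obtain ⟨y, hy⟩ := Int.eq_ofNat_of_zero_le (sub_nonneg.2 hFab.le)
  have hval : ∀ G : (τ →₀ ℕ) →+ ℤ, G (x • a + y • u) = F u * G a + (F b - F a) * G u := by
    intro G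
    rw [map_add, map_nsmul, map_nsmul, hx, hy]; simp
  have hval2 : ∀ G : (τ →₀ ℕ) →+ ℤ, G (x • b) = F u * G b := by
    intro G
    rw [map_nsmul, hx]; simp
  have hle : x • b ≤ x • a + y • u := by
    refine hcone.le _ _ fun G hG => ?_
    rw [hval, hval2]
    by_cases hGF : G = F
    · subst hGF; nlinarith
    · have h1 := hab G (Finset.mem_erase.2 ⟨hGF, hG⟩)
      have h2 := hcone.u_mem G hG
      nlinarith
  obtain ⟨s, hs⟩ := exists_add_of_le hle
  have hsv : ∀ G : (τ →₀ ℕ) →+ ℤ, G s = F u * (G a - G b) + (F b - F a) * G u := by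
    intro G
    have := congrArg G hs
    rw [hval, map_add, hval2] at this
    linarith
  refine ⟨s, fun G hG => ?_, ?_, fun G hG hGF hGu => ?_⟩
  · rw [hsv]
    by_cases hGF : G = F
    · subst hGF; nlinarith
    · have h1 := hab G (Finset.mem_erase.2 ⟨hGF, hG⟩)
      have h2 := hcone.u_mem G hG
      nlinarith
  · rw [hsv]; ring
  · rw [hsv]
    have h1 := hab G (Finset.mem_erase.2 ⟨hGF, hG⟩)
    nlinarith

/-- homogeneity with respect to the forms vanishing on the cone -/
lemma ConeData.homog (h : ConeData φ 𝓕 u) (F : (τ →₀ ℕ) →+ ℤ) (hF : F ∈ 𝓕) (hu : F u = 0)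
    (g a : MvPolynomial τ k) (hg : g ≠ 0) (ha : a ≠ 0) (hga : ∃ r, φ r = g * a) :
    ∀ x ∈ g.support, ∀ y ∈ a.support, F x + F y = 0 := by
  rw [h.range] at hga
  have hz : ∀ v ∈ (g * a).support, F v = 0 := fun v hv => h.u_zero F hF hu v (hga v hv)
  obtain ⟨a1, ha1, b1, hb1, m1, m2, h1⟩ := min_mul F g a hg ha
  obtain ⟨a2, ha2, b2, hb2, m3, m4, h2⟩ := min_mul (-F) g a hg ha
  have e1 := hz _ h1
  have e2 := hz _ h2
  rw [map_add] at e1 e2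
  intro x hx y hy
  have := m1 x hx
  have := m2 y hy
  have := m1 a2 ha2
  have := m2 b2 hb2
  have := m3 x hx
  have := m4 y hy
  simp only [AddMonoidHom.neg_apply] at *
  omega

end MonomialIdeal2

section MonomialIdeal3
open MvPolynomial
variable {τ : Type} {k : Type} [Field k] {R : Type} [CommRing R]
variable {φ : R →+* MvPolynomial τ k} {𝓕 : Finset ((τ →₀ ℕ) →+ ℤ)} {u : τ →₀ ℕ}

lemma support_monomial_mul_mem (α : τ →₀ ℕ) (t : MvPolynomial τ k) (v : τ →₀ ℕ) :
    v ∈ (monomial α (1 : k) * t).support ↔ ∃ w ∈ t.support, v = α + w := by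
  classical
  rw [mem_support_iff, coeff_monomial_mul']
  constructor
  · intro h
    split_ifs at h with hv
    · exact ⟨v - α, mem_support_iff.2 (by simpa using h), (add_tsub_cancel_of_le hv).symm⟩
    · exact absurd rfl h
  · rintro ⟨w, hw, rfl⟩
    rw [if_pos le_self_add, add_tsub_cancel_left, one_mul]
    exact mem_support_iff.1 hw

/-- splitting off the monomial part -/
lemma exists_monomial_part (X : MvPolynomial τ k) (hX : X ≠ 0) :
    ∃ α x', X = monomial α (1 : k) * x' ∧
      ∀ p, Prime p → p ∣ x' → ∀ β, ¬ p ∣ monomial β (1 : k) := by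
  let S : Set (MvPolynomial τ k) := {x' | ∃ α, X = monomial α (1 : k) * x'}
  have hS : S.Nonempty := ⟨X, 0, by simp⟩
  obtain ⟨x', ⟨α, hα⟩, hmin⟩ :=
    (show WellFounded (DvdNotUnit (α := MvPolynomial τ k)) from IsWellFounded.wf).has_min S hS
  refine ⟨α, x', hα, ?_⟩
  rintro p hp ⟨h, rfl⟩ β hβ
  obtain ⟨m, c, -, hc, rfl⟩ := dvd_monomial_one_iff_exists.1 hβ
  have hsplit : (monomial m c : MvPolynomial τ k) = monomial m 1 * C c := by
    rw [mul_comm, C_mul_monomial, mul_one]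
  refine hmin (C c * h) ⟨α + m, ?_⟩ ⟨?_, monomial m 1, ?_, ?_⟩
  · rw [hα, hsplit]
    rw [show (monomial (α + m) (1 : k)) = monomial α 1 * monomial m 1 by
      rw [monomial_mul, mul_one]]
    ring
  · intro h0
    apply hX
    rw [hα, hsplit, mul_assoc (monomial m 1), h0]; simp
  · intro hu
    apply hp.not_isUnit
    rw [hsplit]
    exact hu.mul (hc.map C)
  · rw [hsplit]; ring

lemma ConeData.homog_eq (h : ConeData φ 𝓕 u) (F : (τ →₀ ℕ) →+ ℤ) (hF : F ∈ 𝓕) (hu : F u = 0)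
    (g a b : MvPolynomial τ k) (hg : g ≠ 0) (hga : ∃ r, φ r = g * a) (hgb : ∃ r, φ r = g * b)
    (x y) (hx : x ∈ a.support) (hy : y ∈ b.support) : F x = F y := by
  have ha : a ≠ 0 := by rintro rfl; simp at hx
  have hb : b ≠ 0 := by rintro rfl; simp at hy
  obtain ⟨γ, hγ⟩ := Finset.nonempty_iff_ne_empty.2 (mt support_eq_empty.1 hg)
  have h1 := h.homog F hF hu g a hg ha hga γ hγ x hx
  have h2 := h.homog F hF hu g b hg hb hgb γ hγ y hy
  omega

/-- The unified construction of elements of the colon ideal. -/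
lemma ConeData.unified (h : ConeData φ 𝓕 u) (I : Ideal R) (g : MvPolynomial τ k) (hg : g ≠ 0)
    (a0 a : MvPolynomial τ k) (h0 : ∃ i ∈ I, φ i = g * a0) (hi : ∃ i ∈ I, φ i = g * a)
    (w w' s : τ →₀ ℕ) (hw : w ∈ a0.support) (hw' : w' ∈ a.support)
    (hs : ∀ G ∈ 𝓕, 0 ≤ G s)
    (hG : ∀ G ∈ 𝓕, G u = 0 ∨ 1 ≤ G s ∨ ((∀ a' ∈ a.support, G w' ≤ G a') ∧ G w' ≤ G w)) :
    ∃ (N : ℕ) (x : R), (∃ i ∈ I, φ i = φ x * (g * monomial w (1 : k))) ∧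
      monomial w' (1 : k) * φ x = monomial (N • s) (1 : k) * a := by
  classical
  obtain ⟨i0, hi0, hi0'⟩ := h0
  obtain ⟨i, hi, hi'⟩ := hi
  -- choose N
  let B : Finset (τ →₀ ℕ) := insert w a.support
  have hbd : ∃ N : ℕ, ∀ G ∈ 𝓕, ∀ b ∈ B, G w' - G b ≤ N := by
    refine ⟨∑ G ∈ 𝓕, ∑ b ∈ B, (G w' - G b).toNat, fun G hG b hb => ?_⟩
    have h1 : (G w' - G b).toNat ≤ ∑ b ∈ B, (G w' - G b).toNat :=
      Finset.single_le_sum (f := fun b => (G w' - G b).toNat) (fun _ _ => Nat.zero_le _) hb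
    have h2 : ∑ b ∈ B, (G w' - G b).toNat ≤ ∑ G ∈ 𝓕, ∑ b ∈ B, (G w' - G b).toNat :=
      Finset.single_le_sum (f := fun G : (τ →₀ ℕ) →+ ℤ => ∑ b ∈ B, (G w' - G b).toNat)
        (fun _ _ => Nat.zero_le _) hG
    have := Int.self_le_toNat (G w' - G b)
    omega
  obtain ⟨N, hN⟩ := hbd
  have key : ∀ b ∈ B, ∀ G ∈ 𝓕, G w' ≤ G (N • s + b) := by
    intro b hb G hGF
    rw [map_add, map_nsmul, nsmul_eq_mul]
    rcases hG G hGF with h1 | h1 | h1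
    · have hz : G s = 0 := h.u_zero G hGF h1 s hs
      have : G b = G w' := by
        rcases Finset.mem_insert.1 hb with rfl | hb
        · exact h.homog_eq G hGF h1 g a0 a hg ⟨i0, hi0'⟩ ⟨i, hi'⟩ _ _ hw hw'
        · exact h.homog_eq G hGF h1 g a a hg ⟨i, hi'⟩ ⟨i, hi'⟩ _ _ hb hw'
      rw [hz, this]; simp
    · have := hN G hGF b hb
      nlinarith
    · have h2 := hs G hGF
      have h3 : G w' ≤ G b := by
        rcases Finset.mem_insert.1 hb with rfl | hb
        · exact h1.2
        · exact h1.1 b hb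
      have : 0 ≤ (N : ℤ) * G s := by positivity
      omega
  obtain ⟨x', hx1, hx2⟩ := exists_div_monomial (monomial (N • s) (1 : k) * a) w' (by
    intro v hv
    obtain ⟨b, hb, rfl⟩ := (support_monomial_mul_mem _ _ _).1 hv
    exact h.le _ _ (key b (Finset.mem_insert_of_mem hb)))
  obtain ⟨x, hx⟩ := (h.range x').2 (by
    intro v hv G hGF
    obtain ⟨b, hb, he⟩ := (support_monomial_mul_mem _ _ _).1 ((hx2 v).1 hv)
    have h1 := key b (Finset.mem_insert_of_mem hb) G hGF
    rw [← he, map_add] at h1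
    omega)
  obtain ⟨e, he⟩ := exists_add_of_le (h.le (N • s + w) w' (key w (Finset.mem_insert_self _ _)))
  obtain ⟨ρ, hρ⟩ := (h.range (monomial e (1 : k))).2 (by
    intro v hv G hGF
    have hv' : v = e := by
      have := support_monomial_subset hv
      simpa using this
    subst hv'
    have h1 := key w (Finset.mem_insert_self _ _) G hGF
    rw [he, map_add] at h1
    omega)
  refine ⟨N, x, ⟨ρ * i, I.mul_mem_left _ hi, ?_⟩, by rw [hx, hx1]⟩
  have hne : (monomial w' (1 : k)) ≠ 0 := by simp
  apply mul_left_cancel₀ hne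
  rw [map_mul, hρ, hi', hx, ← mul_assoc, ← mul_assoc (monomial w' 1), hx1, monomial_mul,
    ← he, mul_one]
  rw [show (monomial (N • s + w) (1 : k)) = monomial (N • s) 1 * monomial w 1 by
      rw [monomial_mul, mul_one]]
  ring

/-- the prime ideal of a facet -/
def facetIdeal (φ : R →+* MvPolynomial τ k) (F : (τ →₀ ℕ) →+ ℤ)
    (hF : ∀ r, ∀ v ∈ (φ r).support, 0 ≤ F v) : Ideal R where
  carrier := {r | ∀ v ∈ (φ r).support, 0 < F v}
  zero_mem' := by simp
  add_mem' := by
    classical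
    intro a b ha hb v hv
    rw [map_add] at hv
    rcases Finset.mem_union.1 (support_add hv) with h | h
    · exact ha v h
    · exact hb v h
  smul_mem' := by
    classical
    intro c x hx v hv
    rw [smul_eq_mul, map_mul] at hv
    obtain ⟨a, ha, b, hb, rfl⟩ := Finset.mem_add.1 (support_mul _ _ hv)
    have := hF c a ha
    have := hx b hb
    rw [map_add]; omega

lemma facetIdeal_prime (φ : R →+* MvPolynomial τ k) (F : (τ →₀ ℕ) →+ ℤ)
    (hF : ∀ r, ∀ v ∈ (φ r).support, 0 ≤ F v) : (facetIdeal φ F hF).IsPrime := by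
  classical
  constructor
  · rw [Ne, Ideal.eq_top_iff_one]
    intro h
    have := h 0 (by simp)
    simp at this
  · intro x y hxy
    by_contra hcon
    push Not at hcon
    obtain ⟨h1, h2⟩ := hcon
    change ¬ ∀ v ∈ (φ x).support, 0 < F v at h1
    change ¬ ∀ v ∈ (φ y).support, 0 < F v at h2
    push Not at h1 h2
    obtain ⟨v1, hv1, hv1'⟩ := h1
    obtain ⟨v2, hv2, hv2'⟩ := h2
    obtain ⟨a, ha, b, hb, ma, mb, hab⟩ := min_mul F (φ x) (φ y)
      (by rintro h; simp [h] at hv1) (by rintro h; simp [h] at hv2)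
    rw [← map_mul] at hab
    have := hxy _ hab
    rw [map_add] at this
    have := ma _ hv1
    have := mb _ hv2
    omega

/-- regularity criterion -/
lemma ConeData.regular (h : ConeData φ 𝓕 u) (x y : R) (hx : x ≠ 0)
    (h1 : ∀ F ∈ 𝓕, 0 < F u → ∃ v ∈ (φ y).support, F v ≤ 0)
    (h2 : ∀ p, Prime p → p ∣ φ x → (∀ β, ¬ p ∣ monomial β (1 : k)) → ¬ p ∣ φ y)
    (hy0 : φ y ≠ 0)
    (r : R) (hr : x ∣ y * r) : x ∣ r := by
  obtain ⟨q, hq⟩ := hr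
  have hφ := h.inj
  by_cases hr0 : r = 0
  · rw [hr0]; exact dvd_zero x
  have hne : ∀ z : R, z ≠ 0 → φ z ≠ 0 := fun z hz h0 => hz (hφ (by rw [h0, map_zero]))
  have hmem : ∀ z : R, ∀ v ∈ (φ z).support, ∀ F ∈ 𝓕, 0 ≤ F v := fun z => (h.range _).1 ⟨z, rfl⟩
  obtain ⟨α, x', hα, hx'⟩ := exists_monomial_part (φ x) (hne x hx)
  have hx'0 : x' ≠ 0 := by rintro rfl; exact hne x hx (by rw [hα, mul_zero])
  have hq' : φ y * φ r = φ x * φ q := by rw [← map_mul, ← map_mul, hq]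
  have hd : x' ∣ φ r := by
    refine UniqueFactorizationMonoid.dvd_of_dvd_mul_left_of_no_prime_factors (c := φ y) hx'0 ?_ ?_
    · intro p hp1 hp2 hp
      exact h2 p hp (hα ▸ hp1.mul_left _) (hx' p hp hp1) hp2
    · rw [mul_comm, hq', hα, mul_assoc]
      exact (dvd_mul_right _ _).mul_left _
  obtain ⟨t, ht⟩ := hd
  have ht0 : t ≠ 0 := by rintro rfl; exact hne r hr0 (by rw [ht, mul_zero])
  have heq : φ y * t = monomial α 1 * φ q := by
    apply mul_left_cancel₀ hx'0
    calc x' * (φ y * t) = φ y * (x' * t) := by ring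
      _ = φ x * φ q := by rw [← ht, hq']
      _ = _ := by rw [hα]; ring
  have hle : ∀ v ∈ t.support, ∀ F ∈ 𝓕, F α ≤ F v := by
    intro v hv F hF
    obtain ⟨a, ha, b, hb, ma, mb, hab⟩ := min_mul F (φ y) t hy0 ht0
    have hFa : F a = 0 := by
      rcases (h.u_mem F hF).eq_or_lt with h0 | h0
      · exact h.u_zero F hF h0.symm a (hmem y a ha)
      · obtain ⟨v0, hv0, hv0'⟩ := h1 F hF h0
        have := ma v0 hv0
        have := hmem y a ha F hF
        omega
    rw [heq] at hab
    obtain ⟨w, hw, he⟩ := (support_monomial_mul_mem _ _ _).1 hab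
    have h3 := congrArg F he
    rw [map_add, map_add] at h3
    have := hmem q w hw F hF
    have := mb v hv
    omega
  obtain ⟨t', ht1, ht2⟩ := exists_div_monomial t α (fun v hv => h.le _ _ (hle v hv))
  obtain ⟨r', hr'⟩ := (h.range t').2 (by
    intro v hv F hF
    have := hle _ ((ht2 v).1 hv) F hF
    rw [map_add] at this
    omega)
  refine ⟨r', hφ ?_⟩
  rw [map_mul, hr', ht, hα, ← ht1]
  ring

/-- The ideal `I` contains all the monomial components. -/
lemma ConeData.monomial_mem (h : ConeData φ 𝓕 u) (hfac : FacetCond 𝓕 u) (I : Ideal R)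
    (hP : ∀ x y : R, x ≠ 0 → (∀ r, x ∣ y * r → x ∣ r) → ∀ f ∈ I, ∀ f' ∈ I, y * f = x * f' →
      ∃ f'' ∈ I, f = x * f'')
    (g : MvPolynomial τ k) (hg : g ≠ 0)
    (hg1 : ∀ i ∈ I, g ∣ φ i)
    (hg2 : ∀ p, Prime p → ∃ i ∈ I, ¬ g * p ∣ φ i)
    (a0 : MvPolynomial τ k) (h0 : ∃ i ∈ I, φ i = g * a0) (w : τ →₀ ℕ) (hw : w ∈ a0.support) :
    ∃ i ∈ I, φ i = g * monomial w (1 : k) := by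
  classical
  have hφ := h.inj
  have hmem : ∀ z : R, ∀ v ∈ (φ z).support, ∀ F ∈ 𝓕, 0 ≤ F v := fun z => (h.range _).1 ⟨z, rfl⟩
  let 𝔞 : Ideal R :=
    { carrier := {x | ∃ i ∈ I, φ i = φ x * (g * monomial w (1 : k))}
      zero_mem' := ⟨0, I.zero_mem, by simp⟩
      add_mem' := by
        rintro a b ⟨i, hi, hi'⟩ ⟨j, hj, hj'⟩
        exact ⟨i + j, I.add_mem hi hj, by rw [map_add, hi', hj', map_add, add_mul]⟩
      smul_mem' := by
        rintro c x ⟨i, hi, hi'⟩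
        exact ⟨c * i, I.mul_mem_left _ hi, by rw [map_mul, hi', smul_eq_mul, map_mul, mul_assoc]⟩ }
  -- facets
  have hfacet : ∀ F ∈ 𝓕, 0 < F u → ∃ x ∈ 𝔞, ∃ v ∈ (φ x).support, F v ≤ 0 := by
    intro F hF hFu
    obtain ⟨s, hs1, hs2, hs3⟩ := hfac F hF hFu
    obtain ⟨γ, hγ⟩ := Finset.nonempty_iff_ne_empty.2 (mt support_eq_empty.1 hg)
    obtain ⟨d, ⟨a, ⟨i, hi, hi'⟩, w', hw', rfl⟩, hmin⟩ := Int.exists_least_of_bdd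
      (P := fun d => ∃ a, (∃ i ∈ I, φ i = g * a) ∧ ∃ w' ∈ a.support, F w' = d)
      ⟨- F γ, by
        rintro d ⟨a, ⟨i, hi, hi'⟩, w', hw', rfl⟩
        obtain ⟨x, hx, y, hy, mx, my, hxy⟩ := min_mul F g a hg (by rintro rfl; simp at hw')
        rw [← hi'] at hxy
        have := hmem i _ hxy F hF
        rw [map_add] at this
        have := mx γ hγ
        have := my w' hw'
        omega⟩ ⟨F w, a0, h0, w, hw, rfl⟩
    obtain ⟨N, x, hx1, hx2⟩ := h.unified I g hg a0 a h0 ⟨i, hi, hi'⟩ w w' s hw hw' hs1 (by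
      intro G hG
      rcases (h.u_mem G hG).eq_or_lt with h1 | h1
      · exact Or.inl h1.symm
      by_cases hGF : G = F
      · subst hGF
        exact Or.inr (Or.inr ⟨fun a' ha' => hmin _ ⟨a, ⟨i, hi, hi'⟩, a', ha', rfl⟩,
          hmin _ ⟨a0, h0, w, hw, rfl⟩⟩)
      · exact Or.inr (Or.inl (hs3 G hG hGF h1)))
    refine ⟨x, hx1, N • s, ?_, ?_⟩
    · have h3 : N • s + w' ∈ (monomial w' (1 : k) * φ x).support := by
        rw [hx2]
        exact (support_monomial_mul_mem _ _ _).2 ⟨w', hw', rfl⟩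
      obtain ⟨v, hv, he⟩ := (support_monomial_mul_mem _ _ _).1 h3
      rw [add_comm] at he
      rwa [add_left_cancel he]
    · rw [map_nsmul, hs2]; simp
  have hprime : ∀ p, Prime p → (∀ β, ¬ p ∣ monomial β (1 : k)) → ∃ x ∈ 𝔞, ¬ p ∣ φ x := by
    intro p hp hpm
    obtain ⟨i, hi, hi'⟩ := hg2 p hp
    obtain ⟨a, ha⟩ := hg1 i hi
    have hpa : ¬ p ∣ a := fun hd => hi' (ha ▸ mul_dvd_mul_left g hd)
    have ha0 : a ≠ 0 := by rintro rfl; exact hpa (dvd_zero p)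
    obtain ⟨w', hw'⟩ := Finset.nonempty_iff_ne_empty.2 (mt support_eq_empty.1 ha0)
    obtain ⟨N, x, hx1, hx2⟩ := h.unified I g hg a0 a h0 ⟨i, hi, ha⟩ w w' u hw hw' h.u_mem (by
      intro G hG
      rcases (h.u_mem G hG).eq_or_lt with h1 | h1
      · exact Or.inl h1.symm
      · exact Or.inr (Or.inl h1))
    refine ⟨x, hx1, fun hd => ?_⟩
    have := hx2 ▸ hd.mul_left (monomial w' (1 : k))
    rcases hp.dvd_or_dvd this with h3 | h3
    · exact hpm _ h3
    · exact hpa h3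
  have hnz : ∃ x ∈ 𝔞, x ≠ 0 := by
    have ha0 : a0 ≠ 0 := by rintro rfl; simp at hw
    obtain ⟨N, x, hx1, hx2⟩ := h.unified I g hg a0 a0 h0 h0 w w u hw hw h.u_mem (by
      intro G hG
      rcases (h.u_mem G hG).eq_or_lt with h1 | h1
      · exact Or.inl h1.symm
      · exact Or.inr (Or.inl h1))
    refine ⟨x, hx1, ?_⟩
    rintro rfl
    rw [map_zero, mul_zero] at hx2
    exact mul_ne_zero (by simp) ha0 hx2.symm
  obtain ⟨x, hxa, hx0⟩ := hnz
  have hφx : φ x ≠ 0 := fun h0 => hx0 (hφ (by rw [h0, map_zero]))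
  let S1 : Finset (Ideal R) := (𝓕.filter (fun F => 0 < F u)).attach.image (fun F =>
    facetIdeal φ F.1 (fun r v hv => hmem r v hv _ (Finset.mem_filter.1 F.2).1))
  let S2 : Finset (Ideal R) := ((UniqueFactorizationMonoid.factors (φ x)).toFinset.filter
    (fun p => ∀ β, ¬ p ∣ monomial β (1 : k))).image (fun p => (Ideal.span {p}).comap φ)
  let S3 : Finset (Ideal R) := {⊥}
  haveI hdom : IsDomain R := hφ.isDomain φ
  obtain ⟨y, hya, hyS⟩ : ∃ y ∈ 𝔞, ∀ P ∈ S1 ∪ S2 ∪ S3, y ∉ P := by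
    by_contra hcon
    push Not at hcon
    have hsub : (𝔞 : Set R) ⊆ ⋃ P ∈ (↑(S1 ∪ S2 ∪ S3) : Set (Ideal R)), ((id P : Ideal R) : Set R) := by
      intro y hy
      obtain ⟨P, hP, hyP⟩ := hcon y hy
      exact Set.mem_biUnion (x := P) hP hyP
    rw [Ideal.subset_union_prime ⊥ ⊥] at hsub
    · obtain ⟨P, hPS, hle⟩ := hsub
      rcases Finset.mem_union.1 hPS with hPS | hPS
      · rcases Finset.mem_union.1 hPS with hPS | hPS
        · obtain ⟨⟨F, hF⟩, -, rfl⟩ := Finset.mem_image.1 hPS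
          obtain ⟨hF1, hF2⟩ := Finset.mem_filter.1 hF
          obtain ⟨z, hz, v, hv, hv'⟩ := hfacet F hF1 hF2
          have := hle hz v hv
          exact absurd this (not_lt.2 hv')
        · obtain ⟨p, hp, rfl⟩ := Finset.mem_image.1 hPS
          obtain ⟨hp1, hp2⟩ := Finset.mem_filter.1 hp
          obtain ⟨z, hz, hz'⟩ := hprime p
            (UniqueFactorizationMonoid.prime_of_factor p (Multiset.mem_toFinset.1 hp1)) hp2
          exact hz' (Ideal.mem_span_singleton.1 (hle hz))
      · rw [Finset.mem_singleton.1 hPS] at hle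
        exact hx0 (by simpa using hle hxa)
    · intro P hPS hPb _
      rcases Finset.mem_union.1 hPS with hPS | hPS
      · rcases Finset.mem_union.1 hPS with hPS | hPS
        · obtain ⟨⟨F, hF⟩, -, rfl⟩ := Finset.mem_image.1 hPS
          exact facetIdeal_prime _ _ _
        · obtain ⟨p, hp, rfl⟩ := Finset.mem_image.1 hPS
          obtain ⟨hp1, hp2⟩ := Finset.mem_filter.1 hp
          have hpp := UniqueFactorizationMonoid.prime_of_factor p (Multiset.mem_toFinset.1 hp1)
          haveI : (Ideal.span {p}).IsPrime := (Ideal.span_singleton_prime hpp.ne_zero).2 hpp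
          exact Ideal.comap_isPrime φ (Ideal.span {p})
      · exact absurd (Finset.mem_singleton.1 hPS) hPb
  have hy0 : y ≠ 0 := by
    rintro rfl
    exact hyS ⊥ (Finset.mem_union_right _ (Finset.mem_singleton_self _)) (Ideal.zero_mem _)
  have hφy : φ y ≠ 0 := fun h0 => hy0 (hφ (by rw [h0, map_zero]))
  have hreg : ∀ r, x ∣ y * r → x ∣ r := by
    refine h.regular x y hx0 ?_ ?_ hφy
    · intro F hF hFu
      by_contra hcon
      push Not at hcon
      refine hyS (facetIdeal φ F (fun r v hv => hmem r v hv _ hF)) ?_ hcon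
      refine Finset.mem_union_left _ (Finset.mem_union_left _ (Finset.mem_image.2
        ⟨⟨F, Finset.mem_filter.2 ⟨hF, hFu⟩⟩, Finset.mem_attach _ _, rfl⟩))
    · intro p hp hpx hpm hpy
      obtain ⟨q, hq, hpq⟩ := UniqueFactorizationMonoid.exists_mem_factors_of_dvd hφx
        hp.irreducible hpx
      refine hyS ((Ideal.span {q}).comap φ) ?_ (Ideal.mem_span_singleton.2 (hpq.dvd_iff_dvd_left.1 hpy))
      refine Finset.mem_union_left _ (Finset.mem_union_right _ (Finset.mem_image.2
        ⟨q, Finset.mem_filter.2 ⟨Multiset.mem_toFinset.2 hq, fun β hβ =>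
          hpm β (hpq.dvd_iff_dvd_left.2 hβ)⟩, rfl⟩))
  obtain ⟨i, hi, hi'⟩ := hxa
  obtain ⟨j, hj, hj'⟩ := hya
  obtain ⟨f, hf, hf'⟩ := hP x y hx0 hreg i hi j hj (hφ (by
    rw [map_mul, map_mul, hi', hj']; ring))
  refine ⟨f, hf, mul_left_cancel₀ hφx ?_⟩
  rw [← hi', hf', map_mul]

/-- Main result: the ideal is isomorphic to a monomial ideal. -/
lemma ConeData.exists_monomial_ideal (hd : ConeData φ 𝓕 u) (I : Ideal R) (hI : I ≠ ⊥)
    (hP : ∀ x y : R, x ≠ 0 → (∀ r, x ∣ y * r → x ∣ r) → ∀ f ∈ I, ∀ f' ∈ I, y * f = x * f' →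
      ∃ f'' ∈ I, f = x * f'') :
    ∃ (U : Set (τ →₀ ℕ)) (J : Ideal R), U.Nonempty ∧ (∀ v ∈ U, ∀ F ∈ 𝓕, 0 ≤ F v) ∧
      (∀ v ∈ U, ∀ s, (∀ F ∈ 𝓕, 0 ≤ F s) → v + s ∈ U) ∧
      (∀ r, r ∈ J ↔ ∀ v ∈ (φ r).support, v ∈ U) ∧ Nonempty (I ≃ₗ[R] J) := by
  classical
  obtain ⟨𝓖, h, hfac, heq⟩ := hd.exists_minimal
  simp only [← heq]
  have hφ := h.inj
  obtain ⟨i0, hi0, hi0'⟩ := Submodule.exists_mem_ne_zero_of_ne_bot hI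
  obtain ⟨g, hg1, hg2⟩ := exists_common_divisor (fun t => ∃ i ∈ I, φ i = t) (φ i0) ⟨i0, hi0, rfl⟩
    (fun h0 => hi0' (hφ (by rw [h0, map_zero])))
  replace hg1 : ∀ i ∈ I, g ∣ φ i := fun i hi => hg1 _ ⟨i, hi, rfl⟩
  replace hg2 : ∀ p, Prime p → ∃ i ∈ I, ¬ g * p ∣ φ i := by
    intro p hp
    obtain ⟨t, ⟨i, hi, rfl⟩, ht⟩ := hg2 p hp
    exact ⟨i, hi, ht⟩
  have hg : g ≠ 0 := by
    rintro rfl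
    have := hg1 i0 hi0
    rw [zero_dvd_iff] at this
    exact hi0' (hφ (by rw [this, map_zero]))
  obtain ⟨γ, hγ⟩ := Finset.nonempty_iff_ne_empty.2 (mt support_eq_empty.1 hg)
  have hmono : ∀ s : τ →₀ ℕ, (∀ F ∈ 𝓖, 0 ≤ F s) → ∀ c : k, ∃ r, φ r = monomial s c := by
    intro s hs c
    refine (h.range _).2 fun v hv => ?_
    have hv' : v = s := by simpa using support_monomial_subset hv
    exact hv' ▸ hs
  let W : Set (τ →₀ ℕ) := {w | ∃ i ∈ I, φ i = g * monomial w (1 : k)}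
  let U : Set (τ →₀ ℕ) := {v | ∃ w ∈ W, v = γ + w}
  have hUc : ∀ v ∈ U, ∀ F ∈ 𝓖, 0 ≤ F v := by
    rintro v ⟨w, ⟨i, hi, hi'⟩, rfl⟩
    refine (h.range _).1 ⟨i, rfl⟩ _ ?_
    rw [hi', mul_comm]
    exact (support_monomial_mul_mem _ _ _).2 ⟨γ, hγ, add_comm _ _⟩
  have hUs : ∀ v ∈ U, ∀ s, (∀ F ∈ 𝓖, 0 ≤ F s) → v + s ∈ U := by
    rintro v ⟨w, ⟨i, hi, hi'⟩, rfl⟩ s hs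
    obtain ⟨r, hr⟩ := hmono s hs 1
    refine ⟨w + s, ⟨i * r, I.mul_mem_right _ hi, ?_⟩, add_assoc _ _ _⟩
    rw [map_mul, hi', hr, mul_assoc, monomial_mul, mul_one]
  have hWm : ∀ a : MvPolynomial τ k, (∃ i ∈ I, φ i = g * a) → ∀ w ∈ a.support, w ∈ W :=
    fun a ha w hw => h.monomial_mem hfac I hP g hg hg1 hg2 a ha w hw
  have hWs : ∀ t : MvPolynomial τ k, (∀ w ∈ t.support, w ∈ W) → ∃ i ∈ I, φ i = g * t := by
    intro t ht
    choose! f hf hf' using ht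
    choose e he using fun c => hmono 0 (by simp) c
    refine ⟨∑ w ∈ t.support, e (coeff w t) * f w,
      I.sum_mem fun w hw => I.mul_mem_left _ (hf w hw), ?_⟩
    rw [map_sum]
    conv_rhs => rw [t.as_sum, Finset.mul_sum]
    refine Finset.sum_congr rfl fun w hw => ?_
    rw [map_mul, he, hf' w hw, mul_left_comm, monomial_mul, mul_one, zero_add]
  let J : Ideal R :=
    { carrier := {r | ∀ v ∈ (φ r).support, v ∈ U}
      zero_mem' := by simp
      add_mem' := by
        intro a b ha hb v hv
        rw [map_add] at hv
        rcases Finset.mem_union.1 (support_add hv) with h | h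
        · exact ha v h
        · exact hb v h
      smul_mem' := by
        intro c x hx v hv
        rw [smul_eq_mul, map_mul] at hv
        obtain ⟨a, ha, b, hb, rfl⟩ := Finset.mem_add.1 (support_mul _ _ hv)
        rw [add_comm]
        exact hUs _ (hx b hb) a ((h.range _).1 ⟨c, rfl⟩ a ha) }
  refine ⟨U, J, ?_, hUc, hUs, fun r => Iff.rfl, ?_⟩
  · obtain ⟨a, ha⟩ := hg1 i0 hi0
    have ha0 : a ≠ 0 := by
      rintro rfl
      rw [mul_zero] at ha
      exact hi0' (hφ (by rw [ha, map_zero]))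
    obtain ⟨w, hw⟩ := Finset.nonempty_iff_ne_empty.2 (mt support_eq_empty.1 ha0)
    exact ⟨_, w, hWm a ⟨i0, hi0, ha⟩ w hw, rfl⟩
  · refine iso_of_corr φ hφ I J (monomial γ 1) g (by simp) hg ?_ ?_
    · intro i hi
      obtain ⟨a, ha⟩ := hg1 i hi
      have hsup : ∀ v ∈ (monomial γ (1 : k) * a).support, v ∈ U := by
        intro v hv
        obtain ⟨w, hw, rfl⟩ := (support_monomial_mul_mem _ _ _).1 hv
        exact ⟨w, hWm a ⟨i, hi, ha⟩ w hw, rfl⟩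
      obtain ⟨j, hj⟩ := (h.range (monomial γ 1 * a)).2 (fun v hv => hUc v (hsup v hv))
      refine ⟨j, ?_, ?_⟩
      · intro v hv
        rw [hj] at hv
        exact hsup v hv
      · rw [hj, ha]; ring
    · intro j hj
      obtain ⟨t, ht1, ht2⟩ := exists_div_monomial (φ j) γ (by
        intro v hv
        obtain ⟨w, -, rfl⟩ := hj v hv
        exact le_self_add)
      obtain ⟨i, hi, hi'⟩ := hWs t (by
        intro w hw
        obtain ⟨w', hw', he⟩ := hj _ ((ht2 w).1 hw)
        rwa [add_left_cancel he])
      exact ⟨i, hi, by rw [hi', ← ht1]; ring⟩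

end MonomialIdeal3

section Hall
variable {α β : Type} [Fintype α] [Fintype β] [DecidableEq α] [DecidableEq β]

/-- exponent vector of an edge -/
noncomputable def ev (y : α × β) : α ⊕ β →₀ ℕ :=
  Finsupp.single (Sum.inl y.1) 1 + Finsupp.single (Sum.inr y.2) 1

noncomputable def coordForm (x : α ⊕ β) : (α ⊕ β →₀ ℕ) →+ ℤ :=
  (Nat.castAddMonoidHom ℤ).comp (Finsupp.applyAddHom x)

noncomputable def rowForm (A : Finset α) : (α ⊕ β →₀ ℕ) →+ ℤ :=
  ∑ a ∈ A, coordForm (Sum.inl a)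

noncomputable def colForm (B : Finset β) : (α ⊕ β →₀ ℕ) →+ ℤ :=
  ∑ b ∈ B, coordForm (Sum.inr b)

/-- neighbours -/
def nbr (E : Finset (α × β)) (A : Finset α) : Finset β :=
  Finset.univ.filter (fun b => ∃ a ∈ A, (a, b) ∈ E)

open Classical in
noncomputable def hallForms (E : Finset (α × β)) : Finset ((α ⊕ β →₀ ℕ) →+ ℤ) :=
  Finset.univ.image coordForm ∪
    (Finset.univ.image (fun A => colForm (nbr E A) - rowForm A) ∪
      {rowForm Finset.univ - colForm Finset.univ})

lemma coordForm_apply (x : α ⊕ β) (v : α ⊕ β →₀ ℕ) : coordForm x v = (v x : ℤ) := rfl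

lemma rowForm_apply (A : Finset α) (v : α ⊕ β →₀ ℕ) :
    rowForm A v = ∑ a ∈ A, (v (Sum.inl a) : ℤ) := by
  simp [rowForm, coordForm_apply, AddMonoidHom.finsetSum_apply]

lemma colForm_apply (A : Finset β) (v : α ⊕ β →₀ ℕ) :
    colForm A v = ∑ a ∈ A, (v (Sum.inr a) : ℤ) := by
  simp [colForm, coordForm_apply, AddMonoidHom.finsetSum_apply]

lemma hall_nonneg_ev (E : Finset (α × β)) (y : α × β) (hy : y ∈ E) :
    ∀ F ∈ hallForms E, 0 ≤ F (ev y) := by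
  intro F hF
  have hr : ∀ A : Finset α, rowForm A (ev y) = if y.1 ∈ A then 1 else 0 := by
    intro A
    rw [rowForm_apply]
    simp [ev, Finsupp.single_apply]
  have hc : ∀ A : Finset β, colForm A (ev y) = if y.2 ∈ A then 1 else 0 := by
    intro A
    rw [colForm_apply]
    simp [ev, Finsupp.single_apply]
  simp only [hallForms, Finset.mem_union, Finset.mem_image, Finset.mem_univ, true_and,
    Finset.mem_singleton] at hF
  rcases hF with ⟨x, rfl⟩ | ⟨A, rfl⟩ | rfl
  · rw [coordForm_apply]; positivity
  · rw [AddMonoidHom.sub_apply, hr, hc]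
    by_cases h : y.1 ∈ A
    · rw [if_pos h, if_pos]
      · simp
      · simp only [nbr, Finset.mem_filter, Finset.mem_univ, true_and]
        exact ⟨y.1, h, hy⟩
    · rw [if_neg h]; split_ifs <;> simp
  · rw [AddMonoidHom.sub_apply, hr, hc]; simp

lemma hall_mem_closure (E : Finset (α × β)) (v : α ⊕ β →₀ ℕ)
    (h : ∀ F ∈ hallForms E, 0 ≤ F v) : v ∈ AddSubmonoid.closure (ev '' (E : Set (α × β))) := by
  have hH : ∀ A : Finset α, ∑ a ∈ A, v (Sum.inl a) ≤ ∑ b ∈ nbr E A, v (Sum.inr b) := by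
    intro A
    have := h (colForm (nbr E A) - rowForm A) (by
      simp [hallForms])
    rw [AddMonoidHom.sub_apply, rowForm_apply, colForm_apply] at this
    zify; omega
  have hT : ∑ b, v (Sum.inr b) ≤ ∑ a, v (Sum.inl a) := by
    have := h (rowForm Finset.univ - colForm Finset.univ) (by
      simp [hallForms])
    rw [AddMonoidHom.sub_apply, rowForm_apply, colForm_apply] at this
    zify; omega
  let ι := Σ a : α, Fin (v (Sum.inl a))
  let κ := Σ b : β, Fin (v (Sum.inr b))
  let t : ι → Finset κ := fun x => Finset.univ.filter (fun y : κ => (x.1, y.1) ∈ E)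
  have hfib1 : ∀ A : Finset α, (Finset.univ.filter (fun x : ι => x.1 ∈ A)).card
      = ∑ a ∈ A, v (Sum.inl a) := by
    intro A
    have : (Finset.univ.filter (fun x : ι => x.1 ∈ A)) = A.sigma (fun a => Finset.univ) := by
      ext x
      rw [Finset.mem_filter, Finset.mem_sigma]
      simp
    rw [this, Finset.card_sigma]; simp
  have hfib2 : ∀ A : Finset β, (Finset.univ.filter (fun x : κ => x.1 ∈ A)).card
      = ∑ a ∈ A, v (Sum.inr a) := by
    intro A
    have : (Finset.univ.filter (fun x : κ => x.1 ∈ A)) = A.sigma (fun a => Finset.univ) := by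
      ext x
      rw [Finset.mem_filter, Finset.mem_sigma]
      simp
    rw [this, Finset.card_sigma]; simp
  obtain ⟨f, hf, hft⟩ := (Finset.all_card_le_biUnion_card_iff_exists_injective t).1 (by
    intro s
    let A : Finset α := s.image Sigma.fst
    have h1 : s.card ≤ (Finset.univ.filter (fun x : ι => x.1 ∈ A)).card := by
      refine Finset.card_le_card fun x hx => ?_
      simp only [Finset.mem_filter, Finset.mem_univ, true_and]
      exact Finset.mem_image_of_mem _ hx
    have h2 : (Finset.univ.filter (fun x : κ => x.1 ∈ nbr E A)).card ≤ (s.biUnion t).card := by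
      refine Finset.card_le_card fun y hy => ?_
      simp only [nbr, Finset.mem_filter, Finset.mem_univ, true_and] at hy
      obtain ⟨a, ha, hay⟩ := hy
      obtain ⟨x, hx, rfl⟩ := Finset.mem_image.1 ha
      refine Finset.mem_biUnion.2 ⟨x, hx, ?_⟩
      simp only [t, Finset.mem_filter, Finset.mem_univ, true_and]
      exact hay
    rw [hfib1] at h1
    rw [hfib2] at h2
    exact h1.trans ((hH A).trans h2))
  have hcι : Fintype.card ι = ∑ a, v (Sum.inl a) := by
    have := hfib1 Finset.univ
    simpa using this
  have hcκ : Fintype.card κ = ∑ a, v (Sum.inr a) := by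
    have := hfib2 Finset.univ
    simpa using this
  have hbij : Function.Bijective f := by
    rw [Fintype.bijective_iff_injective_and_card]
    refine ⟨hf, le_antisymm (Fintype.card_le_of_injective f hf) ?_⟩
    rw [hcι, hcκ]; exact hT
  have hv : v = ∑ x : ι, ev (x.1, (f x).1) := by
    ext z
    rw [Finsupp.finsetSum_apply]
    rcases z with a | b
    · have h1 : ∀ x : ι, (ev (x.1, (f x).1) : α ⊕ β →₀ ℕ) (Sum.inl a)
          = if x.1 ∈ ({a} : Finset α) then 1 else 0 := by
        intro x
        simp [ev, Finsupp.single_apply]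
      simp only [h1]
      rw [Finset.sum_boole, hfib1]; simp
    · have h1 : ∀ x : ι, (ev (x.1, (f x).1) : α ⊕ β →₀ ℕ) (Sum.inr b)
          = (fun y : κ => if y.1 ∈ ({b} : Finset β) then 1 else 0) (f x) := by
        intro x
        simp [ev, Finsupp.single_apply]
      simp only [h1]
      rw [Function.Bijective.sum_comp hbij
        (fun y : κ => if y.1 ∈ ({b} : Finset β) then 1 else 0), Finset.sum_boole, hfib2]; simp
  rw [hv]
  refine AddSubmonoid.sum_mem _ fun x _ => AddSubmonoid.subset_closure ⟨(x.1, (f x).1), ?_, rfl⟩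
  have := hft x
  simp only [t, Finset.mem_filter, Finset.mem_univ, true_and] at this
  exact this

lemma hall_iff (E : Finset (α × β)) (v : α ⊕ β →₀ ℕ) :
    (∀ F ∈ hallForms E, 0 ≤ F v) ↔ v ∈ AddSubmonoid.closure (ev '' (E : Set (α × β))) := by
  refine ⟨hall_mem_closure E v, fun h F hF => ?_⟩
  induction h using AddSubmonoid.closure_induction with
  | mem x hx =>
    obtain ⟨y, hy, rfl⟩ := hx
    exact hall_nonneg_ev E y hy F hF
  | zero => simp
  | add x y _ _ hx hy => rw [map_add]; omega

lemma hall_u (E : Finset (α × β)) (F : (α ⊕ β →₀ ℕ) →+ ℤ) (hF : F ∈ hallForms E)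
    (h0 : F (∑ y ∈ E, ev y) = 0) (s : α ⊕ β →₀ ℕ)
    (hs : s ∈ AddSubmonoid.closure (ev '' (E : Set (α × β)))) : F s = 0 := by
  rw [map_sum, Finset.sum_eq_zero_iff_of_nonneg (fun y hy => hall_nonneg_ev E y hy F hF)] at h0
  induction hs using AddSubmonoid.closure_induction with
  | mem x hx =>
    obtain ⟨y, hy, rfl⟩ := hx
    exact h0 y hy
  | zero => simp
  | add x y _ _ hx hy => rw [map_add]; omega

end Hall

section Toric
open MvPolynomial
variable {α β : Type} [Fintype α] [Fintype β] [DecidableEq α] [DecidableEq β]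
variable (k : Type) [Field k] (Y : Set (ℕ × ℕ)) (ρ : ℕ → α) (κ : ℕ → β)

/-- toric exponent -/
noncomputable def tev (y : ℕ × ℕ) : α ⊕ β →₀ ℕ := ev (ρ y.1, κ y.2)

noncomputable def evSum : (Y →₀ ℕ) →+ (α ⊕ β →₀ ℕ) :=
  Finsupp.liftAddHom (fun y => multiplesHom _ (tev ρ κ y.1))

noncomputable def toricHom : MvPolynomial Y k →ₐ[k] MvPolynomial (α ⊕ β) k :=
  aeval (fun y => monomial (tev ρ κ y.1) (1 : k))

lemma evSum_single (y : Y) (n : ℕ) : evSum Y ρ κ (Finsupp.single y n) = n • tev ρ κ y.1 := by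
  simp [evSum]

lemma toricHom_monomial (d : Y →₀ ℕ) (c : k) :
    toricHom k Y ρ κ (monomial d c) = monomial (evSum Y ρ κ d) c := by
  induction d using Finsupp.induction_linear generalizing c with
  | zero =>
    rw [map_zero]
    change toricHom k Y ρ κ (C c) = C c
    rw [toricHom, algHom_C]; rfl
  | add f g hf hg =>
    rw [map_add, ← mul_one c, ← monomial_mul, map_mul, hf, hg, monomial_mul]
  | single y n =>
    rw [evSum_single, toricHom, aeval_monomial, Finsupp.prod_single_index (by simp), monomial_pow,
      one_pow, algebraMap_eq, C_mul_monomial, mul_one]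

variable {Y} {ρ} {κ}

lemma evSum_apply (d : Y →₀ ℕ) (z) : evSum Y ρ κ d z = d.sum (fun y n => n * tev ρ κ y.1 z) := by
  rw [evSum, Finsupp.liftAddHom_apply, Finsupp.sum_apply]
  rfl

lemma evSum_row_pos (d : Y →₀ ℕ) (a : α) :
    0 < evSum Y ρ κ d (Sum.inl a) ↔ ∃ y ∈ d.support, ρ y.1.1 = a := by
  rw [evSum_apply, Finsupp.sum, Finset.sum_pos_iff]
  refine exists_congr fun y => and_congr_right fun hy => ?_
  have : d y ≠ 0 := Finsupp.mem_support_iff.1 hy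
  simp [tev, ev, Finsupp.single_apply, Nat.pos_iff_ne_zero, this]

lemma evSum_col_pos (d : Y →₀ ℕ) (b : β) :
    0 < evSum Y ρ κ d (Sum.inr b) ↔ ∃ y ∈ d.support, κ y.1.2 = b := by
  rw [evSum_apply, Finsupp.sum, Finset.sum_pos_iff]
  refine exists_congr fun y => and_congr_right fun hy => ?_
  have : d y ≠ 0 := Finsupp.mem_support_iff.1 hy
  simp [tev, ev, Finsupp.single_apply, Nat.pos_iff_ne_zero, this]

lemma minor_two_mem (i i2 j1 j : ℕ) (hi : i < i2) (hj : j1 < j) (h11 : (i, j1) ∈ Y)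
    (h12 : (i, j) ∈ Y) (h21 : (i2, j1) ∈ Y) (h22 : (i2, j) ∈ Y) :
    (X ⟨(i, j1), h11⟩ * X ⟨(i2, j), h22⟩ - X ⟨(i, j), h12⟩ * X ⟨(i2, j1), h21⟩ :
      MvPolynomial Y k) ∈ minorIdeal k 2 Y := by
  refine Ideal.subset_span ⟨![i, i2], ![j1, j], ?_, ?_, ?_, ?_⟩
  · intro a b hab
    fin_cases a <;> fin_cases b <;> simp_all
  · intro a b hab
    fin_cases a <;> fin_cases b <;> simp_all
  · intro a b
    fin_cases a <;> fin_cases b <;> simp_all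
  · rw [minorPoly, Matrix.det_fin_two]
    rfl

lemma toric_ker_le : minorIdeal k 2 Y ≤ RingHom.ker (toricHom k Y ρ κ) := by
  rw [minorIdeal, Ideal.span_le]
  rintro f ⟨r, c, hr, hc, h, rfl⟩
  change toricHom k Y ρ κ _ = 0
  rw [minorPoly, Matrix.det_fin_two]
  simp only [Matrix.of_apply, map_sub, map_mul, toricHom, aeval_X, monomial_mul, tev, ev]
  rw [sub_eq_zero]
  congr 1
  ac_rfl

lemma exists_swap (m n : ℕ) (hY : IsLadder m n Y) (d : Y →₀ ℕ) (i j : ℕ)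
    (hi : ∃ y ∈ d.support, y.1.1 = i) (hi' : ∀ y ∈ d.support, i ≤ y.1.1)
    (hj : ∃ y ∈ d.support, y.1.2 = j) (hj' : ∀ y ∈ d.support, y.1.2 ≤ j) :
    ∃ h : (i, j) ∈ Y, ∃ e : Y →₀ ℕ,
      Ideal.Quotient.mk (minorIdeal k 2 Y) (monomial d 1) =
        Ideal.Quotient.mk (minorIdeal k 2 Y) (monomial (Finsupp.single ⟨(i, j), h⟩ 1 + e) 1) ∧
      evSum Y ρ κ d = evSum Y ρ κ (Finsupp.single ⟨(i, j), h⟩ 1 + e) := by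
  obtain ⟨⟨⟨i', j1⟩, h1⟩, hd1, rfl⟩ := hi
  obtain ⟨⟨⟨i2, j'⟩, h2⟩, hd2, rfl⟩ := hj
  have le1 : i' ≤ i2 := hi' _ hd2
  have le2 : j1 ≤ j' := hj' _ hd1
  obtain ⟨h12, h21⟩ := hY.2 i' j1 i2 j' h1 h2 le1 le2
  refine ⟨h12, ?_⟩
  rcases le1.eq_or_lt with rfl | lt1
  · obtain ⟨e, he⟩ := exists_add_of_le (Finsupp.single_le_iff.2
      (Nat.one_le_iff_ne_zero.2 (Finsupp.mem_support_iff.1 hd2)))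
    exact ⟨e, by rw [← he], by rw [← he]⟩
  rcases le2.eq_or_lt with rfl | lt2
  · obtain ⟨e, he⟩ := exists_add_of_le (Finsupp.single_le_iff.2
      (Nat.one_le_iff_ne_zero.2 (Finsupp.mem_support_iff.1 hd1)))
    exact ⟨e, by rw [← he], by rw [← he]⟩
  have hle : Finsupp.single (⟨(i', j1), h1⟩ : Y) 1 + Finsupp.single ⟨(i2, j'), h2⟩ 1 ≤ d := by
    classical
    intro y
    have e1 := Finsupp.mem_support_iff.1 hd1
    have e2 := Finsupp.mem_support_iff.1 hd2
    have hne : (⟨(i', j1), h1⟩ : Y) ≠ ⟨(i2, j'), h2⟩ := by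
      intro h
      have := congrArg (fun y : Y => y.1.1) h
      simp at this
      omega
    rw [Finsupp.add_apply, Finsupp.single_apply, Finsupp.single_apply]
    split_ifs with h3 h4 h4
    · exact absurd (h3.trans h4.symm) hne
    · subst h3; omega
    · subst h4; omega
    · omega
  obtain ⟨e, he⟩ := exists_add_of_le hle
  refine ⟨Finsupp.single ⟨(i2, j1), h21⟩ 1 + e, ?_, ?_⟩
  · rw [Ideal.Quotient.eq, he, ← add_assoc]
    rw [show (monomial (Finsupp.single (⟨(i', j1), h1⟩ : Y) 1 + Finsupp.single ⟨(i2, j'), h2⟩ 1 + e)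
        (1 : k)) = X ⟨(i', j1), h1⟩ * X ⟨(i2, j'), h2⟩ * monomial e 1 by
      simp only [X, monomial_mul, mul_one],
      show (monomial (Finsupp.single (⟨(i', j'), h12⟩ : Y) 1 + Finsupp.single ⟨(i2, j1), h21⟩ 1 + e)
        (1 : k)) = X ⟨(i', j'), h12⟩ * X ⟨(i2, j1), h21⟩ * monomial e 1 by
      simp only [X, monomial_mul, mul_one], ← sub_mul]
    exact Ideal.mul_mem_right _ _ (minor_two_mem k i' i2 j1 j' lt1 lt2 h1 h12 h21 h2)
  · rw [he]
    simp only [map_add, evSum_single, one_nsmul, tev, ev]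
    abel

lemma toric_monomial_congr (m n : ℕ) (hY : IsLadder m n Y)
    (hρ : ∀ y ∈ Y, ∀ y' ∈ Y, ρ y.1 = ρ y'.1 → y.1 = y'.1)
    (hκ : ∀ y ∈ Y, ∀ y' ∈ Y, κ y.2 = κ y'.2 → y.2 = y'.2)
    (N : ℕ) : ∀ d d' : Y →₀ ℕ, d.degree ≤ N → evSum Y ρ κ d = evSum Y ρ κ d' →
      Ideal.Quotient.mk (minorIdeal k 2 Y) (monomial d 1) =
        Ideal.Quotient.mk (minorIdeal k 2 Y) (monomial d' 1) := by
  have hrow : ∀ d d' : Y →₀ ℕ, evSum Y ρ κ d = evSum Y ρ κ d' → ∀ y ∈ d.support,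
      ∃ y' ∈ d'.support, y'.1.1 = y.1.1 := by
    intro d d' h y hy
    have := (evSum_row_pos (ρ := ρ) (κ := κ) d (ρ y.1.1)).2 ⟨y, hy, rfl⟩
    rw [h, evSum_row_pos] at this
    obtain ⟨y', hy', he⟩ := this
    exact ⟨y', hy', hρ _ y'.2 _ y.2 he⟩
  have hcol : ∀ d d' : Y →₀ ℕ, evSum Y ρ κ d = evSum Y ρ κ d' → ∀ y ∈ d.support,
      ∃ y' ∈ d'.support, y'.1.2 = y.1.2 := by
    intro d d' h y hy
    have := (evSum_col_pos (ρ := ρ) (κ := κ) d (κ y.1.2)).2 ⟨y, hy, rfl⟩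
    rw [h, evSum_col_pos] at this
    obtain ⟨y', hy', he⟩ := this
    exact ⟨y', hy', hκ _ y'.2 _ y.2 he⟩
  induction N with
  | zero =>
    intro d d' hd h
    have hd0 : d = 0 := by
      rw [← Finsupp.degree_eq_zero_iff]; omega
    have hd0' : d' = 0 := by
      by_contra hne
      obtain ⟨y, hy⟩ := Finsupp.support_nonempty_iff.2 hne
      obtain ⟨y', hy', -⟩ := hrow d' d h.symm y hy
      rw [hd0] at hy'
      simp at hy'
    rw [hd0, hd0']
  | succ N ih =>
    intro d d' hd h
    by_cases hd0 : d = 0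
    · have hd0' : d' = 0 := by
        by_contra hne
        obtain ⟨y, hy⟩ := Finsupp.support_nonempty_iff.2 hne
        obtain ⟨y', hy', -⟩ := hrow d' d h.symm y hy
        rw [hd0] at hy'
        simp at hy'
      rw [hd0, hd0']
    have hne := Finsupp.support_nonempty_iff.2 hd0
    obtain ⟨y1, hy1, hm1⟩ := d.support.exists_min_image (fun y => y.1.1) hne
    obtain ⟨y2, hy2, hm2⟩ := d.support.exists_max_image (fun y => y.1.2) hne
    obtain ⟨hij, e, he1, he2⟩ := exists_swap k (ρ := ρ) (κ := κ) m n hY d y1.1.1 y2.1.2 ⟨y1, hy1, rfl⟩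
      hm1 ⟨y2, hy2, rfl⟩ hm2
    obtain ⟨hij', e', he1', he2'⟩ := exists_swap k (ρ := ρ) (κ := κ) m n hY d' y1.1.1 y2.1.2
      (hrow d d' h y1 hy1)
      (fun y hy => by
        obtain ⟨z, hz, he⟩ := hrow d' d h.symm y hy
        rw [← he]; exact hm1 z hz)
      (hcol d d' h y2 hy2)
      (fun y hy => by
        obtain ⟨z, hz, he⟩ := hcol d' d h.symm y hy
        rw [← he]; exact hm2 z hz)
    have hev : evSum Y ρ κ e = evSum Y ρ κ e' := by
      have := (he2.symm.trans h).trans he2'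
      rw [map_add, map_add] at this
      exact add_left_cancel this
    have hdeg : e.degree ≤ N := by
      -- compare degrees through evSum
      have hD : ∀ f : Y →₀ ℕ, (evSum Y ρ κ f).degree = 2 * f.degree := by
        intro f
        induction f using Finsupp.induction_linear with
        | zero => simp
        | add f g hf hg => rw [map_add, map_add, map_add, hf, hg]; ring
        | single y n =>
          rw [evSum_single, map_nsmul]
          simp [tev, ev]
          ring
      have h1 := hD d
      rw [he2, hD] at h1
      rw [map_add] at h1
      simp at h1
      omega
    rw [he1, he1']
    rw [show ∀ f : Y →₀ ℕ, monomial (Finsupp.single ⟨(y1.1.1, y2.1.2), hij⟩ 1 + f) (1 : k)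
      = monomial (Finsupp.single ⟨(y1.1.1, y2.1.2), hij⟩ 1) 1 * monomial f 1 by
        intro f; rw [monomial_mul, mul_one]]
    rw [show ∀ f : Y →₀ ℕ, monomial (Finsupp.single ⟨(y1.1.1, y2.1.2), hij⟩ 1 + f) (1 : k)
      = monomial (Finsupp.single ⟨(y1.1.1, y2.1.2), hij⟩ 1) 1 * monomial f 1 by
        intro f; rw [monomial_mul, mul_one]]
    rw [map_mul, map_mul, ih e e' hdeg hev]

lemma toric_ker (m n : ℕ) (hY : IsLadder m n Y)
    (hρ : ∀ y ∈ Y, ∀ y' ∈ Y, ρ y.1 = ρ y'.1 → y.1 = y'.1)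
    (hκ : ∀ y ∈ Y, ∀ y' ∈ Y, κ y.2 = κ y'.2 → y.2 = y'.2)
    (p : MvPolynomial Y k) (hp : toricHom k Y ρ κ p = 0) : p ∈ minorIdeal k 2 Y := by
  classical
  let mfun : (α ⊕ β →₀ ℕ) → LadderRing k 2 Y := fun v =>
    if h : ∃ d : Y →₀ ℕ, evSum Y ρ κ d = v then
      Ideal.Quotient.mk (minorIdeal k 2 Y) (monomial h.choose 1) else 0
  let ψ : MvPolynomial (α ⊕ β) k →ₗ[k] LadderRing k 2 Y := (basisMonomials (α ⊕ β) k).constr k mfun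
  have hψ : ψ.comp (toricHom k Y ρ κ).toLinearMap = (Ideal.Quotient.mkₐ k (minorIdeal k 2 Y)).toLinearMap := by
    apply (basisMonomials Y k).ext
    intro d
    rw [coe_basisMonomials]
    change ψ (toricHom k Y ρ κ (monomial d 1)) = Ideal.Quotient.mk _ (monomial d 1)
    rw [toricHom_monomial]
    have : (monomial (evSum Y ρ κ d) (1 : k)) = basisMonomials (α ⊕ β) k (evSum Y ρ κ d) := by
      rw [coe_basisMonomials]
    rw [this, Module.Basis.constr_basis]
    have hex : ∃ d' : Y →₀ ℕ, evSum Y ρ κ d' = evSum Y ρ κ d := ⟨d, rfl⟩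
    simp only [mfun]
    rw [dif_pos hex]
    exact toric_monomial_congr k m n hY hρ hκ _ _ _ le_rfl hex.choose_spec
  have := LinearMap.congr_fun hψ p
  change ψ (toricHom k Y ρ κ p) = Ideal.Quotient.mk _ p at this
  rw [hp, map_zero] at this
  exact Ideal.Quotient.eq_zero_iff_mem.1 this.symm

lemma toric_range (t : MvPolynomial (α ⊕ β) k) :
    (∃ r, toricHom k Y ρ κ r = t) ↔
      ∀ v ∈ t.support, v ∈ AddSubmonoid.closure (tev ρ κ '' Y) := by
  classical
  have hmr : ∀ v, v ∈ AddSubmonoid.closure (tev ρ κ '' Y) ↔ ∃ d, evSum Y ρ κ d = v := by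
    intro v
    constructor
    · intro h
      induction h using AddSubmonoid.closure_induction with
      | mem x hx =>
        obtain ⟨y, hy, rfl⟩ := hx
        exact ⟨Finsupp.single ⟨y, hy⟩ 1, by rw [evSum_single, one_nsmul]⟩
      | zero => exact ⟨0, map_zero _⟩
      | add x y _ _ hx hy =>
        obtain ⟨d, rfl⟩ := hx
        obtain ⟨e, rfl⟩ := hy
        exact ⟨d + e, map_add _ _ _⟩
    · rintro ⟨d, rfl⟩
      induction d using Finsupp.induction_linear with
      | zero => rw [map_zero]; exact zero_mem _
      | add f g hf hg => rw [map_add]; exact add_mem hf hg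
      | single y n =>
        rw [evSum_single]
        exact nsmul_mem (AddSubmonoid.subset_closure (Set.mem_image_of_mem _ y.2)) n
  constructor
  · rintro ⟨r, rfl⟩ v hv
    rw [hmr]
    rw [r.as_sum, map_sum] at hv
    simp only [toricHom_monomial] at hv
    obtain ⟨d, hd, hv⟩ := Finset.mem_biUnion.1 (support_sum hv)
    have := Finset.mem_singleton.1 (support_monomial_subset hv)
    exact ⟨d, this.symm⟩
  · intro h
    choose! f hf using fun v hv => (hmr v).1 (h v hv)
    refine ⟨∑ v ∈ t.support, monomial (f v) (coeff v t), ?_⟩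
    rw [map_sum]
    conv_rhs => rw [t.as_sum]
    exact Finset.sum_congr rfl fun v hv => by rw [toricHom_monomial, hf v hv]

theorem toric_coneData (m n : ℕ) (hY : IsLadder m n Y)
    (hρ : ∀ y ∈ Y, ∀ y' ∈ Y, ρ y.1 = ρ y'.1 → y.1 = y'.1)
    (hκ : ∀ y ∈ Y, ∀ y' ∈ Y, κ y.2 = κ y'.2 → y.2 = y'.2) :
    ∃ (φ : LadderRing k 2 Y →+* MvPolynomial (α ⊕ β) k) (𝓕 : _) (u : _), ConeData φ 𝓕 u ∧
      ∀ v, (∀ F ∈ 𝓕, 0 ≤ F v) ↔ v ∈ AddSubmonoid.closure (tev ρ κ '' Y) := by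
  classical
  let E : Finset (α × β) := Finset.univ.filter (fun p => ∃ y ∈ Y, (ρ y.1, κ y.2) = p)
  have hE : (ev '' (E : Set (α × β))) = tev ρ κ '' Y := by
    ext v
    constructor
    · rintro ⟨p, hp, rfl⟩
      obtain ⟨y, hy, rfl⟩ := (Finset.mem_filter.1 hp).2
      exact ⟨y, hy, rfl⟩
    · rintro ⟨y, hy, rfl⟩
      exact ⟨(ρ y.1, κ y.2), Finset.mem_filter.2 ⟨Finset.mem_univ _, y, hy, rfl⟩, rfl⟩
  have hker : ∀ a ∈ minorIdeal k 2 Y, (toricHom k Y ρ κ : MvPolynomial Y k →+* MvPolynomial (α ⊕ β) k) a = 0 :=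
    fun a ha => (toric_ker_le k (ρ := ρ) (κ := κ) ha :)
  let φ : LadderRing k 2 Y →+* MvPolynomial (α ⊕ β) k :=
    Ideal.Quotient.lift (minorIdeal k 2 Y) (toricHom k Y ρ κ : MvPolynomial Y k →+* MvPolynomial (α ⊕ β) k)
      hker
  have hφ : ∀ p, φ (Ideal.Quotient.mk _ p) = toricHom k Y ρ κ p := fun p => Ideal.Quotient.lift_mk _ _ _
  refine ⟨φ, hallForms E, ∑ y ∈ E, ev y, ⟨?_, ?_, ?_, ?_, ?_⟩, ?_⟩
  · rw [injective_iff_map_eq_zero]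
    intro a ha
    obtain ⟨p, rfl⟩ := Ideal.Quotient.mk_surjective a
    rw [hφ] at ha
    exact Ideal.Quotient.eq_zero_iff_mem.2 (toric_ker k m n hY hρ hκ p ha)
  · intro t
    simp only [hall_iff, hE]
    rw [← toric_range]
    constructor
    · rintro ⟨r, rfl⟩
      obtain ⟨p, rfl⟩ := Ideal.Quotient.mk_surjective r
      exact ⟨p, (hφ p).symm⟩
    · rintro ⟨p, rfl⟩
      exact ⟨_, hφ p⟩
  · intro a b h x
    have := h (coordForm x) (by simp [hallForms])
    rw [coordForm_apply, coordForm_apply] at this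
    exact_mod_cast this
  · rw [hall_iff]
    exact AddSubmonoid.sum_mem _ fun y hy => AddSubmonoid.subset_closure ⟨y, hy, rfl⟩
  · intro F hF h0 s hs
    exact hall_u E F hF h0 s ((hall_iff E s).1 hs)
  · intro v
    rw [hall_iff, hE]

end Toric

section Graded
variable {k L R : Type} [Field k] [AddCommGroup L] [CommRing R]

/-- a monoid-graded ring presented through its coefficient functions -/
structure GrRing (k R : Type) {L : Type} [Field k] [AddCommGroup L] [CommRing R]
    (S : AddSubmonoid L) where
  c : R →+ (L → k)
  mon : L → k → R
  inj : ∀ r, c r = 0 → r = 0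
  fin : ∀ r, (Function.support (c r)).Finite
  supp : ∀ r v, c r v ≠ 0 → v ∈ S
  c_mon_self : ∀ s ∈ S, ∀ a, c (mon s a) s = a
  c_mon_ne : ∀ s ∈ S, ∀ a w, w ≠ s → c (mon s a) w = 0
  mon_mul : ∀ s ∈ S, ∀ a r v, c (mon s a * r) v = a * c r (v - s)

variable {S : AddSubmonoid L} (G : GrRing k R S)

lemma GrRing.ext' (r r' : R) (h : ∀ v, G.c r v = G.c r' v) : r = r' := by
  rw [← sub_eq_zero]
  apply G.inj
  rw [map_sub, sub_eq_zero]
  exact funext h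

lemma GrRing.induct (P : R → Prop) (h0 : P 0) (hadd : ∀ a b, P a → P b → P (a + b))
    (hmon : ∀ s ∈ S, ∀ a, P (G.mon s a)) (r : R) : P r := by
  classical
  have hr : r = ∑ v ∈ (G.fin r).toFinset, G.mon v (G.c r v) := by
    apply G.ext'
    intro v
    rw [map_sum, Finset.sum_apply]
    by_cases hv : v ∈ (G.fin r).toFinset
    · rw [Finset.sum_eq_single v]
      · rw [G.c_mon_self]
        exact G.supp r v (by simpa using hv)
      · intro w hw hne
        exact G.c_mon_ne w (G.supp r w (by simpa using hw)) _ _ hne.symm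
      · exact fun h => absurd hv h
    · rw [Finset.sum_eq_zero]
      · simpa using hv
      · intro w hw
        refine G.c_mon_ne w (G.supp r w (by simpa using hw)) _ _ ?_
        rintro rfl
        exact hv hw
  rw [hr]
  refine Finset.sum_induction _ P hadd h0 fun v hv => hmon v (G.supp r v (by simpa using hv)) _

/-- graded submodules of free modules -/
structure GMod (k : Type) {L : Type} [Field k] [AddCommGroup L] (S : AddSubmonoid L) where
  ι : Type
  fι : Fintype ι
  dι : DecidableEq ι
  b : ι → L
  W : L → Submodule k (ι → k)
  supp : ∀ v x, x ∈ W v → ∀ j, x j ≠ 0 → v - b j ∈ S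
  mono : ∀ v s, s ∈ S → W v ≤ W (v + s)

attribute [instance] GMod.fι GMod.dι

def GrRing.coef {ι : Type} (b : ι → L) (v : L) : (ι → R) →+ (ι → k) where
  toFun X := fun j => G.c (X j) (v - b j)
  map_zero' := by ext j; simp
  map_add' X Y := by ext j; simp

lemma GrRing.coef_mon {ι : Type} (b : ι → L) (v s : L) (hs : s ∈ S) (a : k) (X : ι → R) :
    G.coef b v (G.mon s a • X) = a • G.coef b (v - s) X := by
  ext j
  change G.c (G.mon s a * X j) (v - b j) = a * G.c (X j) (v - s - b j)
  rw [G.mon_mul s hs]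
  rw [sub_right_comm]

open Classical in
/-- homogeneous elements -/
noncomputable def GrRing.hom {ι : Type} (b : ι → L) (v : L) (x : ι → k) : ι → R :=
  fun j => if v - b j ∈ S then G.mon (v - b j) (x j) else 0

lemma GrRing.coef_hom_self {ι : Type} (b : ι → L) (v : L) (x : ι → k)
    (hx : ∀ j, x j ≠ 0 → v - b j ∈ S) : G.coef b v (G.hom b v x) = x := by
  ext j
  change G.c (G.hom b v x j) (v - b j) = x j
  unfold GrRing.hom
  split_ifs with h
  · exact G.c_mon_self _ h _
  · rw [map_zero]
    by_contra hc
    exact h (hx j (Ne.symm hc))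

lemma GrRing.coef_hom_ne {ι : Type} (b : ι → L) (v w : L) (hw : w ≠ v) (x : ι → k) :
    G.coef b w (G.hom b v x) = 0 := by
  ext j
  change G.c (G.hom b v x j) (w - b j) = 0
  unfold GrRing.hom
  split_ifs with h
  · exact G.c_mon_ne _ h _ _ (fun he => hw (sub_left_injective he))
  · rw [map_zero]; rfl

def spanAt (S : AddSubmonoid L) {V : Type} [AddCommGroup V] [Module k V] (g : Set (L × V)) (v : L) :
    Submodule k V := Submodule.span k {x | ∃ p ∈ g, p.2 = x ∧ v - p.1 ∈ S}

lemma spanAt_mono {V : Type} [AddCommGroup V] [Module k V] (g : Set (L × V)) (v s : L)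
    (hs : s ∈ S) : spanAt (k := k) S g v ≤ spanAt S g (v + s) := by
  apply Submodule.span_mono
  rintro x ⟨p, hp, rfl, h⟩
  refine ⟨p, hp, rfl, ?_⟩
  rw [add_sub_right_comm]
  exact add_mem h hs

lemma GMod.exists_gen (G : GrRing k R S) [IsNoetherianRing R] (Q : GMod k S) :
    ∃ g : Finset (L × (Q.ι → k)), ∀ v, Q.W v = spanAt S (g : Set _) v := by
  classical
  let N : Submodule R (Q.ι → R) :=
    { carrier := {X | ∀ v, G.coef Q.b v X ∈ Q.W v}
      zero_mem' := fun v => by rw [map_zero]; exact zero_mem _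
      add_mem' := fun {X Y} hX hY v => by rw [map_add]; exact add_mem (hX v) (hY v)
      smul_mem' := fun r X hX => by
        refine G.induct (fun r => ∀ v, G.coef Q.b v (r • X) ∈ Q.W v) ?_ ?_ ?_ r
        · intro v; rw [zero_smul, map_zero]; exact zero_mem _
        · intro a b ha hb v
          rw [add_smul, map_add]; exact add_mem (ha v) (hb v)
        · intro s hs a v
          rw [G.coef_mon _ _ _ hs]
          have := Q.mono (v - s) s hs (hX (v - s))
          rw [sub_add_cancel] at this
          exact Submodule.smul_mem _ _ this }
  obtain ⟨T, hT⟩ : N.FG := IsNoetherian.noetherian N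
  have hfin : ∀ X : Q.ι → R, {v | G.coef Q.b v X ≠ 0}.Finite := by
    intro X
    have : {v | G.coef Q.b v X ≠ 0} ⊆ ⋃ j : Q.ι, (fun w => w + Q.b j) '' Function.support (G.c (X j)) := by
      intro v hv
      obtain ⟨j, hj⟩ := Function.ne_iff.1 hv
      exact Set.mem_iUnion.2 ⟨j, v - Q.b j, hj, sub_add_cancel _ _⟩
    exact (Set.finite_iUnion fun j => (G.fin (X j)).image _).subset this
  let g : Finset (L × (Q.ι → k)) := T.biUnion (fun X =>
    (hfin X).toFinset.image (fun v => (v, G.coef Q.b v X)))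
  refine ⟨g, fun v => le_antisymm ?_ ?_⟩
  · intro x hx
    have hX : G.hom Q.b v x ∈ N := by
      intro w
      by_cases hw : w = v
      · subst hw
        rw [G.coef_hom_self _ _ _ (Q.supp w x hx)]
        exact hx
      · rw [G.coef_hom_ne _ _ _ hw]; exact zero_mem _
    have key : ∀ X ∈ N, ∀ v, G.coef Q.b v X ∈ spanAt (k := k) S (g : Set _) v := by
      intro X hX
      rw [← hT] at hX
      induction hX using Submodule.span_induction with
      | mem X hX =>
        intro v
        by_cases h0 : G.coef Q.b v X = 0
        · rw [h0]; exact zero_mem _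
        · refine Submodule.subset_span ⟨(v, G.coef Q.b v X), ?_, rfl, ?_⟩
          · refine Finset.mem_biUnion.2 ⟨X, hX, Finset.mem_image.2 ⟨v, ?_, rfl⟩⟩
            simpa using h0
          · rw [sub_self]; exact zero_mem _
      | zero => intro v; rw [map_zero]; exact zero_mem _
      | add X Y _ _ hX hY => intro v; rw [map_add]; exact add_mem (hX v) (hY v)
      | smul r X _ hX =>
        refine G.induct (fun r => ∀ v, G.coef Q.b v (r • X) ∈ spanAt (k := k) S (g : Set _) v) ?_ ?_ ?_ r
        · intro v; rw [zero_smul, map_zero]; exact zero_mem _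
        · intro a b ha hb v
          rw [add_smul, map_add]; exact add_mem (ha v) (hb v)
        · intro s hs a v
          rw [G.coef_mon _ _ _ hs]
          have := spanAt_mono (k := k) (g : Set (L × (Q.ι → k))) (v - s) s hs (hX (v - s))
          rw [sub_add_cancel] at this
          exact Submodule.smul_mem _ _ this
    have := key _ hX v
    rwa [G.coef_hom_self _ _ _ (Q.supp v x hx)] at this
  · apply Submodule.span_le.2
    rintro x ⟨p, hp, rfl, h⟩
    obtain ⟨X, hX, hp⟩ := Finset.mem_biUnion.1 hp
    obtain ⟨w, hw, rfl⟩ := Finset.mem_image.1 hp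
    have hXN : X ∈ N := by rw [← hT]; exact Submodule.subset_span hX
    have := Q.mono w _ h (hXN w)
    simpa using this

lemma GMod.exists_min_gen (G : GrRing k R S) [IsNoetherianRing R] (Q : GMod k S) :
    ∃ g : Finset (L × (Q.ι → k)), (∀ v, Q.W v = spanAt S (g : Set _) v) ∧
      ∀ p ∈ g, p.2 ∉ spanAt (k := k) S ((g : Set (L × (Q.ι → k))) \ {p}) p.1 := by
  classical
  obtain ⟨g0, hg0⟩ := Q.exists_gen G
  obtain ⟨g, hg, hmin⟩ := (wellFounded_lt (α := Finset (L × (Q.ι → k)))).has_min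
    {g | ∀ v, Q.W v = spanAt S (g : Set _) v} ⟨g0, hg0⟩
  refine ⟨g, hg, fun p hp hmem => hmin (g.erase p) ?_ (Finset.erase_ssubset hp)⟩
  intro v
  rw [hg, Finset.coe_erase]
  refine le_antisymm (Submodule.span_le.2 ?_) (Submodule.span_mono ?_)
  · rintro x ⟨q, hq, rfl, h⟩
    by_cases hqp : q = p
    · subst hqp
      have := spanAt_mono (k := k) _ _ _ h hmem
      rwa [add_sub_cancel] at this
    · exact Submodule.subset_span ⟨q, ⟨hq, hqp⟩, rfl, h⟩
  · rintro x ⟨q, hq, rfl, h⟩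
    exact ⟨q, hq.1, rfl, h⟩

lemma mem_spanAt {V : Type} [AddCommGroup V] [Module k V] (g : Finset (L × V)) (v : L) (x : V) :
    x ∈ spanAt (k := k) S (g : Set (L × V)) v ↔
      ∃ y : g → k, (∀ p, y p ≠ 0 → v - p.1.1 ∈ S) ∧ ∑ p, y p • p.1.2 = x := by
  classical
  constructor
  · intro h
    induction h using Submodule.span_induction with
    | mem x hx =>
      obtain ⟨p, hp, rfl, h⟩ := hx
      refine ⟨Pi.single ⟨p, hp⟩ 1, ?_, ?_⟩
      · intro q hq
        by_cases hqp : q = ⟨p, hp⟩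
        · rw [hqp]; exact h
        · rw [Pi.single_eq_of_ne hqp] at hq
          exact absurd rfl hq
      · rw [Finset.sum_eq_single ⟨p, hp⟩]
        · rw [Pi.single_eq_same, one_smul]
        · intro q _ hq; rw [Pi.single_eq_of_ne hq, zero_smul]
        · intro h; exact absurd (Finset.mem_univ _) h
    | zero => exact ⟨0, fun p hp => absurd rfl hp, by simp⟩
    | add x x' _ _ h h' =>
      obtain ⟨y, hy, rfl⟩ := h
      obtain ⟨y', hy', rfl⟩ := h'
      refine ⟨y + y', fun p hp => ?_, ?_⟩
      · by_cases h0 : y p = 0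
        · refine hy' p fun h1 => hp ?_
          rw [Pi.add_apply, h0, h1, add_zero]
        · exact hy p h0
      · rw [← Finset.sum_add_distrib]
        exact Finset.sum_congr rfl fun p _ => by rw [Pi.add_apply, add_smul]
    | smul a x _ h =>
      obtain ⟨y, hy, rfl⟩ := h
      refine ⟨a • y, fun p hp => hy p (right_ne_zero_of_mul hp), ?_⟩
      rw [Finset.smul_sum]
      exact Finset.sum_congr rfl fun p _ => by rw [Pi.smul_apply, smul_eq_mul, mul_smul]
  · rintro ⟨y, hy, rfl⟩
    refine Submodule.sum_mem _ fun p _ => ?_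
    by_cases h0 : y p = 0
    · rw [h0, zero_smul]; exact zero_mem _
    · exact Submodule.smul_mem _ _ (Submodule.subset_span ⟨p, p.2, rfl, hy p h0⟩)

/-- vectors supported at positions `j` with `v - b j ∈ A` -/
def suppSub (k : Type) [Field k] {ι : Type} (P : ι → Prop) : Submodule k (ι → k) where
  carrier := {x | ∀ j, x j ≠ 0 → P j}
  zero_mem' := fun j h => absurd rfl h
  add_mem' := fun {x y} hx hy j h => by
    by_cases h0 : x j = 0
    · refine hy j fun h1 => h ?_
      rw [Pi.add_apply, h0, h1, add_zero]
    · exact hx j h0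
  smul_mem' := fun a x hx j h => hx j (right_ne_zero_of_mul h)

/-- the minimal generators and the next syzygy -/
noncomputable def GMod.gens [IsNoetherianRing R] (Q : GMod k S) : Finset (L × (Q.ι → k)) :=
  (Q.exists_min_gen G).choose

lemma GMod.gens_spec [IsNoetherianRing R] (Q : GMod k S) : (∀ v, Q.W v = spanAt S (Q.gens G : Set _) v) ∧
      ∀ p ∈ Q.gens G, p.2 ∉ spanAt (k := k) S ((Q.gens G : Set (L × (Q.ι → k))) \ {p}) p.1 :=
  (Q.exists_min_gen G).choose_spec

/-- the matrix of the minimal presentation, as a linear map -/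
noncomputable def GMod.mat [IsNoetherianRing R] (Q : GMod k S) : (Q.gens G → k) →ₗ[k] (Q.ι → k) where
  toFun y := ∑ p, y p • p.1.2
  map_add' y y' := by
    rw [← Finset.sum_add_distrib]
    exact Finset.sum_congr rfl fun p _ => by rw [Pi.add_apply, add_smul]
  map_smul' a y := by
    rw [RingHom.id_apply, Finset.smul_sum]
    exact Finset.sum_congr rfl fun p _ => by rw [Pi.smul_apply, smul_eq_mul, mul_smul]

noncomputable def GMod.next [IsNoetherianRing R] (Q : GMod k S) : GMod k S where
  ι := Q.gens G
  fι := inferInstance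
  dι := Classical.decEq _
  b p := p.1.1
  W v := suppSub k (fun p : Q.gens G => v - p.1.1 ∈ S) ⊓ LinearMap.ker (Q.mat G)
  supp v x hx := hx.1
  mono v s hs := by
    rintro x ⟨hx, hx'⟩
    refine ⟨fun j hj => ?_, hx'⟩
    change v + s - j.1.1 ∈ S
    rw [add_sub_right_comm]
    exact add_mem (hx j hj) hs

lemma GMod.W_eq [IsNoetherianRing R] (Q : GMod k S) (v : L) :
    Q.W v = (suppSub k (fun p : Q.gens G => v - p.1.1 ∈ S)).map (Q.mat G) := by
  ext x
  rw [(Q.gens_spec G).1, mem_spanAt]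
  rfl

lemma GMod.gen_mem [IsNoetherianRing R] (Q : GMod k S) (p : Q.gens G) : p.1.2 ∈ Q.W p.1.1 := by
  rw [(Q.gens_spec G).1]
  exact Submodule.subset_span ⟨p, p.2, rfl, by rw [sub_self]; exact zero_mem _⟩

lemma GMod.gen_ne_zero [IsNoetherianRing R] (Q : GMod k S) (p : Q.gens G) : p.1.2 ≠ 0 := by
  intro h
  apply (Q.gens_spec G).2 p p.2
  rw [h]; exact zero_mem _

/-- minimality -/
lemma GMod.min_aux [IsNoetherianRing R] (Q : GMod k S) (x : Q.gens G → k) (j : Q.gens G)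
    (h1 : ∀ p : Q.gens G, x p ≠ 0 → j.1.1 - p.1.1 ∈ S)
    (h2 : ∑ p : Q.gens G, x p • p.1.2 = 0) : x j = 0 := by
  classical
  by_contra hj
  apply (Q.gens_spec G).2 j.1 j.2
  rw [← Finset.add_sum_erase _ _ (Finset.mem_univ j)] at h2
  have h3 : j.1.2 = - (x j)⁻¹ • ∑ p ∈ Finset.univ.erase j, x p • p.1.2 := by
    rw [← eq_neg_iff_add_eq_zero] at h2
    rw [neg_smul, ← smul_neg, ← h2, smul_smul, inv_mul_cancel₀ hj, one_smul]
  rw [h3]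
  refine Submodule.smul_mem _ _ (Submodule.sum_mem _ fun p hp => ?_)
  by_cases h0 : x p = 0
  · rw [h0, zero_smul]; exact zero_mem _
  · refine Submodule.smul_mem _ _ (Submodule.subset_span ⟨p, ⟨p.2, ?_⟩, rfl, h1 p h0⟩)
    intro he
    exact (Finset.mem_erase.1 hp).1 (Subtype.ext he)

lemma GMod.next_min [IsNoetherianRing R] (Q : GMod k S) (v : L) (x : (Q.next G).ι → k)
    (hx : x ∈ (Q.next G).W v) (j : (Q.next G).ι) (hj : x j ≠ 0) : v ≠ (Q.next G).b j := by
  rintro rfl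
  exact hj (Q.min_aux G x j hx.1 hx.2)

/-- the presentation matrix -/
noncomputable def GMod.M [IsNoetherianRing R] (Q : GMod k S) :
    ((Q.next G).ι → k) →ₗ[k] (Q.ι → k) := Q.mat G

lemma GMod.mem_W [IsNoetherianRing R] (Q : GMod k S) (v : L) (x : Q.ι → k) :
    x ∈ Q.W v ↔ ∃ y, (∀ j, y j ≠ 0 → v - (Q.next G).b j ∈ S) ∧ Q.M G y = x := by
  rw [Q.W_eq G]
  rfl

lemma GMod.mem_next_W [IsNoetherianRing R] (Q : GMod k S) (v : L) (x : (Q.next G).ι → k) :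
    x ∈ (Q.next G).W v ↔ (∀ j, x j ≠ 0 → v - (Q.next G).b j ∈ S) ∧ Q.M G x = 0 := Iff.rfl

lemma GMod.M_single_aux [IsNoetherianRing R] (Q : GMod k S) [DecidableEq (Q.gens G)] (l : Q.gens G) :
    Q.mat G (Pi.single l 1) = l.1.2 := by
  change ∑ p : Q.gens G, (Pi.single l (1 : k) : Q.gens G → k) p • p.1.2 = l.1.2
  rw [Finset.sum_eq_single l]
  · rw [Pi.single_eq_same, one_smul]
  · intro q _ hq; rw [Pi.single_eq_of_ne hq, zero_smul]
  · intro h; exact absurd (Finset.mem_univ _) h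

lemma GMod.M_single_mem [IsNoetherianRing R] (Q : GMod k S) (l : (Q.next G).ι) :
    Q.M G (Pi.single l 1) ∈ Q.W ((Q.next G).b l) := by
  have h : Q.M G (Pi.single l 1) = (id l : Q.gens G).1.2 :=
    @GMod.M_single_aux _ _ _ _ _ _ _ G _ Q (Q.next G).dι l
  rw [h]
  exact Q.gen_mem G l

lemma GMod.M_single_ne [IsNoetherianRing R] (Q : GMod k S) (l : (Q.next G).ι) :
    Q.M G (Pi.single l 1) ≠ 0 := by
  have h : Q.M G (Pi.single l 1) = (id l : Q.gens G).1.2 :=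
    @GMod.M_single_aux _ _ _ _ _ _ _ G _ Q (Q.next G).dι l
  rw [h]
  exact Q.gen_ne_zero G l

end Graded

section Res
variable {k L R : Type} [Field k] [AddCommGroup L] [CommRing R]

/-- combinatorial data of a minimal graded free resolution of the monomial ideal of `U` -/
structure MinRes (k : Type) {L : Type} [Field k] [AddCommGroup L] (S : AddSubmonoid L)
    (U : Set L) (deg : L →+ ℤ) where
  ι : ℕ → Type
  fι : ∀ i, Fintype (ι i)
  dι : ∀ i, DecidableEq (ι i)
  b : ∀ i, ι i → L
  g : ι 0 → k
  M : ∀ i, (ι (i + 1) → k) →ₗ[k] (ι i → k)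
  g_ne : ∀ j, g j ≠ 0
  b0 : ∀ j, b 0 j ∈ U
  gen : ∀ v ∈ U, ∃ j, v - b 0 j ∈ S
  M_supp : ∀ i l j, M i (Pi.single l 1) j ≠ 0 → b (i + 1) l - b i j ∈ S
  gM : ∀ y, ∑ j, g j * M 0 y j = 0
  ex0 : ∀ v x, (∀ j, x j ≠ 0 → v - b 0 j ∈ S) → ∑ j, g j * x j = 0 →
    ∃ y, (∀ l, y l ≠ 0 → v - b 1 l ∈ S) ∧ M 0 y = x
  MM : ∀ i y, M i (M (i + 1) y) = 0
  ex : ∀ i v x, (∀ j, x j ≠ 0 → v - b (i + 1) j ∈ S) → M i x = 0 →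
    ∃ y, (∀ l, y l ≠ 0 → v - b (i + 2) l ∈ S) ∧ M (i + 1) y = x
  hdeg : ∀ (i : ℕ) (j : ι i), (i : ℤ) ≤ deg (b i j)

attribute [instance] MinRes.fι MinRes.dι

open Classical in
/-- the zeroth state -/
noncomputable def gmod0 (k : Type) [Field k] {S : AddSubmonoid L} {U : Set L}
    (hUS : ∀ v ∈ U, v ∈ S) (hU : ∀ v ∈ U, ∀ s ∈ S, v + s ∈ U) : GMod k S where
  ι := Unit
  fι := inferInstance
  dι := inferInstance
  b _ := 0
  W v := if v ∈ U then ⊤ else ⊥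
  supp v x hx j hj := by
    rw [sub_zero]
    split_ifs at hx with h
    · exact hUS v h
    · rw [Submodule.mem_bot] at hx
      exact absurd (congrFun hx j) hj
  mono v s hs := by
    split_ifs with h h'
    · exact le_rfl
    · exact absurd (hU v h s hs) h'
    · exact bot_le
    · exact le_rfl

/-- iterated syzygies -/
noncomputable def gmodSeq {S : AddSubmonoid L} (G : GrRing k R S) [IsNoetherianRing R]
    (Q : GMod k S) : ℕ → GMod k S
  | 0 => Q
  | i + 1 => (gmodSeq G Q i).next G

lemma GMod.M_apply [IsNoetherianRing R] {S : AddSubmonoid L} (G : GrRing k R S) (Q : GMod k S)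
    (y : (Q.next G).ι → k) : Q.M G y = ∑ l, y l • Q.M G (Pi.single l 1) := by
  conv_lhs => rw [← Finset.univ_sum_single y]
  rw [map_sum]
  refine Finset.sum_congr rfl fun l _ => ?_
  rw [← map_smul]
  congr 1
  ext j
  by_cases h : j = l
  · subst h; simp
  · simp [Pi.single_eq_of_ne h]

lemma GMod.MM [IsNoetherianRing R] {S : AddSubmonoid L} (G : GrRing k R S) (Q : GMod k S)
    (y : ((Q.next G).next G).ι → k) : Q.M G ((Q.next G).M G y) = 0 := by
  rw [GMod.M_apply G (Q.next G) y, map_sum]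
  refine Finset.sum_eq_zero fun l _ => ?_
  rw [map_smul]
  rw [((Q.mem_next_W G _ _).1 ((Q.next G).M_single_mem G l)).2, smul_zero]

lemma GMod.next_supp [IsNoetherianRing R] {S : AddSubmonoid L} (G : GrRing k R S) (Q : GMod k S)
    (l : (Q.next G).ι) (j : Q.ι) (h : Q.M G (Pi.single l 1) j ≠ 0) :
    (Q.next G).b l - Q.b j ∈ S := Q.supp _ _ (Q.M_single_mem G l) j h

theorem exists_minRes {S : AddSubmonoid L} (G : GrRing k R S) [IsNoetherianRing R] {U : Set L}
    (deg : L →+ ℤ) (hdeg : ∀ s ∈ S, s ≠ 0 → 1 ≤ deg s)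
    (hUS : ∀ v ∈ U, v ∈ S) (hU : ∀ v ∈ U, ∀ s ∈ S, v + s ∈ U) : Nonempty (MinRes k S U deg) := by
  classical
  have hdeg0 : ∀ s ∈ S, 0 ≤ deg s := fun s hs => by
    by_cases h : s = 0
    · rw [h, map_zero]
    · exact zero_le_one.trans (hdeg s hs h)
  let Q := gmodSeq G (gmod0 k hUS hU)
  have hW0 : ∀ v (x : (Q 0).ι → k), x ∈ (Q 0).W v ↔ (v ∈ U ∨ x = 0) := by
    intro v x
    change x ∈ (if v ∈ U then (⊤ : Submodule k (Unit → k)) else ⊥) ↔ _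
    split_ifs with h
    · exact ⟨fun _ => Or.inl h, fun _ => Submodule.mem_top (R := k) (M := Unit → k)⟩
    · simp only [h, false_or]; exact Submodule.mem_bot (M := Unit → k) k
  have hg : ∀ j, (Q 0).M G (Pi.single j 1) () ≠ 0 := by
    intro j h
    apply (Q 0).M_single_ne G j
    exact funext fun _ => h
  have hM0 : ∀ y, (Q 0).M G y () = ∑ j, (Q 0).M G (Pi.single j 1) () * y j := by
    intro y
    rw [GMod.M_apply]
    erw [Finset.sum_apply]
    exact Finset.sum_congr rfl fun j _ => mul_comm _ _
  have hb0 : ∀ j, (Q 1).b j ∈ U := fun j =>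
    ((hW0 _ _).1 ((Q 0).M_single_mem G j)).resolve_right ((Q 0).M_single_ne G j)
  refine ⟨{ ι := fun i => (Q (i + 1)).ι
            fι := fun i => (Q (i + 1)).fι
            dι := fun i => (Q (i + 1)).dι
            b := fun i => (Q (i + 1)).b
            g := fun j => (Q 0).M G (Pi.single j 1) ()
            M := fun i => (Q (i + 1)).M G
            g_ne := hg
            b0 := hb0
            gen := ?_
            M_supp := fun i l j h => GMod.next_supp G (Q (i + 1)) l j h
            gM := ?_
            ex0 := ?_
            MM := fun i y => GMod.MM G (Q (i + 1)) y
            ex := ?_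
            hdeg := ?_ }⟩
  · intro v hv
    obtain ⟨y, hy, hy'⟩ := ((Q 0).mem_W G v (fun _ => 1)).1 ((hW0 _ _).2 (Or.inl hv))
    have : y ≠ 0 := by
      rintro rfl
      rw [map_zero] at hy'
      exact zero_ne_one (congrFun hy' ())
    obtain ⟨j, hj⟩ := Function.ne_iff.1 this
    exact ⟨j, hy j hj⟩
  · intro y
    exact (hM0 ((Q 1).M G y)).symm.trans (congrFun (GMod.MM G (Q 0) y) ())
  · intro v x hx h
    replace h := (hM0 x).trans h
    exact ((Q 1).mem_W G v x).1 (((Q 0).mem_next_W G v x).2 ⟨hx, funext fun _ => h⟩)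
  · intro i v x hx h
    exact ((Q (i + 2)).mem_W G v x).1 (((Q (i + 1)).mem_next_W G v x).2 ⟨hx, h⟩)
  · intro i
    induction i with
    | zero => intro j; exact_mod_cast hdeg0 _ (hUS _ (hb0 j))
    | succ i ih =>
      intro l
      obtain ⟨j, hj⟩ := Function.ne_iff.1 ((Q (i + 1)).M_single_ne G l)
      have h1 := GMod.next_supp G (Q (i + 1)) l j hj
      have h2 := (Q i).next_min G _ _ ((Q (i + 1)).M_single_mem G l) j hj
      have h3 := hdeg _ h1 (sub_ne_zero.2 h2)
      rw [map_sub] at h3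
      have h4 := ih j
      push_cast
      change (i : ℤ) + 1 ≤ deg (((Q (i + 1)).next G).b l)
      linarith
end Res

section Res
variable {k L R : Type} [Field k] [AddCommGroup L] [CommRing R]
variable {S : AddSubmonoid L} {U : Set L} {deg : L →+ ℤ}

lemma GrRing.lift_coef (G : GrRing k R S) {ι V : Type} [AddCommGroup V] [Module k V] (b : ι → L)
    (Φ : (ι → k) →ₗ[k] V) (F : L → V) (hfin : {v | F v ≠ 0}.Finite)
    (h : ∀ v, ∃ y : ι → k, (∀ l, y l ≠ 0 → v - b l ∈ S) ∧ Φ y = F v) :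
    ∃ Y : ι → R, ∀ v, Φ (G.coef b v Y) = F v := by
  classical
  choose y hy hy' using h
  refine ⟨∑ v ∈ hfin.toFinset, G.hom b v (y v), fun v => ?_⟩
  rw [map_sum]
  by_cases hv : F v = 0
  · rw [Finset.sum_eq_zero, map_zero, hv]
    intro w hw
    refine G.coef_hom_ne _ _ _ ?_ _
    rintro rfl
    exact (hfin.mem_toFinset.1 hw) hv
  · rw [Finset.sum_eq_single v, G.coef_hom_self _ _ _ (hy v), hy']
    · intro w _ hw
      exact G.coef_hom_ne _ _ _ hw.symm _
    · intro h
      exact absurd (hfin.mem_toFinset.2 hv) h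

lemma GrRing.mon_zero_one (G : GrRing k R S) : G.mon 0 1 = 1 := by
  have : ∀ r, G.mon 0 1 * r = r := fun r => G.ext' _ _ fun v => by
    rw [G.mon_mul 0 (zero_mem _), sub_zero, one_mul]
  rw [← mul_one (G.mon 0 1), this]

lemma GrRing.coef_finite (G : GrRing k R S) {ι : Type} [Finite ι] (b : ι → L) (X : ι → R) :
    {v | G.coef b v X ≠ 0}.Finite := by
  have : {v | G.coef b v X ≠ 0} ⊆ ⋃ j : ι, (fun w => w + b j) '' Function.support (G.c (X j)) := by
    intro v hv
    obtain ⟨j, hj⟩ := Function.ne_iff.1 hv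
    exact Set.mem_iUnion.2 ⟨j, v - b j, hj, sub_add_cancel _ _⟩
  exact (Set.finite_iUnion fun j => (G.fin (X j)).image _).subset this

open Classical in
/-- matrix entries as monomials; zero if the coefficient vanishes -/
noncomputable def GrRing.m0 (G : GrRing k R S) (s : L) (a : k) : R := if a = 0 then 0 else G.mon s a

lemma GrRing.c_m0_mul (G : GrRing k R S) (s : L) (a : k) (h : a ≠ 0 → s ∈ S) (r : R) (v : L) :
    G.c (G.m0 s a * r) v = a * G.c r (v - s) := by
  unfold GrRing.m0
  split_ifs with h0
  · rw [zero_mul, map_zero, h0, zero_mul]; rfl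
  · exact G.mon_mul s (h h0) a r v

namespace MinRes
variable (D : MinRes k S U deg) (G : GrRing k R S)

/-- transposed differential -/
def Mt (i : ℕ) : (D.ι i → k) →ₗ[k] (D.ι (i + 1) → k) where
  toFun x l := ∑ j, x j * D.M i (Pi.single l 1) j
  map_add' x y := by
    ext l
    simp only [Pi.add_apply, add_mul, Finset.sum_add_distrib]
  map_smul' a x := by
    ext l
    simp only [Pi.smul_apply, smul_eq_mul, mul_assoc, Finset.mul_sum, RingHom.id_apply]

lemma Mt_apply (i : ℕ) (x : D.ι i → k) (l) : D.Mt i x l = ∑ j, x j * D.M i (Pi.single l 1) j := rfl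

lemma M_apply (i : ℕ) (y : D.ι (i + 1) → k) (j) :
    D.M i y j = ∑ l, D.M i (Pi.single l 1) j * y l := by
  conv_lhs => rw [← Finset.univ_sum_single y]
  rw [map_sum, Finset.sum_apply]
  refine Finset.sum_congr rfl fun l _ => ?_
  have : (Pi.single l (y l) : D.ι (i + 1) → k) = y l • Pi.single l 1 := by
    ext j
    by_cases h : j = l
    · subst h; simp
    · simp [Pi.single_eq_of_ne h]
  rw [this, map_smul, Pi.smul_apply, smul_eq_mul, mul_comm]

lemma Mt_pair (i : ℕ) (x : D.ι i → k) (y : D.ι (i + 1) → k) :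
    ∑ j, x j * D.M i y j = ∑ l, D.Mt i x l * y l := by
  simp only [D.M_apply i y, D.Mt_apply, Finset.mul_sum, Finset.sum_mul]
  rw [Finset.sum_comm]
  exact Finset.sum_congr rfl fun l _ => Finset.sum_congr rfl fun j _ => by ring

lemma Mt_Mt (i : ℕ) (x : D.ι i → k) : D.Mt (i + 1) (D.Mt i x) = 0 := by
  ext l
  have h := D.Mt_pair i x (D.M (i + 1) (Pi.single l 1))
  rw [D.MM] at h
  rw [D.Mt_apply, ← h]
  simp

lemma Mt_g : D.Mt 0 D.g = 0 := by
  ext l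
  rw [D.Mt_apply, D.gM]; rfl

lemma Mt_supp (hU : ∀ v ∈ U, ∀ s ∈ S, v + s ∈ U) (i : ℕ) (v : L) (x : D.ι i → k)
    (hx : ∀ j, x j ≠ 0 → v + D.b i j ∈ U) (l) (hl : D.Mt i x l ≠ 0) : v + D.b (i + 1) l ∈ U := by
  obtain ⟨j, _, hj⟩ := Finset.exists_ne_zero_of_sum_ne_zero hl
  have := hU _ (hx j (left_ne_zero_of_mul hj)) _ (D.M_supp i l j (right_ne_zero_of_mul hj))
  rwa [add_assoc, add_sub_cancel] at this

lemma M_supp' (i : ℕ) (v : L) (x : D.ι (i + 1) → k)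
    (hx : ∀ j, x j ≠ 0 → v - D.b (i + 1) j ∈ S) (l) (hl : D.M i x l ≠ 0) : v - D.b i l ∈ S := by
  rw [D.M_apply] at hl
  obtain ⟨j, _, hj⟩ := Finset.exists_ne_zero_of_sum_ne_zero hl
  have := add_mem (hx j (right_ne_zero_of_mul hj)) (D.M_supp i j l (left_ne_zero_of_mul hj))
  rwa [sub_add_sub_cancel] at this

/-- differential over `R` -/
noncomputable def d (i : ℕ) : (D.ι (i + 1) → R) →ₗ[R] (D.ι i → R) where
  toFun X j := ∑ l, G.m0 (D.b (i + 1) l - D.b i j) (D.M i (Pi.single l 1) j) * X l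
  map_add' x y := by
    ext l
    simp only [Pi.add_apply, mul_add, Finset.sum_add_distrib]
  map_smul' a x := by
    ext l
    simp only [Pi.smul_apply, smul_eq_mul, Finset.mul_sum, RingHom.id_apply]
    exact Finset.sum_congr rfl fun j _ => by ring

lemma coef_d (i : ℕ) (X : D.ι (i + 1) → R) (v : L) :
    G.coef (D.b i) v (D.d G i X) = D.M i (G.coef (D.b (i + 1)) v X) := by
  ext j
  rw [D.M_apply]
  change G.c (∑ l, G.m0 (D.b (i + 1) l - D.b i j) (D.M i (Pi.single l 1) j) * X l) (v - D.b i j) = _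
  rw [map_sum, Finset.sum_apply]
  refine Finset.sum_congr rfl fun l _ => ?_
  rw [G.c_m0_mul _ _ (D.M_supp i l j)]
  rw [sub_sub_sub_cancel_right]
  rfl

/-- functional over `R` given by a vector `x`, shift `v` -/
noncomputable def fn {ι : Type} [Fintype ι] (b : ι → L) (v : L) (x : ι → k) : (ι → R) →ₗ[R] R where
  toFun X := ∑ j, G.m0 (v + b j) (x j) * X j
  map_add' x y := by
    simp only [Pi.add_apply, mul_add, Finset.sum_add_distrib]
  map_smul' a x := by
    simp only [Pi.smul_apply, smul_eq_mul, Finset.mul_sum, RingHom.id_apply]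
    exact Finset.sum_congr rfl fun j _ => by ring

lemma c_fn {ι : Type} [Fintype ι] (b : ι → L) (v : L) (x : ι → k)
    (hx : ∀ j, x j ≠ 0 → v + b j ∈ S) (X : ι → R) (w : L) :
    G.c (fn G b v x X) w = ∑ j, x j * G.coef b (w - v) X j := by
  change G.c (∑ j, G.m0 (v + b j) (x j) * X j) w = _
  rw [map_sum, Finset.sum_apply]
  refine Finset.sum_congr rfl fun l _ => ?_
  rw [G.c_m0_mul _ _ (hx l), ← sub_sub]
  rfl

lemma ext_coef (G : GrRing k R S) {ι : Type} (b : ι → L) (X Y : ι → R)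
    (h : ∀ v, G.coef b v X = G.coef b v Y) : X = Y := by
  ext j
  apply G.ext'
  intro v
  have := congrFun (h (v + b j)) j
  change G.c (X j) (v + b j - b j) = G.c (Y j) (v + b j - b j) at this
  rwa [add_sub_cancel_right] at this

lemma coef_supp (G : GrRing k R S) {ι : Type} (b : ι → L) (X : ι → R) (v : L) (j : ι)
    (h : G.coef b v X j ≠ 0) : v - b j ∈ S := G.supp _ _ h

lemma coef_single (G : GrRing k R S) {ι : Type} [DecidableEq ι] (b : ι → L) (l j : ι) :
    G.coef b (b l) (Pi.single l 1) j = (Pi.single l 1 : ι → k) j := by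
  change G.c ((Pi.single l 1 : ι → R) j) (b l - b j) = _
  by_cases h : j = l
  · subst h
    rw [Pi.single_eq_same, Pi.single_eq_same, sub_self, ← G.mon_zero_one,
      G.c_mon_self _ (zero_mem _)]
  · rw [Pi.single_eq_of_ne h, Pi.single_eq_of_ne h, map_zero]; rfl

lemma exact_d (i : ℕ) : Function.Exact (D.d G (i + 1)) (D.d G i) := by
  intro X
  constructor
  · intro hX
    have h : ∀ v, ∃ y, (∀ l, y l ≠ 0 → v - D.b (i + 2) l ∈ S) ∧
        D.M (i + 1) y = G.coef (D.b (i + 1)) v X := by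
      intro v
      refine D.ex i v _ (coef_supp G _ X v) ?_
      rw [← coef_d, hX, map_zero]
    obtain ⟨Y, hY⟩ := G.lift_coef (D.b (i + 2)) (D.M (i + 1)) _ (G.coef_finite _ X) h
    refine ⟨Y, ext_coef G (D.b (i + 1)) _ _ fun v => ?_⟩
    rw [← hY, coef_d]
  · rintro ⟨Y, rfl⟩
    refine ext_coef G (D.b i) _ _ fun v => ?_
    rw [coef_d, coef_d, D.MM, map_zero]

/-- functional with values in the ideal -/
noncomputable def fnJ (J : Ideal R) (hJ : ∀ r, r ∈ J ↔ ∀ v, G.c r v ≠ 0 → v ∈ U)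
    (hUS : ∀ v ∈ U, v ∈ S) (hU : ∀ v ∈ U, ∀ s ∈ S, v + s ∈ U) {ι : Type} [Fintype ι] (b : ι → L)
    (v : L) (x : ι → k) (hx : ∀ j, x j ≠ 0 → v + b j ∈ U) : (ι → R) →ₗ[R] J :=
  (fn G b v x).codRestrict J (fun X => by
    rw [hJ]
    intro w hw
    rw [c_fn G b v x (fun j hj => hUS _ (hx j hj))] at hw
    obtain ⟨j, _, hj⟩ := Finset.exists_ne_zero_of_sum_ne_zero hw
    have h1 := hU _ (hx j (left_ne_zero_of_mul hj)) _ (coef_supp G b X _ j (right_ne_zero_of_mul hj))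
    have h2 : v + b j + (w - v - b j) = w := by abel
    rwa [h2] at h1)

lemma exact_eps (J : Ideal R) (hJ : ∀ r, r ∈ J ↔ ∀ v, G.c r v ≠ 0 → v ∈ U)
    (hUS : ∀ v ∈ U, v ∈ S) (hU : ∀ v ∈ U, ∀ s ∈ S, v + s ∈ U) :
    ∃ ε : (D.ι 0 → R) →ₗ[R] J, Function.Surjective ε ∧ Function.Exact (D.d G 0) ε ∧
      ∀ X w, G.c (ε X) w = ∑ j, D.g j * G.coef (D.b 0) w X j := by
  have hx : ∀ j, D.g j ≠ 0 → 0 + D.b 0 j ∈ U := fun j _ => by rw [zero_add]; exact D.b0 j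
  let ε := fnJ G J hJ hUS hU (D.b 0) 0 D.g hx
  have hc : ∀ X w, G.c (ε X : R) w = ∑ j, D.g j * G.coef (D.b 0) w X j := fun X w => by
    have := c_fn G (D.b 0) 0 D.g (fun j hj => hUS _ (hx j hj)) X w
    rw [sub_zero] at this
    exact this
  refine ⟨ε, ?_, ?_, hc⟩
  · rintro ⟨r, hr⟩
    let Φ : (D.ι 0 → k) →ₗ[k] k := ∑ j, D.g j • LinearMap.proj j
    have hΦ : ∀ x, Φ x = ∑ j, D.g j * x j := fun x => by
      simp [Φ]
    have h : ∀ v, ∃ y : D.ι 0 → k, (∀ l, y l ≠ 0 → v - D.b 0 l ∈ S) ∧ Φ y = G.c r v := by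
      intro v
      by_cases h0 : G.c r v = 0
      · exact ⟨0, fun l hl => absurd rfl hl, by rw [map_zero, h0]⟩
      · obtain ⟨j, hj⟩ := D.gen v ((hJ r).1 hr v h0)
        refine ⟨Pi.single j ((D.g j)⁻¹ * G.c r v), fun l hl => ?_, ?_⟩
        · by_cases hlj : l = j
          · rw [hlj]; exact hj
          · rw [Pi.single_eq_of_ne hlj] at hl; exact absurd rfl hl
        · rw [hΦ, Finset.sum_eq_single j]
          · rw [Pi.single_eq_same, mul_inv_cancel_left₀ (D.g_ne j)]
          · intro l _ hl; rw [Pi.single_eq_of_ne hl, mul_zero]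
          · intro h; exact absurd (Finset.mem_univ _) h
    obtain ⟨Y, hY⟩ := G.lift_coef (D.b 0) Φ _ (G.fin r) h
    refine ⟨Y, Subtype.ext (G.ext' _ _ fun v => ?_)⟩
    rw [hc, ← hΦ, hY]
  · intro X
    constructor
    · intro hX
      have h : ∀ v, ∃ y, (∀ l, y l ≠ 0 → v - D.b 1 l ∈ S) ∧
          D.M 0 y = G.coef (D.b 0) v X := by
        intro v
        refine D.ex0 v _ (coef_supp G _ X v) ?_
        rw [← hc, hX]
        change G.c 0 v = 0
        rw [map_zero]; rfl
      obtain ⟨Y, hY⟩ := G.lift_coef (D.b 1) (D.M 0) _ (G.coef_finite _ X) h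
      refine ⟨Y, ext_coef G (D.b 0) _ _ fun v => ?_⟩
      rw [← hY, coef_d]
    · rintro ⟨Y, rfl⟩
      refine Subtype.ext (G.ext' _ _ fun v => ?_)
      rw [hc, coef_d, D.gM]
      change 0 = G.c 0 v
      rw [map_zero]; rfl

end MinRes
end Res

section Res
variable {k L R : Type} [Field k] [AddCommGroup L] [CommRing R]
variable {S : AddSubmonoid L} {U : Set L} {deg : L →+ ℤ}

namespace MinRes
variable (D : MinRes k S U deg) (G : GrRing k R S)

lemma fn_single {ι : Type} [Fintype ι] [DecidableEq ι] (b : ι → L) (v : L) (x : ι → k)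
    (hx : ∀ j, x j ≠ 0 → v + b j ∈ S) (l : ι) :
    G.c (fn G b v x (Pi.single l 1)) (v + b l) = x l := by
  rw [c_fn G b v x hx, add_sub_cancel_left]
  simp only [coef_single]
  rw [Finset.sum_eq_single l]
  · rw [Pi.single_eq_same, mul_one]
  · intro j _ hj; rw [Pi.single_eq_of_ne hj, mul_zero]
  · intro h; exact absurd (Finset.mem_univ _) h

theorem dual_exact (J : Ideal R) (hJ : ∀ r, r ∈ J ↔ ∀ v, G.c r v ≠ 0 → v ∈ U)
    (hUS : ∀ v ∈ U, v ∈ S) (hU : ∀ v ∈ U, ∀ s ∈ S, v + s ∈ U)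
    (C : ModuleCat.{0} R) (hC : IsSemidualizing C) (e : C ≃ₗ[R] J) (i : ℕ) (v : L)
    (x : D.ι (i + 1) → k) (hx : ∀ j, x j ≠ 0 → v + D.b (i + 1) j ∈ U)
    (h0 : D.Mt (i + 1) x = 0) :
    ∃ z : D.ι i → k, (∀ j, z j ≠ 0 → v + D.b i j ∈ U) ∧ D.Mt i z = x := by
  obtain ⟨ε, hε, hex, -⟩ := D.exact_eps G J hJ hUS hU
  have hxS : ∀ j, x j ≠ 0 → v + D.b (i + 1) j ∈ S := fun j hj => hUS _ (hx j hj)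
  let f := fnJ G J hJ hUS hU (D.b (i + 1)) v x hx
  have hfd : f.comp (D.d G (i + 1)) = 0 := by
    refine LinearMap.ext fun X => Subtype.ext (G.ext' _ _ fun w => ?_)
    change G.c (fn G (D.b (i + 1)) v x (D.d G (i + 1) X)) w = G.c 0 w
    rw [c_fn G _ v x hxS, coef_d, D.Mt_pair, h0, map_zero]
    simp
  obtain ⟨g, hg⟩ := ext_lift_free (fun i => D.ι i → R) C C (D.d G)
    (e.symm.toLinearMap.comp ε) (e.symm.surjective.comp hε)
    (fun X => by
      rw [← hex X]
      change e.symm (ε X) = 0 ↔ _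
      rw [e.symm.map_eq_zero_iff])
    (fun i => D.exact_d G i) i (hC.2.2 (i + 1) (by omega)) (e.symm.toLinearMap.comp f)
    (by rw [LinearMap.comp_assoc, hfd, LinearMap.comp_zero])
  have hg' : ∀ Y, e (g (D.d G i Y)) = f Y := fun Y => by
    have := LinearMap.congr_fun hg Y
    change g (D.d G i Y) = e.symm (f Y) at this
    rw [this, e.apply_symm_apply]
  let g' : (D.ι i → R) →ₗ[R] J := e.toLinearMap.comp g
  have hgs : ∀ X, (g' X : R) = ∑ j, X j * (g' (Pi.single j 1) : R) := by
    intro X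
    conv_lhs => rw [← Finset.univ_sum_single X]
    rw [map_sum, Submodule.coe_sum]
    refine Finset.sum_congr rfl fun j _ => ?_
    have : (Pi.single j (X j) : D.ι i → R) = X j • Pi.single j 1 := by
      ext l
      by_cases h : l = j
      · subst h; simp
      · simp [Pi.single_eq_of_ne h]
    rw [this, map_smul]
    rfl
  refine ⟨fun j => G.c (g' (Pi.single j 1) : R) (v + D.b i j), fun j hj => ?_, ?_⟩
  · exact (hJ _).1 (g' (Pi.single j 1)).2 _ hj
  · ext l
    have h1 : G.c (f (Pi.single l 1) : R) (v + D.b (i + 1) l) = x l :=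
      fn_single G _ v x hxS l
    rw [← h1, ← hg']
    change _ = G.c (g' (D.d G i (Pi.single l 1)) : R) _
    rw [hgs, map_sum, Finset.sum_apply, Mt_apply]
    refine Finset.sum_congr rfl fun j _ => ?_
    have h2 : D.d G i (Pi.single l 1) j =
        G.m0 (D.b (i + 1) l - D.b i j) (D.M i (Pi.single l 1) j) := by
      change ∑ l', G.m0 (D.b (i + 1) l' - D.b i j) (D.M i (Pi.single l' 1) j) *
        (Pi.single l 1 : D.ι (i + 1) → R) l' = _
      rw [Finset.sum_eq_single l]
      · rw [Pi.single_eq_same, mul_one]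
      · intro j _ hj; rw [Pi.single_eq_of_ne hj, mul_zero]
      · intro h; exact absurd (Finset.mem_univ _) h
    rw [h2, G.c_m0_mul _ _ (D.M_supp i l j), mul_comm]
    have h3 : v + D.b (i + 1) l - (D.b (i + 1) l - D.b i j) = v + D.b i j := by abel
    rw [h3]

theorem dual_exact0 (J : Ideal R) (hJ : ∀ r, r ∈ J ↔ ∀ v, G.c r v ≠ 0 → v ∈ U)
    (hUS : ∀ v ∈ U, v ∈ S) (hU : ∀ v ∈ U, ∀ s ∈ S, v + s ∈ U)
    (C : ModuleCat.{0} R) (hC : IsSemidualizing C) (e : C ≃ₗ[R] J) (v : L)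
    (x : D.ι 0 → k) (hx : ∀ j, x j ≠ 0 → v + D.b 0 j ∈ U)
    (h0 : D.Mt 0 x = 0) : ∃ a : k, (a ≠ 0 → v ∈ S) ∧ x = a • D.g := by
  obtain ⟨ε, hε, hex, hc⟩ := D.exact_eps G J hJ hUS hU
  have hxS : ∀ j, x j ≠ 0 → v + D.b 0 j ∈ S := fun j hj => hUS _ (hx j hj)
  let f := fnJ G J hJ hUS hU (D.b 0) v x hx
  have hfd : ∀ X, f (D.d G 0 X) = 0 := by
    refine fun X => Subtype.ext (G.ext' _ _ fun w => ?_)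
    change G.c (fn G (D.b 0) v x (D.d G 0 X)) w = G.c 0 w
    rw [c_fn G _ v x hxS, coef_d, D.Mt_pair, h0, map_zero]
    simp
  have hker : LinearMap.ker ε ≤ LinearMap.ker f := by
    intro X hX
    obtain ⟨Y, rfl⟩ := (hex X).1 hX
    exact hfd Y
  let h : J →ₗ[R] J := ((LinearMap.ker ε).liftQ f hker).comp
    (ε.quotKerEquivOfSurjective hε).symm.toLinearMap
  have hh : ∀ X, h (ε X) = f X := by
    intro X
    have : (ε.quotKerEquivOfSurjective hε).symm (ε X) = (LinearMap.ker ε).mkQ X := by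
      rw [LinearEquiv.symm_apply_eq]; rfl
    change (LinearMap.ker ε).liftQ f hker ((ε.quotKerEquivOfSurjective hε).symm (ε X)) = _
    rw [this]; rfl
  let h' : C →ₗ[R] C := e.symm.toLinearMap.comp (h.comp e.toLinearMap)
  obtain ⟨r, hr⟩ := hC.2.1.2 h'
  have hr' : ∀ y : J, h y = r • y := by
    intro y
    have h1 : e.symm (h (e (e.symm y))) = r • e.symm y := (LinearMap.congr_fun hr (e.symm y)).symm
    rw [e.apply_symm_apply, ← map_smul] at h1
    exact e.symm.injective h1
  refine ⟨G.c r v, G.supp r v, ?_⟩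
  ext j
  have h1 : G.c (f (Pi.single j 1) : R) (v + D.b 0 j) = x j := fn_single G _ v x hxS j
  rw [← h1, ← hh, hr']
  change G.c (r * (ε (Pi.single j 1) : R)) _ = G.c r v * D.g j
  have h2 : (ε (Pi.single j 1) : R) = G.m0 (D.b 0 j) (D.g j) := by
    have hS : D.g j ≠ 0 → D.b 0 j ∈ S := fun _ => hUS _ (D.b0 j)
    apply G.ext'
    intro w
    rw [hc, ← mul_one (G.m0 _ _), G.c_m0_mul _ _ hS, Finset.sum_eq_single j]
    · congr 1
      change G.c ((Pi.single j 1 : D.ι 0 → R) j) _ = _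
      rw [Pi.single_eq_same]
    · intro l _ hl
      change D.g l * G.c ((Pi.single j 1 : D.ι 0 → R) l) _ = _
      rw [Pi.single_eq_of_ne hl, map_zero]; exact mul_zero _
    · intro h; exact absurd (Finset.mem_univ _) h
  rw [h2, mul_comm, G.c_m0_mul _ _ (fun _ => hUS _ (D.b0 j)), add_sub_cancel_right, mul_comm]

end MinRes
end Res

section Koszul
variable {κ : Type} [Fintype κ] [LinearOrder κ]

/-- Koszul sign -/
def ksgn (k : Type) [CommRing k] (x : κ) (T : Finset κ) : k := (-1) ^ (T.filter (· < x)).card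

lemma ksgn_mul_self (k : Type) [CommRing k] (x : κ) (T : Finset κ) :
    ksgn k x T * ksgn k x T = 1 := by
  unfold ksgn
  rw [← mul_pow]; simp

lemma ksgn_insert_lt (k : Type) [CommRing k] (x y : κ) (T : Finset κ) (hy : y ∉ T) (h : y < x) :
    ksgn k x (insert y T) = - ksgn k x T := by
  unfold ksgn
  rw [Finset.filter_insert, if_pos h, Finset.card_insert_of_notMem, pow_succ]
  · ring
  · simp [hy]

lemma ksgn_insert_gt (k : Type) [CommRing k] (x y : κ) (T : Finset κ) (h : ¬ y < x) :
    ksgn k x (insert y T) = ksgn k x T := by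
  unfold ksgn
  rw [Finset.filter_insert, if_neg h]

lemma ksgn_swap (k : Type) [CommRing k] (x y : κ) (T : Finset κ) (hxy : x ≠ y) (hx : x ∉ T)
    (hy : y ∉ T) :
    ksgn k y T * ksgn k x (insert y T) + ksgn k x T * ksgn k y (insert x T) = 0 := by
  rcases lt_or_gt_of_ne hxy with h | h
  · rw [ksgn_insert_gt k x y T h.not_gt, ksgn_insert_lt k y x T hx h]; ring
  · rw [ksgn_insert_lt k x y T hy h, ksgn_insert_gt k y x T h.not_gt]; ring

/-- Koszul differential -/
def kbd (k : Type) [CommRing k] (V : Type) [AddCommGroup V] [Module k V] :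
    (Finset κ → V) →ₗ[k] (Finset κ → V) where
  toFun c T := ∑ y ∈ Tᶜ, ksgn k y T • c (insert y T)
  map_add' c d := by
    ext T
    simp only [Pi.add_apply, smul_add, Finset.sum_add_distrib]
  map_smul' a c := by
    ext T
    simp only [Pi.smul_apply, Finset.smul_sum, RingHom.id_apply]
    exact Finset.sum_congr rfl fun y _ => smul_comm _ _ _

variable {k : Type} [CommRing k] {V : Type} [AddCommGroup V] [Module k V]

lemma kbd_apply (c : Finset κ → V) (T : Finset κ) :
    kbd k V c T = ∑ y ∈ Tᶜ, ksgn k y T • c (insert y T) := rfl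

lemma kbd_kbd (c : Finset κ → V) : kbd k V (kbd k V c) = 0 := by
  ext T
  rw [kbd_apply]
  simp only [kbd_apply, Finset.smul_sum, smul_smul]
  rw [Finset.sum_sigma']
  refine Finset.sum_involution (fun p _ => ⟨p.2, p.1⟩) ?_ ?_ ?_ ?_
  · rintro ⟨x, y⟩ h
    simp only [Finset.mem_sigma, Finset.mem_compl, Finset.mem_insert, not_or] at h
    simp only
    rw [Finset.insert_comm x y T, ← add_smul, ksgn_swap k y x T h.2.1 h.2.2 h.1, zero_smul]
  · rintro ⟨x, y⟩ h _ he
    simp only [Finset.mem_sigma, Finset.mem_compl, Finset.mem_insert, not_or] at h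
    simp only [Sigma.mk.injEq] at he
    exact h.2.1 he.1
  · rintro ⟨x, y⟩ h
    simp only [Finset.mem_sigma, Finset.mem_compl, Finset.mem_insert, not_or] at h ⊢
    exact ⟨h.2.2, fun h' => h.2.1 h'.symm, h.1⟩
  · rintro ⟨x, y⟩ h; rfl

/-- cone homotopy -/
def kcone (y : κ) (c : Finset κ → k) (T : Finset κ) : k :=
  if y ∈ T then ksgn k y (T.erase y) * c (T.erase y) else 0

lemma kbd_kcone (y : κ) (c : Finset κ → k) (hc : kbd k k c = 0) : kbd k k (kcone y c) = c := by
  ext T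
  rw [kbd_apply]
  by_cases hy : y ∈ T
  · obtain ⟨T', hT', rfl⟩ : ∃ T', y ∉ T' ∧ insert y T' = T :=
      ⟨T.erase y, Finset.notMem_erase _ _, Finset.insert_erase hy⟩
    have h := congrFun hc T'
    rw [kbd_apply] at h
    have hmem : y ∈ T'ᶜ := by simpa using hT'
    rw [← Finset.add_sum_erase _ _ hmem, Pi.zero_apply, ← eq_neg_iff_add_eq_zero] at h
    have hset : T'ᶜ.erase y = (insert y T')ᶜ := by
      ext x; simp [not_or]
    rw [hset] at h
    have h2 : c (insert y T') = - ksgn k y T' * ∑ x ∈ (insert y T')ᶜ, ksgn k x T' • c (insert x T') := by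
      rw [neg_mul, ← mul_neg, ← h, smul_eq_mul, ← mul_assoc, ksgn_mul_self, one_mul]
    rw [h2, Finset.mul_sum]
    refine Finset.sum_congr rfl fun x hx => ?_
    simp only [Finset.mem_compl, Finset.mem_insert, not_or] at hx
    have h3 : (insert x (insert y T')).erase y = insert x T' := by
      rw [Finset.insert_comm, Finset.erase_insert]
      simp [hT', Ne.symm hx.1]
    unfold kcone
    rw [if_pos (by simp), h3]
    simp only [smul_eq_mul]
    have h4 := ksgn_swap k x y T' hx.1 hx.2 hT'
    have h5 : ksgn k x (insert y T') * ksgn k y (insert x T') = - (ksgn k y T' * ksgn k x T') := by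
      have e1 : ksgn k y T' * (ksgn k y T' * ksgn k x (insert y T')) = ksgn k x (insert y T') := by
        rw [← mul_assoc, ksgn_mul_self, one_mul]
      have e2 : ksgn k y T' * ksgn k x (insert y T') = - (ksgn k x T' * ksgn k y (insert x T')) :=
        eq_neg_iff_add_eq_zero.2 h4
      rw [← e1, e2]
      have e3 := ksgn_mul_self k y (insert x T')
      linear_combination (- ksgn k y T' * ksgn k x T') * e3
    linear_combination h5 * c (insert x T')
  · rw [Finset.sum_eq_single y]
    · unfold kcone
      rw [if_pos (Finset.mem_insert_self _ _), Finset.erase_insert hy, smul_eq_mul, ← mul_assoc,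
        ksgn_mul_self, one_mul]
    · intro x _ hx
      unfold kcone
      rw [if_neg, smul_zero]
      simp [Ne.symm hx, hy]
    · intro h; simp [hy] at h

lemma kbd_map {W : Type} [AddCommGroup W] [Module k W] (f : V →ₗ[k] W) (c : Finset κ → V) :
    kbd k W (fun T => f (c T)) = fun T => f (kbd k V c T) := by
  ext T
  simp only [kbd_apply, map_sum, map_smul]

end Koszul

section Cone
variable {κ L : Type} [Fintype κ] [LinearOrder κ] [AddCommGroup L]

/-- sum of the generators in `T` -/
def eT (e : κ → L) (T : Finset κ) : L := ∑ y ∈ T, e y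

open Classical in
/-- the `K`-polynomial of `U`, as a function -/
noncomputable def KF (e : κ → L) (U : Set L) (w : L) : ℤ :=
  ∑ T : Finset κ, (-1) ^ T.card * (if w - eT e T ∈ U then 1 else 0)

/-- cone points for `w` -/
def IsConePt (e : κ → L) (U : Set L) (w : L) (y : κ) : Prop :=
  ∀ T : Finset κ, w - eT e T ∈ U → w - eT e (insert y T) ∈ U

def BadSet (e : κ → L) (U : Set L) : Set L := {w | ¬ ∃ y, IsConePt e U w y}

lemma eT_insert (e : κ → L) (y : κ) (T : Finset κ) (h : y ∉ T) :
    eT e (insert y T) = e y + eT e T := Finset.sum_insert h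

lemma rep_of_mem (e : κ → L) (s : L) (hs : s ∈ AddSubmonoid.closure (Set.range e)) :
    ∃ n : κ →₀ ℕ, s = ∑ y, n y • e y := by
  classical
  induction hs using AddSubmonoid.closure_induction with
  | mem x hx =>
    obtain ⟨y, rfl⟩ := hx
    refine ⟨Finsupp.single y 1, ?_⟩
    rw [Finset.sum_eq_single y]
    · simp
    · intro z _ hz; simp [Finsupp.single_apply, Ne.symm hz]
    · simp
  | zero => exact ⟨0, by simp⟩
  | add x y _ _ hx hy =>
    obtain ⟨n, rfl⟩ := hx
    obtain ⟨n', rfl⟩ := hy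
    exact ⟨n + n', by simp [add_smul, Finset.sum_add_distrib]⟩

lemma sum_mem_of (e : κ → L) (n : κ → ℕ) : ∑ y, n y • e y ∈ AddSubmonoid.closure (Set.range e) :=
  sum_mem fun y _ => nsmul_mem (AddSubmonoid.subset_closure (Set.mem_range_self y)) _

/-- minimal elements of a stable subset are finite in number -/
lemma finite_min (e : κ → L) (V : Set L)
    (hVS : ∀ v ∈ V, v ∈ AddSubmonoid.closure (Set.range e))
    (hV : ∀ v ∈ V, ∀ s ∈ AddSubmonoid.closure (Set.range e), v + s ∈ V) :
    {v | v ∈ V ∧ ∀ y, v - e y ∉ V}.Finite := by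
  classical
  have h : ∀ v : L, ∃ n : κ →₀ ℕ, v ∈ V → v = ∑ y, n y • e y := by
    intro v
    by_cases hv : v ∈ V
    · obtain ⟨n, hn⟩ := rep_of_mem e v (hVS v hv)
      exact ⟨n, fun _ => hn⟩
    · exact ⟨0, fun h => absurd h hv⟩
  choose n hn using h
  set A := {v | v ∈ V ∧ ∀ y, v - e y ∉ V} with hA
  have hinj : Set.InjOn n A := by
    intro v hv w hw he
    rw [hn v hv.1, hn w hw.1, he]
  have hanti : IsAntichain (· ≤ ·) (n '' A) := by
    rintro _ ⟨v, hv, rfl⟩ _ ⟨w, hw, rfl⟩ hne hle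
    apply hne
    by_contra hne'
    have : ∃ y, n v y < n w y := by
      by_contra hcon
      push Not at hcon
      exact hne' (le_antisymm hle hcon)
    obtain ⟨y, hy⟩ := this
    apply hw.2 y
    have hs := sum_mem_of e (fun z => if z = y then n w z - n v z - 1 else n w z - n v z)
    have h2 := hV v hv.1 _ hs
    have h3 : w - e y = v + ∑ z, (if z = y then n w z - n v z - 1 else n w z - n v z) • e z := by
      rw [sub_eq_iff_eq_add]
      refine (hn w hw.1).trans ?_
      have h5 := hn v hv.1
      suffices hh : ∑ y, n w y • e y = ∑ y, n v y • e y +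
          ∑ z, (if z = y then n w z - n v z - 1 else n w z - n v z) • e z + e y by
        rw [← h5] at hh; exact hh
      have h4 : e y = ∑ z, (if z = y then 1 else 0) • e z := by simp
      rw [add_assoc]
      rw [h4]
      rw [← Finset.sum_add_distrib, ← Finset.sum_add_distrib]
      refine Finset.sum_congr rfl fun z _ => ?_
      rw [← add_smul, ← add_smul]
      congr 1
      have := hle z
      by_cases hz : z = y
      · subst hz
        simp only [if_true]; omega
      · simp only [hz, if_false]; omega
    rwa [h3]
  exact (WellQuasiOrderedLE.finite_of_isAntichain hanti).of_finite_image hinj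

lemma bad_finite [Nonempty κ] (e : κ → L) (U : Set L)
    (hUS : ∀ v ∈ U, v ∈ AddSubmonoid.closure (Set.range e))
    (hU : ∀ v ∈ U, ∀ s ∈ AddSubmonoid.closure (Set.range e), v + s ∈ U) : (BadSet e U).Finite := by
  classical
  let V : Set (Finset κ) → Set L := fun P => {w | ∀ T ∈ P, w - eT e T ∈ U}
  have hfin : ∀ P : Set (Finset κ), P.Nonempty → {v | v ∈ V P ∧ ∀ y, v - e y ∉ V P}.Finite := by
    rintro P ⟨T0, hT0⟩
    apply finite_min
    · intro v hv
      have h1 := hUS _ (hv T0 hT0)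
      have h2 : eT e T0 ∈ AddSubmonoid.closure (Set.range e) :=
        sum_mem fun y _ => AddSubmonoid.subset_closure ⟨y, rfl⟩
      have := add_mem h1 h2
      rwa [sub_add_cancel] at this
    · intro v hv s hs T hT
      have := hU _ (hv T hT) s hs
      rwa [← add_sub_right_comm] at this
  have : BadSet e U ⊆ ⋃ P : {P : Set (Finset κ) // P.Nonempty}, {v | v ∈ V P ∧ ∀ y, v - e y ∉ V P} := by
    intro w hw
    by_cases hP : {T : Finset κ | w - eT e T ∈ U}.Nonempty
    · refine Set.mem_iUnion.2 ⟨⟨_, hP⟩, fun T hT => hT, fun y hy => hw ⟨y, fun T hT => ?_⟩⟩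
      have := hy T hT
      by_cases hyT : y ∈ T
      · rw [Finset.insert_eq_self.2 hyT]; exact hT
      · rw [eT_insert e y T hyT, ← sub_sub]; exact this
    · exfalso
      refine hw ⟨Classical.arbitrary κ, fun T hT => ?_⟩
      exact absurd ⟨T, hT⟩ hP
  exact (Set.finite_iUnion fun P : {P : Set (Finset κ) // P.Nonempty} => hfin P.1 P.2).subset this

lemma KF_eq_zero (e : κ → L) (U : Set L)
    (hU : ∀ v ∈ U, ∀ s ∈ AddSubmonoid.closure (Set.range e), v + s ∈ U) (w : L)
    (hw : w ∉ BadSet e U) : KF e U w = 0 := by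
  classical
  unfold BadSet at hw
  simp only [Set.mem_setOf_eq, not_not] at hw
  obtain ⟨y, hy⟩ := hw
  have hiff : ∀ T, y ∉ T → (w - eT e (insert y T) ∈ U ↔ w - eT e T ∈ U) := by
    intro T hT
    refine ⟨fun h => ?_, hy T⟩
    have := hU _ h (e y) (AddSubmonoid.subset_closure ⟨y, rfl⟩)
    rw [eT_insert e y T hT] at this
    have h2 : w - (e y + eT e T) + e y = w - eT e T := by abel
    rwa [h2] at this
  unfold KF
  refine Finset.sum_involution (fun T _ => if y ∈ T then T.erase y else insert y T) ?_ ?_ ?_ ?_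
  · intro T _
    by_cases h1 : y ∈ T
    · have h2 := hiff _ (Finset.notMem_erase y T)
      rw [Finset.insert_erase h1] at h2
      have h3 := Finset.card_erase_add_one h1
      simp only [h1, if_true]
      rw [← h3, if_congr h2 rfl rfl]; ring
    · simp only [h1, if_false]
      rw [Finset.card_insert_of_notMem h1, if_congr (hiff T h1) rfl rfl]; ring
  · intro T _ _ h
    split_ifs at h with h1
    · exact (Finset.erase_ne_self.2 h1) h
    · exact (Finset.insert_ne_self.2 h1) h
  · intro T _; exact Finset.mem_univ _
  · intro T _
    by_cases h1 : y ∈ T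
    · simp [h1]
    · simp [h1]

end Cone

section Chase
variable {κ L k : Type} [Fintype κ] [LinearOrder κ] [AddCommGroup L] [Field k]
variable {S : AddSubmonoid L} {U : Set L} {deg : L →+ ℤ}

namespace MinRes
variable (D : MinRes k S U deg)

/-- support condition of the dual complex -/
def BB (i : ℕ) (v : L) : Submodule k (D.ι i → k) := suppSub k (fun j => v + D.b i j ∈ U)

/-- cocycles of the dual complex in degree `v` -/
def ZZ (i : ℕ) (v : L) : Submodule k (D.ι i → k) := D.BB i v ⊓ LinearMap.ker (D.Mt i)

/-- the exactness statement for the dual complex -/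
def DualExact : Prop := ∀ i v (x : D.ι (i + 1) → k), x ∈ D.ZZ (i + 1) v →
    ∃ z ∈ D.BB i v, D.Mt i z = x

lemma kbd_BB (e : κ → L) (he : ∀ y, e y ∈ S) (hU : ∀ v ∈ U, ∀ s ∈ S, v + s ∈ U) (i : ℕ) (v : L)
    (c : Finset κ → D.ι i → k) (hc : ∀ T, c T ∈ D.BB i (v - eT e T)) (T : Finset κ) :
    kbd k _ c T ∈ D.BB i (v - eT e T) := by
  rw [kbd_apply]
  refine Submodule.sum_mem _ fun y hy => Submodule.smul_mem _ _ fun j hj => ?_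
  have h1 := hU _ (hc _ j hj) _ (he y)
  rw [eT_insert e y T (by simpa using hy)] at h1
  have h2 : v - (e y + eT e T) + D.b i j + e y = v - eT e T + D.b i j := by abel
  rwa [h2] at h1

lemma chase (hD : D.DualExact) (e : κ → L) (he : ∀ y, e y ∈ S)
    (hU : ∀ v ∈ U, ∀ s ∈ S, v + s ∈ U) (v : L) (s0 : ℕ)
    (hcone : ∀ i, s0 ≤ i → ∀ j : D.ι i, ∃ y, IsConePt e U (v + D.b i j) y) (q : ℕ) :
    ∀ p, p + q = Fintype.card κ + 1 → ∀ s, s0 ≤ s → ∀ c : Finset κ → D.ι s → k,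
      (∀ T, c T ∈ D.ZZ s (v - eT e T)) → kbd k _ c = 0 → (∀ T, T.card < p → c T = 0) →
      ∃ c' : Finset κ → D.ι s → k, (∀ T, c' T ∈ D.ZZ s (v - eT e T)) ∧ kbd k _ c' = c ∧
        ∀ T, T.card < p + 1 → c' T = 0 := by
  classical
  induction q with
  | zero =>
    intro p hp s _ c _ _ hc0
    refine ⟨0, fun T => zero_mem _, ?_, fun T _ => rfl⟩
    rw [map_zero]
    ext T : 1
    rw [hc0 T (by have := Finset.card_le_univ T; omega)]; rfl
  | succ q ih =>
    intro p hp s hs c hc hbd hc0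
    choose y hy using hcone s hs
    let h : Finset κ → D.ι s → k := fun T j => kcone (y j) (fun T => c T j) T
    have hcoord : ∀ (c : Finset κ → D.ι s → k) T j,
        kbd k _ c T j = kbd k k (fun T => c T j) T := by
      intro c T j
      have := congrFun (kbd_map (LinearMap.proj j : (D.ι s → k) →ₗ[k] k) c) T
      exact this.symm
    have hh : kbd k _ h = c := by
      ext T j
      rw [hcoord]
      have h0 : kbd k k (fun T => c T j) = 0 := by
        ext T
        rw [← hcoord, hbd]; rfl
      exact congrFun (kbd_kcone (y j) _ h0) T
    have hhB : ∀ T, h T ∈ D.BB s (v - eT e T) := by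
      intro T j hj
      change kcone (y j) (fun T => c T j) T ≠ 0 at hj
      unfold kcone at hj
      split_ifs at hj with hyT
      · have h1 := (hc (T.erase (y j))).1 j (right_ne_zero_of_mul hj)
        change v - eT e (T.erase (y j)) + D.b s j ∈ U at h1
        rw [sub_add_eq_add_sub] at h1
        have h2 := hy j _ h1
        rw [Finset.insert_erase hyT] at h2
        change v - eT e T + D.b s j ∈ U
        rwa [sub_add_eq_add_sub]
      · exact absurd rfl hj
    have hhp : ∀ T : Finset κ, T.card < p + 1 → h T = 0 := by
      intro T hT
      ext j
      change kcone (y j) (fun T => c T j) T = 0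
      unfold kcone
      split_ifs with hyT
      · have := Finset.card_erase_add_one hyT
        change ksgn k (y j) (T.erase (y j)) * c (T.erase (y j)) j = 0
        rw [hc0 (T.erase (y j)) (by omega), Pi.zero_apply, mul_zero]
      · rfl
    obtain ⟨c', hc', hc'b, hc'0⟩ := ih (p + 1) (by omega) (s + 1) (by omega)
      (fun T => D.Mt s (h T))
      (fun T => ⟨fun l hl => D.Mt_supp hU s _ _ (hhB T) l hl, D.Mt_Mt s _⟩)
      (by
        rw [kbd_map, hh]
        ext T : 1
        exact (hc T).2)
      (fun T hT => by rw [hhp T hT, map_zero])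
    have hex : ∀ T, ∃ z ∈ D.BB s (v - eT e T), D.Mt s z = c' T ∧ (c' T = 0 → z = 0) := by
      intro T
      by_cases h0 : c' T = 0
      · exact ⟨0, zero_mem _, by rw [map_zero, h0], fun _ => rfl⟩
      · obtain ⟨z, hz, hz'⟩ := hD s _ _ (hc' T)
        exact ⟨z, hz, hz', fun h => absurd h h0⟩
    choose d hdB hdM hd0 using hex
    refine ⟨h - kbd k _ d, fun T => ⟨?_, ?_⟩, ?_, ?_⟩
    · exact sub_mem (hhB T) (D.kbd_BB e he hU s v d hdB T)
    · change D.Mt s (h T - kbd k _ d T) = 0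
      rw [map_sub, sub_eq_zero]
      have h1 := congrFun (kbd_map (D.Mt s) d) T
      rw [← h1]
      have h2 := congrFun hc'b T
      rw [← h2]
      have h3 : c' = fun T => D.Mt s (d T) := funext fun T => (hdM T).symm
      rw [h3]
    · rw [map_sub, kbd_kbd, sub_zero, hh]
    · intro T hT
      rw [Pi.sub_apply, hhp T hT, zero_sub, neg_eq_zero, kbd_apply]
      refine Finset.sum_eq_zero fun y hy => ?_
      rw [hd0, smul_zero]
      apply hc'0
      rw [Finset.card_insert_of_notMem (by simpa using hy)]; omega

end MinRes

/-- chains with values in given subspaces -/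
def chainSub {V : Type} [AddCommGroup V] [Module k V] (W : Finset κ → Submodule k V) :
    Submodule k (Finset κ → V) where
  carrier := {c | ∀ T, c T ∈ W T}
  zero_mem' := fun T => zero_mem _
  add_mem' := fun h h' T => add_mem (h T) (h' T)
  smul_mem' := fun a c h T => Submodule.smul_mem _ _ (h T)

lemma finrank_chainSub {V : Type} [AddCommGroup V] [Module k V] [FiniteDimensional k V]
    (W : Finset κ → Submodule k V) :
    Module.finrank k (chainSub W) = ∑ T, Module.finrank k (W T) := by
  rw [← Module.finrank_pi_fintype]
  refine LinearEquiv.finrank_eq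
    { toFun := fun c T => ⟨c.1 T, c.2 T⟩
      invFun := fun c => ⟨fun T => c T, fun T => (c T).2⟩
      map_add' := fun _ _ => rfl
      map_smul' := fun _ _ => rfl
      left_inv := fun _ => rfl
      right_inv := fun _ => rfl }

lemma euler_zero {V : Type} [AddCommGroup V] [Module k V] [FiniteDimensional k V]
    (W : Finset κ → Submodule k V)
    (hbd : ∀ c ∈ chainSub W, kbd k V c ∈ chainSub W)
    (hex : ∀ c ∈ chainSub W, kbd k V c = 0 → ∃ c' ∈ chainSub W, kbd k V c' = c) :
    ∑ T : Finset κ, (-1 : ℤ) ^ T.card * (Module.finrank k (W T) : ℤ) = 0 := by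
  classical
  let part : (Finset κ → Prop) → Finset κ → Submodule k V := fun P T => if P T then W T else ⊥
  have hmem : ∀ P c, c ∈ chainSub (part P) ↔ c ∈ chainSub W ∧ ∀ T, ¬ P T → c T = 0 := by
    intro P c
    constructor
    · intro h
      refine ⟨fun T => ?_, fun T hT => ?_⟩
      · have := h T
        simp only [part] at this
        split_ifs at this with hP
        · exact this
        · rw [(Submodule.mem_bot k).1 this]; exact zero_mem _
      · have := h T
        simp only [part, hT, if_false] at this
        exact (Submodule.mem_bot k).1 this
    · rintro ⟨h, h'⟩ T
      simp only [part]
      split_ifs with hP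
      · exact h T
      · rw [h' T hP]; exact zero_mem _
  have key : ∀ P P' : Finset κ → Prop, (∀ T y, y ∉ T → (P T ↔ P' (insert y T))) →
      (∀ T y, y ∉ T → (P' T ↔ P (insert y T))) →
      Submodule.map (kbd k V) (chainSub (part P')) =
      chainSub (part P) ⊓ LinearMap.ker (kbd k V) := by
    intro P P' hPP' hP'P
    ext c
    constructor
    · rintro ⟨c', hc', rfl⟩
      have hc'' := (hmem P' c').1 hc'
      refine ⟨(hmem P _).2 ⟨hbd c' hc''.1, fun T hT => ?_⟩, kbd_kbd c'⟩
      rw [kbd_apply]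
      refine Finset.sum_eq_zero fun y hy => ?_
      rw [hc''.2, smul_zero]
      rw [← hPP' T y (by simpa using hy)]; exact hT
    · rintro ⟨hc, hc0⟩
      have hc' := (hmem P c).1 hc
      obtain ⟨d, hd, hdc⟩ := hex c hc'.1 hc0
      let d' : Finset κ → V := fun T => if P' T then d T else 0
      refine ⟨d', (hmem P' d').2 ⟨fun T => ?_, fun T hT => by simp [d', hT]⟩, ?_⟩
      · simp only [d']
        split_ifs
        · exact hd T
        · exact zero_mem _
      · ext T
        by_cases hT : P T
        · rw [← hdc, kbd_apply, kbd_apply]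
          refine Finset.sum_congr rfl fun y hy => ?_
          have : P' (insert y T) := (hPP' T y (by simpa using hy)).1 hT
          simp [d', this]
        · rw [hc'.2 T hT, kbd_apply]
          refine Finset.sum_eq_zero fun y hy => ?_
          have : ¬ P' (insert y T) := fun h => hT ((hPP' T y (by simpa using hy)).2 h)
          simp [d', this]
  have hdim : ∀ P : Finset κ → Prop, Module.finrank k (Submodule.map (kbd k V) (chainSub (part P))) +
      Module.finrank k ↥(chainSub (part P) ⊓ LinearMap.ker (kbd k V)) =
      Module.finrank k (chainSub (part P)) := by
    intro P
    have h1 := LinearMap.finrank_range_add_finrank_ker ((kbd k V).domRestrict (chainSub (part P)))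
    rw [← h1]
    congr 1
    · rw [LinearMap.range_domRestrict]
    · rw [LinearMap.ker_domRestrict]
      have e := Submodule.comapSubtypeEquivOfLe
        (inf_le_left : chainSub (part P) ⊓ LinearMap.ker (kbd k V) ≤ chainSub (part P))
      rw [← e.finrank_eq, Submodule.comap_inf, Submodule.comap_subtype_self, top_inf_eq]
  have hcard : ∀ (T : Finset κ) y, y ∉ T → (Even T.card ↔ Odd (insert y T).card) := by
    intro T y hy
    rw [Finset.card_insert_of_notMem hy]
    exact ⟨fun h => h.add_one, fun h => by simpa [parity_simps] using h⟩
  have hcard' : ∀ (T : Finset κ) y, y ∉ T → (Odd T.card ↔ Even (insert y T).card) := by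
    intro T y hy
    rw [Finset.card_insert_of_notMem hy]
    exact ⟨fun h => h.add_one, fun h => by simpa [parity_simps] using h⟩
  have k1 := key (fun T => Even T.card) (fun T => Odd T.card) hcard hcard'
  have k2 := key (fun T => Odd T.card) (fun T => Even T.card) hcard' hcard
  have d1 := hdim (fun T => Even T.card)
  have d2 := hdim (fun T => Odd T.card)
  rw [← k1] at d1
  rw [← k2] at d2
  have heq : Module.finrank k (chainSub (part fun T => Even T.card)) =
      Module.finrank k (chainSub (part fun T => Odd T.card)) := by
    rw [← d1, ← d2, add_comm]
  rw [finrank_chainSub, finrank_chainSub] at heq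
  have hz : ∀ T : Finset κ, (-1 : ℤ) ^ T.card * (Module.finrank k (W T) : ℤ) =
      (Module.finrank k (part (fun T => Even T.card) T) : ℤ) -
      (Module.finrank k (part (fun T => Odd T.card) T) : ℤ) := by
    intro T
    rcases Nat.even_or_odd T.card with h | h
    · have h' : ¬ Odd T.card := Nat.not_odd_iff_even.2 h
      have e1 : part (fun T => Even T.card) T = W T := if_pos h
      have e2 : part (fun T => Odd T.card) T = ⊥ := if_neg h'
      rw [e1, e2, finrank_bot, h.neg_one_pow]
      simp
    · have h' : ¬ Even T.card := Nat.not_even_iff_odd.2 h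
      have e1 : part (fun T => Even T.card) T = ⊥ := if_neg h'
      have e2 : part (fun T => Odd T.card) T = W T := if_pos h
      rw [e1, e2, finrank_bot, h.neg_one_pow]
      simp
  rw [Finset.sum_congr rfl fun T _ => hz T, Finset.sum_sub_distrib, sub_eq_zero]
  exact_mod_cast heq

end Chase

lemma alternating_lemma (a z : ℕ → ℤ) (t : ℤ) (h0 : a 0 = t + z 0)
    (h : ∀ i, a (i + 1) = z i + z (i + 1)) (s : ℕ) :
    t = ∑ i ∈ Finset.range (s + 1), (-1) ^ i * a i + (-1) ^ (s + 1) * z s := by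
  induction s with
  | zero => simp [h0]
  | succ s ih =>
    rw [Finset.sum_range_succ, h s, pow_succ _ (s + 1)]
    linear_combination ih

section Ranks
variable {k : Type} [Field k]

lemma finrank_map_add_ker {V W : Type} [AddCommGroup V] [Module k V] [FiniteDimensional k V]
    [AddCommGroup W] [Module k W] (f : V →ₗ[k] W) (A : Submodule k V) :
    Module.finrank k A = Module.finrank k (Submodule.map f A) +
      Module.finrank k ↥(A ⊓ LinearMap.ker f) := by
  have h1 := LinearMap.finrank_range_add_finrank_ker (f.domRestrict A)
  rw [← h1]
  congr 1
  · rw [LinearMap.range_domRestrict]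
  · rw [LinearMap.ker_domRestrict]
    have e := Submodule.comapSubtypeEquivOfLe
      (inf_le_left : A ⊓ LinearMap.ker f ≤ A)
    rw [← e.finrank_eq, Submodule.comap_inf, Submodule.comap_subtype_self, top_inf_eq]

open Classical in
lemma finrank_suppSub {ι : Type} [Fintype ι] (P : ι → Prop) :
    (Module.finrank k (suppSub k P) : ℤ) = ∑ j, if P j then 1 else 0 := by
  have e : suppSub k P ≃ₗ[k] ({j // P j} → k) :=
    { toFun := fun x j => x.1 j
      invFun := fun x => ⟨fun j => if h : P j then x ⟨j, h⟩ else 0, fun j hj => by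
        change P j
        by_contra hc
        simp [hc] at hj⟩
      map_add' := fun _ _ => rfl
      map_smul' := fun _ _ => rfl
      left_inv := fun x => by
        apply Subtype.ext
        funext j
        change (if h : P j then x.1 j else 0) = x.1 j
        split_ifs with h
        · rfl
        · by_contra hc
          exact h (x.2 j fun h => hc h.symm)
      right_inv := fun x => by
        funext j
        change (if h : P j.1 then x ⟨j.1, h⟩ else 0) = x j
        rw [dif_pos j.2] }
  rw [e.finrank_eq, Module.finrank_fintype_fun_eq_card, Fintype.card_subtype]
  simp

end Ranks

section Corr
variable {κ L k : Type} [Fintype κ] [LinearOrder κ] [AddCommGroup L] [Field k]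
variable {S : AddSubmonoid L} {U : Set L} {deg : L →+ ℤ}

namespace MinRes
variable (D : MinRes k S U deg)

/-- support condition of the complex -/
def AA (i : ℕ) (v : L) : Submodule k (D.ι i → k) := suppSub k (fun j => v - D.b i j ∈ S)

/-- augmentation -/
def gl : (D.ι 0 → k) →ₗ[k] k := ∑ j, D.g j • LinearMap.proj j

lemma gl_apply (x : D.ι 0 → k) : D.gl x = ∑ j, D.g j * x j := by
  simp [gl]

/-- cycles -/
noncomputable def zdim (v : L) : ℕ → ℤ
  | 0 => Module.finrank k ↥(D.AA 0 v ⊓ LinearMap.ker D.gl)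
  | i + 1 => Module.finrank k ↥(D.AA (i + 1) v ⊓ LinearMap.ker (D.M i))

open Classical in
lemma I1 (hU : ∀ v ∈ U, ∀ s ∈ S, v + s ∈ U) (hdeg : ∀ s ∈ S, 0 ≤ deg s) (v : L) (s : ℕ)
    (hs : deg v < s) :
    (if v ∈ U then (1 : ℤ) else 0) = ∑ i ∈ Finset.range (s + 1), (-1) ^ i *
      ∑ j, if v - D.b i j ∈ S then 1 else 0 := by
  have key := alternating_lemma (fun i => ∑ j : D.ι i, if v - D.b i j ∈ S then 1 else 0)
    (D.zdim v) (if v ∈ U then (1 : ℤ) else 0) ?_ ?_ s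
  · have hz : D.zdim v s = 0 := by
      have hA : D.AA s v = ⊥ := by
        rw [eq_bot_iff]
        intro x hx
        rw [Submodule.mem_bot]
        funext j
        by_contra hc
        have h1 := hdeg _ (hx j hc)
        rw [map_sub] at h1
        have := D.hdeg s j
        omega
      cases s with
      | zero =>
        change (Module.finrank k ↥(D.AA 0 v ⊓ _) : ℤ) = 0
        rw [hA, bot_inf_eq, finrank_bot]; rfl
      | succ s =>
        change (Module.finrank k ↥(D.AA (s + 1) v ⊓ _) : ℤ) = 0
        rw [hA, bot_inf_eq, finrank_bot]; rfl
    rw [hz, mul_zero, add_zero] at key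
    exact key
  · change (∑ j : D.ι 0, if v - D.b 0 j ∈ S then (1 : ℤ) else 0) = _
    rw [← finrank_suppSub (k := k)]
    change (Module.finrank k (D.AA 0 v) : ℤ) = _
    rw [finrank_map_add_ker D.gl]
    push_cast
    congr 1
    split_ifs with hv
    · have : Submodule.map D.gl (D.AA 0 v) = ⊤ := by
        rw [eq_top_iff]
        rintro c -
        obtain ⟨j, hj⟩ := D.gen v hv
        refine ⟨Pi.single j (c / D.g j), fun l hl => ?_, ?_⟩
        · by_cases h : l = j
          · subst h; exact hj
          · rw [Pi.single_eq_of_ne h] at hl; exact absurd rfl hl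
        · rw [gl_apply, Finset.sum_eq_single j]
          · rw [Pi.single_eq_same, mul_div_cancel₀ _ (D.g_ne j)]
          · intro l _ hl
            rw [Pi.single_eq_of_ne hl, mul_zero]
          · simp
      rw [this, finrank_top]
      simp
    · have : D.AA 0 v = ⊥ := by
        rw [eq_bot_iff]
        intro x hx
        rw [Submodule.mem_bot]
        funext j
        by_contra hc
        apply hv
        have := hU _ (D.b0 j) _ (hx j hc)
        rwa [add_sub_cancel] at this
      rw [this, Submodule.map_bot, finrank_bot]; rfl
  · intro i
    change (∑ j : D.ι (i + 1), if v - D.b (i + 1) j ∈ S then (1 : ℤ) else 0) = _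
    rw [← finrank_suppSub (k := k)]
    change (Module.finrank k (D.AA (i + 1) v) : ℤ) = _
    rw [finrank_map_add_ker (D.M i)]
    push_cast
    congr 1
    cases i with
    | zero =>
      change _ = (Module.finrank k ↥(D.AA 0 v ⊓ _) : ℤ)
      have : Submodule.map (D.M 0) (D.AA 1 v) = D.AA 0 v ⊓ LinearMap.ker D.gl := by
        ext x
        constructor
        · rintro ⟨y, hy, rfl⟩
          refine ⟨fun l hl => D.M_supp' 0 v y hy l hl, ?_⟩
          change D.gl _ = 0
          rw [gl_apply, D.gM]
        · rintro ⟨hx, hx0⟩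
          obtain ⟨y, hy, hy'⟩ := D.ex0 v x hx (by rw [← gl_apply]; exact hx0)
          exact ⟨y, hy, hy'⟩
      rw [this]
    | succ i =>
      change _ = (Module.finrank k ↥(D.AA (i + 1) v ⊓ _) : ℤ)
      have : Submodule.map (D.M (i + 1)) (D.AA (i + 2) v) = D.AA (i + 1) v ⊓ LinearMap.ker (D.M i) := by
        ext x
        constructor
        · rintro ⟨y, hy, rfl⟩
          exact ⟨fun l hl => D.M_supp' (i + 1) v y hy l hl, D.MM i y⟩
        · rintro ⟨hx, hx0⟩
          obtain ⟨y, hy, hy'⟩ := D.ex i v x hx hx0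
          exact ⟨y, hy, hy'⟩
      rw [this]

open Classical in
lemma I2 (hU : ∀ v ∈ U, ∀ s ∈ S, v + s ∈ U) (hne : U.Nonempty)
    (hD : D.DualExact)
    (hD0 : ∀ v (x : D.ι 0 → k), x ∈ D.ZZ 0 v → ∃ a : k, (a ≠ 0 → v ∈ S) ∧ x = a • D.g)
    (v : L) (s : ℕ) :
    (if v ∈ S then (1 : ℤ) else 0) = ∑ i ∈ Finset.range (s + 1), (-1) ^ i *
      (∑ j, if v + D.b i j ∈ U then 1 else 0) +
      (-1) ^ (s + 1) * (Module.finrank k (D.ZZ (s + 1) v) : ℤ) := by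
  have hstep : ∀ i, (∑ j : D.ι i, if v + D.b i j ∈ U then (1 : ℤ) else 0) =
      Module.finrank k (D.ZZ i v) + Module.finrank k (D.ZZ (i + 1) v) := by
    intro i
    rw [← finrank_suppSub (k := k)]
    change (Module.finrank k (D.BB i v) : ℤ) = _
    rw [finrank_map_add_ker (D.Mt i)]
    have : Submodule.map (D.Mt i) (D.BB i v) = D.ZZ (i + 1) v := by
      ext x
      constructor
      · rintro ⟨z, hz, rfl⟩
        exact ⟨fun l hl => D.Mt_supp hU i _ _ hz l hl, D.Mt_Mt i _⟩
      · intro hx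
        obtain ⟨z, hz, hz'⟩ := hD i v x hx
        exact ⟨z, hz, hz'⟩
    rw [this]
    push_cast
    rw [add_comm]
    rfl
  have h0 : (Module.finrank k (D.ZZ 0 v) : ℤ) = if v ∈ S then 1 else 0 := by
    split_ifs with hv
    · have hg : D.g ≠ 0 := by
        obtain ⟨u, hu⟩ := hne
        obtain ⟨j, -⟩ := D.gen u hu
        intro h
        exact D.g_ne j (congrFun h j)
      have : D.ZZ 0 v = k ∙ D.g := by
        ext x
        rw [Submodule.mem_span_singleton]
        constructor
        · intro hx
          obtain ⟨a, -, rfl⟩ := hD0 v x hx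
          exact ⟨a, rfl⟩
        · rintro ⟨a, rfl⟩
          refine Submodule.smul_mem _ _ ⟨fun j _ => ?_, D.Mt_g⟩
          have := hU _ (D.b0 j) v hv
          change v + D.b 0 j ∈ U
          rwa [add_comm]
      rw [this, finrank_span_singleton hg]; rfl
    · have : D.ZZ 0 v = ⊥ := by
        rw [eq_bot_iff]
        intro x hx
        obtain ⟨a, ha, rfl⟩ := hD0 v x hx
        by_cases h : a = 0
        · rw [h, zero_smul]; exact zero_mem _
        · exact absurd (ha h) hv
      rw [this, finrank_bot]; rfl
  refine alternating_lemma _ (fun i => (Module.finrank k (D.ZZ (i + 1) v) : ℤ)) _ ?_ ?_ s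
  · rw [← h0]; exact hstep 0
  · intro i; exact hstep (i + 1)

lemma euler_ZZ (hD : D.DualExact) (e : κ → L) (he : ∀ y, e y ∈ S)
    (hU : ∀ v ∈ U, ∀ s ∈ S, v + s ∈ U) (v : L) (s0 : ℕ)
    (hcone : ∀ i, s0 ≤ i → ∀ j : D.ι i, ∃ y, IsConePt e U (v + D.b i j) y) (s : ℕ) (hs : s0 ≤ s) :
    ∑ T : Finset κ, (-1 : ℤ) ^ T.card * (Module.finrank k (D.ZZ s (v - eT e T)) : ℤ) = 0 := by
  apply euler_zero (fun T => D.ZZ s (v - eT e T))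
  · intro c hc T
    refine ⟨D.kbd_BB e he hU s v c (fun T => (hc T).1) T, ?_⟩
    change D.Mt s (kbd k _ c T) = 0
    rw [← congrFun (kbd_map (D.Mt s) c) T]
    have : (fun T => D.Mt s (c T)) = 0 := funext fun T => (hc T).2
    rw [this, map_zero]; rfl
  · intro c hc h0
    obtain ⟨c', hc', hb, -⟩ := D.chase hD e he hU v s0 hcone (Fintype.card κ + 1) 0 (by omega) s hs c
      hc h0 (fun T hT => by omega)
    exact ⟨c', hc', hb⟩

lemma KU_eq (hU : ∀ v ∈ U, ∀ s ∈ S, v + s ∈ U) (hdeg : ∀ s ∈ S, 0 ≤ deg s)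
    (e : κ → L) (he : ∀ y, e y ∈ S) (w : L) (s : ℕ) (hs : deg w < s) :
    KF e U w = ∑ i ∈ Finset.range (s + 1), (-1) ^ i * ∑ j, KF e (S : Set L) (w - D.b i j) := by
  classical
  unfold KF
  have h1 : ∀ T : Finset κ, deg (w - eT e T) < s := by
    intro T
    have := hdeg (eT e T) (sum_mem fun y _ => he y)
    rw [map_sub]; omega
  rw [Finset.sum_congr rfl fun T _ => by rw [D.I1 hU hdeg (w - eT e T) s (h1 T)]]
  simp_rw [Finset.mul_sum]
  rw [Finset.sum_comm]
  refine Finset.sum_congr rfl fun i _ => ?_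
  rw [Finset.sum_comm]
  refine Finset.sum_congr rfl fun j _ => Finset.sum_congr rfl fun T _ => ?_
  rw [sub_right_comm]
  rw [mul_left_comm]
  rfl

lemma KS_eq (hU : ∀ v ∈ U, ∀ s ∈ S, v + s ∈ U) (hne : U.Nonempty)
    (hD : D.DualExact)
    (hD0 : ∀ v (x : D.ι 0 → k), x ∈ D.ZZ 0 v → ∃ a : k, (a ≠ 0 → v ∈ S) ∧ x = a • D.g)
    (e : κ → L) (he : ∀ y, e y ∈ S) (v : L) (s0 : ℕ)
    (hcone : ∀ i, s0 ≤ i → ∀ j : D.ι i, ∃ y, IsConePt e U (v + D.b i j) y) (s : ℕ) (hs : s0 ≤ s) :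
    KF e (S : Set L) v = ∑ i ∈ Finset.range (s + 1), (-1) ^ i * ∑ j, KF e U (v + D.b i j) := by
  classical
  have h2 := D.euler_ZZ hD e he hU v s0 hcone (s + 1) (by omega)
  unfold KF
  have h3 : ∀ T : Finset κ, (-1 : ℤ) ^ T.card * (if v - eT e T ∈ (S : Set L) then 1 else 0) =
      (-1 : ℤ) ^ T.card * ∑ i ∈ Finset.range (s + 1), (-1) ^ i *
      (∑ j, if v - eT e T + D.b i j ∈ U then 1 else 0) +
      (-1) ^ (s + 1) * ((-1) ^ T.card * (Module.finrank k (D.ZZ (s + 1) (v - eT e T)) : ℤ)) := by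
    intro T
    have := D.I2 hU hne hD hD0 (v - eT e T) s
    simp only [SetLike.mem_coe]
    rw [this]
    ring
  rw [Finset.sum_congr rfl fun T _ => h3 T, Finset.sum_add_distrib, ← Finset.mul_sum, h2, mul_zero,
    add_zero]
  simp_rw [Finset.mul_sum]
  rw [Finset.sum_comm]
  refine Finset.sum_congr rfl fun i _ => ?_
  rw [Finset.sum_comm]
  refine Finset.sum_congr rfl fun j _ => Finset.sum_congr rfl fun T _ => ?_
  rw [sub_add_eq_add_sub]
  rw [mul_left_comm]

end MinRes

lemma corr_swap (f g : L → ℤ) (A B : Finset L) (hA : ∀ w, f w ≠ 0 → w ∈ A)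
    (hB : ∀ w, g w ≠ 0 → w ∈ B) (c : L) :
    ∑ w ∈ A, f w * g (w - c) = ∑ w ∈ B, g w * f (w + c) := by
  classical
  refine Finset.sum_bij_ne_zero (fun w _ _ => w - c) ?_ ?_ ?_ ?_
  · intro w _ h
    exact hB _ (right_ne_zero_of_mul h)
  · intro w _ _ w' _ _ h
    exact sub_left_injective h
  · intro w hw h
    refine ⟨w + c, hA _ (right_ne_zero_of_mul h), ?_, by simp⟩
    rw [add_sub_cancel_right, mul_comm]; exact h
  · intro w _ _
    rw [sub_add_cancel, mul_comm]

theorem corr_eq (D : MinRes k S U deg) [Nonempty κ] (e : κ → L)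
    (hS : S = AddSubmonoid.closure (Set.range e))
    (hUS : ∀ v ∈ U, v ∈ S) (hU : ∀ v ∈ U, ∀ s ∈ S, v + s ∈ U) (hne : U.Nonempty)
    (hdeg : ∀ s ∈ S, 0 ≤ deg s) (hD : D.DualExact)
    (hD0 : ∀ v (x : D.ι 0 → k), x ∈ D.ZZ 0 v → ∃ a : k, (a ≠ 0 → v ∈ S) ∧ x = a • D.g)
    (A B : Finset L) (hA : ∀ w, KF e U w ≠ 0 → w ∈ A) (hB : ∀ w, KF e (S : Set L) w ≠ 0 → w ∈ B)
    (u : L) :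
    ∑ w ∈ A, KF e U w * KF e U (w - u) =
      ∑ w ∈ B, KF e (S : Set L) w * KF e (S : Set L) (w - u) := by
  classical
  have he : ∀ y, e y ∈ S := fun y => by rw [hS]; exact AddSubmonoid.subset_closure ⟨y, rfl⟩
  have hbad : (BadSet e U).Finite := bad_finite e U (by rw [← hS]; exact hUS) (by rw [← hS]; exact hU)
  -- bounds
  obtain ⟨N1, hN1⟩ : ∃ N : ℕ, ∀ w ∈ A, deg (w - u) < N := by
    refine ⟨(∑ w ∈ A, (deg (w - u)).toNat) + 1, fun w hw => ?_⟩
    have := Finset.single_le_sum (f := fun w => (deg (w - u)).toNat) (fun _ _ => Nat.zero_le _) hw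
    omega
  obtain ⟨N2, hN2⟩ : ∃ N : ℕ, ∀ w ∈ B, ∀ x ∈ BadSet e U, deg x - deg (w + u) < N := by
    refine ⟨(∑ w ∈ B, ∑ x ∈ hbad.toFinset, (deg x - deg (w + u)).toNat) + 1, fun w hw x hx => ?_⟩
    have h1 := Finset.single_le_sum (f := fun w => ∑ x ∈ hbad.toFinset, (deg x - deg (w + u)).toNat)
      (fun _ _ => Nat.zero_le _) hw
    have h2 := Finset.single_le_sum (f := fun x => (deg x - deg (w + u)).toNat)
      (fun _ _ => Nat.zero_le _) (hbad.mem_toFinset.2 hx)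
    omega
  have hcone : ∀ w ∈ B, ∀ i, N2 ≤ i → ∀ j : D.ι i, ∃ y, IsConePt e U (w + u + D.b i j) y := by
    intro w hw i hi j
    by_contra hc
    have h1 := hN2 w hw _ hc
    have h2 := D.hdeg i j
    rw [map_add deg (w + u)] at h1
    omega
  set s := max N1 N2 with hs
  have e1 : ∑ w ∈ A, KF e U w * KF e U (w - u) = ∑ w ∈ A, KF e U w *
      ∑ i ∈ Finset.range (s + 1), (-1) ^ i * ∑ j, KF e (S : Set L) (w - u - D.b i j) := by
    refine Finset.sum_congr rfl fun w hw => ?_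
    rw [D.KU_eq hU hdeg e he (w - u) s]
    have := hN1 w hw
    have : (N1 : ℤ) ≤ s := by exact_mod_cast le_max_left _ _
    omega
  have e2 : ∑ w ∈ B, KF e (S : Set L) w * KF e (S : Set L) (w + u) = ∑ w ∈ B, KF e (S : Set L) w *
      ∑ i ∈ Finset.range (s + 1), (-1) ^ i * ∑ j, KF e U (w + u + D.b i j) := by
    refine Finset.sum_congr rfl fun w hw => ?_
    rw [D.KS_eq hU hne hD hD0 e he (w + u) N2 (hcone w hw) s (le_max_right _ _)]
  rw [e1]
  have e3 := corr_swap (KF e (S : Set L)) (KF e (S : Set L)) B B hB hB u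
  rw [e3, e2]
  simp_rw [Finset.mul_sum]
  rw [Finset.sum_comm]
  conv_rhs => rw [Finset.sum_comm]
  refine Finset.sum_congr rfl fun i _ => ?_
  rw [Finset.sum_comm]
  conv_rhs => rw [Finset.sum_comm]
  refine Finset.sum_congr rfl fun j _ => ?_
  have e4 := corr_swap (KF e U) (KF e (S : Set L)) A B hA hB (u + D.b i j)
  have e5 : ∑ w ∈ A, KF e U w * ((-1) ^ i * KF e (S : Set L) (w - u - D.b i j)) =
      (-1) ^ i * ∑ w ∈ A, KF e U w * KF e (S : Set L) (w - (u + D.b i j)) := by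
    rw [Finset.mul_sum]
    refine Finset.sum_congr rfl fun w _ => ?_
    rw [sub_sub, mul_left_comm]
  rw [e5, e4, Finset.mul_sum]
  refine Finset.sum_congr rfl fun w _ => ?_
  rw [add_assoc, mul_left_comm]

end Corr

section KPoly
variable {σ : Type} [Fintype σ] [DecidableEq σ]

/-- exponent vector of an edge -/
def ee (y : σ × σ) : σ → ℤ := Pi.single y.1 1 + Pi.single y.2 1

/-- the semigroup -/
def SY (Y : Finset (σ × σ)) : AddSubmonoid (σ → ℤ) := AddSubmonoid.closure (ee '' (Y : Set (σ × σ)))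

open Classical in
/-- the K-polynomial as a function -/
noncomputable def KY (Y : Finset (σ × σ)) (v : σ → ℤ) : ℤ :=
  ∑ T ∈ Y.powerset, (-1) ^ T.card * (if v - ∑ y ∈ T, ee y ∈ SY Y then 1 else 0)

/-- bipartite edge sets -/
def Bip (Y : Finset (σ × σ)) : Prop := ∀ y ∈ Y, ∀ y' ∈ Y, y.1 ≠ y'.2

lemma ee_apply (y : σ × σ) (i : σ) :
    ee y i = (if i = y.1 then 1 else 0) + (if i = y.2 then 1 else 0) := by
  simp [ee, Pi.single_apply]

lemma ee_nonneg (y : σ × σ) (i : σ) : 0 ≤ ee y i := by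
  rw [ee_apply]; split_ifs <;> simp

lemma ee_mem {Y : Finset (σ × σ)} {y : σ × σ} (h : y ∈ Y) : ee y ∈ SY Y :=
  AddSubmonoid.subset_closure ⟨y, h, rfl⟩

lemma SY_nonneg {Y : Finset (σ × σ)} {s : σ → ℤ} (hs : s ∈ SY Y) (i : σ) : 0 ≤ s i := by
  induction hs using AddSubmonoid.closure_induction with
  | mem x hx => obtain ⟨y, _, rfl⟩ := hx; exact ee_nonneg y i
  | zero => exact le_rfl
  | add x y _ _ hx hy => exact add_nonneg hx hy

lemma SY_use {Y : Finset (σ × σ)} {s : σ → ℤ} (hs : s ∈ SY Y) (x : σ) (hx : 0 < s x) :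
    ∃ y ∈ Y, (y.1 = x ∨ y.2 = x) ∧ s - ee y ∈ SY Y := by
  induction hs using AddSubmonoid.closure_induction with
  | mem t ht =>
    obtain ⟨y, hy, rfl⟩ := ht
    refine ⟨y, hy, ?_, by rw [sub_self]; exact zero_mem _⟩
    rw [ee_apply] at hx
    by_contra hc
    push Not at hc
    rw [if_neg (Ne.symm hc.1), if_neg (Ne.symm hc.2)] at hx
    simp at hx
  | zero => exact absurd hx (lt_irrefl _)
  | add a b ha hb iha ihb =>
    by_cases h : 0 < a x
    · obtain ⟨y, hy, h1, h2⟩ := iha h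
      exact ⟨y, hy, h1, by rw [add_sub_right_comm]; exact add_mem h2 hb⟩
    · have h3 := SY_nonneg ha x
      have : 0 < b x := by
        rw [Pi.add_apply] at hx; omega
      obtain ⟨y, hy, h1, h2⟩ := ihb this
      exact ⟨y, hy, h1, by rw [add_sub_assoc]; exact add_mem ha h2⟩

lemma SY_mono {Y Y' : Finset (σ × σ)} (h : Y ⊆ Y') : SY Y ≤ SY Y' :=
  AddSubmonoid.closure_mono (Set.image_mono (by exact_mod_cast h))

lemma SY_restrict {Y : Finset (σ × σ)} (Z : σ → Prop) [DecidablePred Z] {s : σ → ℤ} (hs : s ∈ SY Y)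
    (hZ : ∀ x, Z x → s x = 0) : s ∈ SY (Y.filter fun y => ¬ Z y.1 ∧ ¬ Z y.2) := by
  induction hs using AddSubmonoid.closure_induction with
  | mem t ht =>
    obtain ⟨y, hy, rfl⟩ := ht
    apply ee_mem
    rw [Finset.mem_filter]
    refine ⟨hy, fun h => ?_, fun h => ?_⟩
    · have := hZ _ h
      rw [ee_apply, if_pos rfl] at this
      split_ifs at this <;> simp at this
    · have := hZ _ h
      rw [ee_apply, if_pos rfl] at this
      split_ifs at this <;> simp at this
  | zero => exact zero_mem _
  | add a b ha hb iha ihb =>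
    have h : ∀ x, Z x → a x = 0 ∧ b x = 0 := by
      intro x hx
      have h1 := SY_nonneg ha x
      have h2 := SY_nonneg hb x
      have h3 := hZ x hx
      rw [Pi.add_apply] at h3
      omega
    exact add_mem (iha fun x hx => (h x hx).1) (ihb fun x hx => (h x hx).2)

lemma sum_ee_nonneg (T : Finset (σ × σ)) (i : σ) : 0 ≤ (∑ y ∈ T, ee y) i := by
  rw [Finset.sum_apply]
  exact Finset.sum_nonneg fun y _ => ee_nonneg y i

lemma KY_restrict (Y : Finset (σ × σ)) (Z : σ → Prop) [DecidablePred Z] (v : σ → ℤ)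
    (hZ : ∀ x, Z x → v x = 0) : KY Y v = KY (Y.filter fun y => ¬ Z y.1 ∧ ¬ Z y.2) v := by
  classical
  unfold KY
  symm
  apply Finset.sum_subset_zero_on_sdiff
  · exact Finset.powerset_mono.2 (Finset.filter_subset _ _)
  · intro T hT
    rw [Finset.mem_sdiff, Finset.mem_powerset, Finset.mem_powerset] at hT
    rw [if_neg, mul_zero]
    intro hs
    obtain ⟨y, hyT, hy⟩ := Finset.not_subset.1 hT.2
    have : ∃ x, Z x ∧ 0 < ee y x := by
      have hyY := hT.1 hyT
      rw [Finset.mem_filter] at hy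
      by_cases h1 : Z y.1
      · refine ⟨_, h1, ?_⟩
        rw [ee_apply, if_pos rfl]; split_ifs <;> simp
      · by_cases h2 : Z y.2
        · refine ⟨_, h2, ?_⟩
          rw [ee_apply, if_pos rfl]; split_ifs <;> simp
        · exact absurd ⟨hyY, h1, h2⟩ hy
    obtain ⟨x, hx, hpos⟩ := this
    have h1 := SY_nonneg hs x
    rw [Pi.sub_apply, hZ x hx, Finset.sum_apply] at h1
    have h2 := Finset.single_le_sum (f := fun y => ee y x) (fun y _ => ee_nonneg y x) hyT
    omega
  · intro T hT
    rw [Finset.mem_powerset] at hT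
    congr 1
    apply if_congr _ rfl rfl
    constructor
    · intro h; exact SY_mono (Finset.filter_subset _ _) h
    · intro h
      apply SY_restrict Z h
      intro x hx
      have h1 := SY_nonneg h x
      have h2 := sum_ee_nonneg T x
      rw [Pi.sub_apply, hZ x hx] at h1 ⊢
      omega

lemma KY_nonneg (Y : Finset (σ × σ)) (v : σ → ℤ) (h : KY Y v ≠ 0) (i : σ) : 0 ≤ v i := by
  obtain ⟨T, _, hT⟩ := Finset.exists_ne_zero_of_sum_ne_zero h
  have h1 : v - ∑ y ∈ T, ee y ∈ SY Y := by
    by_contra hc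
    rw [if_neg hc, mul_zero] at hT
    exact hT rfl
  have h2 := SY_nonneg h1 i
  have h3 := sum_ee_nonneg T i
  rw [Pi.sub_apply] at h2
  omega

lemma KY_empty (v : σ → ℤ) : KY (∅ : Finset (σ × σ)) v = if v = 0 then 1 else 0 := by
  unfold KY
  have : SY (∅ : Finset (σ × σ)) = ⊥ := by simp [SY]
  simp [this]

lemma ee_swap (y : σ × σ) : ee y.swap = ee y := by
  unfold ee
  rw [add_comm]; rfl

lemma KY_swap (Y : Finset (σ × σ)) (v : σ → ℤ) :
    KY (Y.map (Equiv.prodComm σ σ).toEmbedding) v = KY Y v := by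
  classical
  unfold KY
  have hS : SY (Y.map (Equiv.prodComm σ σ).toEmbedding) = SY Y := by
    unfold SY
    congr 1
    ext s
    constructor
    · rintro ⟨y, hy, rfl⟩
      rw [Finset.mem_coe, Finset.mem_map] at hy
      obtain ⟨z, hz, rfl⟩ := hy
      exact ⟨z, hz, (ee_swap z).symm⟩
    · rintro ⟨y, hy, rfl⟩
      exact ⟨y.swap, Finset.mem_map.2 ⟨y, hy, rfl⟩, ee_swap y⟩
  rw [hS]
  symm
  refine Finset.sum_bij (fun T _ => T.map (Equiv.prodComm σ σ).toEmbedding) ?_ ?_ ?_ ?_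
  · intro T hT
    rw [Finset.mem_powerset] at hT ⊢
    exact Finset.map_subset_map.2 hT
  · intro T _ T' _ h
    exact Finset.map_injective _ h
  · intro T hT
    rw [Finset.mem_powerset] at hT
    obtain ⟨u, hu, rfl⟩ := Finset.subset_map_iff.1 hT
    exact ⟨u, Finset.mem_powerset.2 hu, rfl⟩
  · intro T _
    rw [Finset.card_map, Finset.sum_map]
    have : ∀ y : σ × σ, ee ((Equiv.prodComm σ σ).toEmbedding y) = ee y := ee_swap
    simp_rw [this]

/-- exchange lemma -/
lemma SY_exchange {Y : Finset (σ × σ)} (hb : Bip Y) {s : σ → ℤ} (hs : s ∈ SY Y) (x j : σ)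
    (hxj : (x, j) ∈ Y) (hx : 0 < s x) (hj : 0 < s j)
    (hex : ∀ i l, (i, j) ∈ Y → (x, l) ∈ Y → 0 < s l → (i, l) ∈ Y) : s - ee (x, j) ∈ SY Y := by
  obtain ⟨⟨x', l⟩, hy, h1, h2⟩ := SY_use hs x hx
  have hx' : x' = x := by
    rcases h1 with h | h
    · exact h
    · exact absurd h.symm (hb _ hxj _ hy)
  subst hx'
  by_cases hlj : l = j
  · rw [← hlj]; exact h2
  have hl : 0 < s l := by
    have := SY_nonneg h2 l
    rw [Pi.sub_apply, ee_apply] at this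
    simp only [if_true] at this
    split_ifs at this <;> omega
  have hjx : j ≠ x' := fun h => hb _ hxj _ hxj h.symm
  obtain ⟨⟨i, j'⟩, hy', h3, h4⟩ := SY_use h2 j (by
    rw [Pi.sub_apply, ee_apply, if_neg hjx, if_neg (fun h => hlj h.symm)]
    omega)
  have hj' : j' = j := by
    rcases h3 with h | h
    · exact absurd h (hb _ hy' _ hxj)
    · exact h
  subst hj'
  have h5 := add_mem h4 (ee_mem (hex i l hy' hy hl))
  have h6 : s - ee (x', l) - ee (i, j') + ee (i, l) = s - ee (x', j') := by
    simp only [ee]; abel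
  rwa [h6] at h5

lemma sum_ee_insert_sub (T : Finset (σ × σ)) (y : σ × σ) (hy : y ∉ T) (v : σ → ℤ) :
    v - ∑ z ∈ insert y T, ee z = v - ∑ z ∈ T, ee z - ee y := by
  rw [Finset.sum_insert hy]; abel

/-- generic toggling lemma -/
lemma toggle_sum (F : Finset (Finset (σ × σ))) (f : Finset (σ × σ) → ℤ) (P : Finset (σ × σ) → Prop)
    [DecidablePred P]
    (y : Finset (σ × σ) → σ × σ)
    (hP : ∀ T ∈ F, ¬ P T → f T = 0)
    (hF : ∀ T ∈ F, P T → symmDiff T {y T} ∈ F ∧ P (symmDiff T {y T}) ∧ y (symmDiff T {y T}) = y T)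
    (hf : ∀ T ∈ F, P T → y T ∉ T → f T + f (insert (y T) T) = 0) : ∑ T ∈ F, f T = 0 := by
  classical
  refine Finset.sum_involution (fun T _ => if P T then symmDiff T {y T} else T) ?_ ?_ ?_ ?_
  · intro T hT
    by_cases h : P T
    · rw [if_pos h]
      by_cases hy : y T ∈ T
      · have h1 : insert (y T) (symmDiff T {y T}) = T := by
          ext z
          simp only [Finset.mem_insert, Finset.mem_symmDiff, Finset.mem_singleton]
          by_cases hz : z = y T
          · subst hz; simp [hy]
          · simp [hz]
        have h2 : y T ∉ symmDiff T {y T} := by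
          simp [Finset.mem_symmDiff, hy]
        obtain ⟨a, b, c⟩ := hF T hT h
        have := hf _ a b (by rw [c]; exact h2)
        rw [c, h1] at this
        rw [add_comm]; exact this
      · have h1 : symmDiff T {y T} = insert (y T) T := by
          ext z
          simp only [Finset.mem_insert, Finset.mem_symmDiff, Finset.mem_singleton]
          by_cases hz : z = y T
          · subst hz; simp [hy]
          · simp [hz]
        rw [h1]; exact hf T hT h hy
    · rw [if_neg h, hP T hT h]; rfl
  · intro T hT h0
    by_cases h : P T
    · rw [if_pos h]
      intro he
      have : ({y T} : Finset (σ × σ)) = ∅ := by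
        have h2 : symmDiff T {y T} = T := he
        rw [symmDiff_eq_left] at h2
        exact h2
      simp at this
    · exact absurd (hP T hT h) h0
  · intro T hT
    by_cases h : P T
    · simp only [if_pos h]; exact (hF T hT h).1
    · simp only [if_neg h]; exact hT
  · intro T hT
    by_cases h : P T
    · simp only [if_pos h, if_pos (hF T hT h).2.1, (hF T hT h).2.2]
      exact symmDiff_symmDiff_cancel_right _ _
    · simp only [if_neg h]

lemma sum_ee_row (Y : Finset (σ × σ)) (hb : Bip Y) (x : σ) (j : σ) (hxj : (x, j) ∈ Y)
    (T : Finset (σ × σ)) (hT : T ⊆ Y) :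
    (∑ y ∈ T, ee y) x = (T.filter fun y => y.1 = x).card := by
  rw [Finset.sum_apply, Finset.card_filter]
  push_cast
  refine Finset.sum_congr rfl fun y hy => ?_
  rw [ee_apply, if_neg (hb _ hxj _ (hT hy)), add_zero]
  by_cases h : x = y.1
  · rw [if_pos h, if_pos h.symm]
  · rw [if_neg h, if_neg (Ne.symm h)]

/-- row-degree lemma -/
lemma KY_rowdeg (Y : Finset (σ × σ)) (hb : Bip Y) (x : σ) (key : σ → ℤ)
    (hne : ∃ j, (x, j) ∈ Y)
    (hnest : ∀ j l, (x, j) ∈ Y → (x, l) ∈ Y → key l ≤ key j → ∀ i, (i, j) ∈ Y → (i, l) ∈ Y)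
    (v : σ → ℤ) (hv : ((Y.filter fun y => y.1 = x).card : ℤ) ≤ v x) : KY Y v = 0 := by
  classical
  set st := Y.filter fun y => y.1 = x with hst
  obtain ⟨j0, hj0⟩ := hne
  let J : Finset (σ × σ) → Finset (σ × σ) := fun T => st.filter fun y => 0 < (v - ∑ z ∈ T \ st, ee z) y.2
  have hmax : ∀ A : Finset (σ × σ), ∃ y, A.Nonempty → (y ∈ A ∧ ∀ z ∈ A, key z.2 ≤ key y.2) := by
    intro A
    by_cases h : A.Nonempty
    · obtain ⟨y, hy⟩ := Finset.exists_max_image A (fun z => key z.2) h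
      exact ⟨y, fun _ => hy⟩
    · exact ⟨(x, j0), fun h' => absurd h' h⟩
  choose yy hyy using hmax
  have hmem : ∀ y, y ∈ st ↔ y ∈ Y ∧ y.1 = x := fun y => Finset.mem_filter
  have hsplit : ∀ T, T ⊆ Y → ∀ l, (v - ∑ z ∈ T, ee z) l =
      (v - ∑ z ∈ T \ st, ee z) l - (∑ z ∈ T ∩ st, ee z) l := by
    intro T _ l
    rw [← Finset.sum_inter_add_sum_sdiff T st (fun z => ee z)]
    simp only [Pi.sub_apply, Pi.add_apply]
    ring
  have hx' : ∀ T, T ⊆ Y → (v - ∑ z ∈ T, ee z) x = v x - (T ∩ st).card := by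
    intro T hT
    rw [Pi.sub_apply, sum_ee_row Y hb x j0 hj0 T hT]
    congr 3
    ext z
    rw [Finset.mem_filter, Finset.mem_inter, hmem]
    exact ⟨fun h => ⟨h.1, hT h.1, h.2⟩, fun h => ⟨h.1, h.2.2⟩⟩
  refine toggle_sum Y.powerset _ (fun T => (J T).Nonempty) (fun T => yy (J T)) ?_ ?_ ?_
  · intro T hT h
    rw [Finset.mem_powerset] at hT
    rw [if_neg, mul_zero]
    intro hs
    apply h
    have hlt : ∃ l, (x, l) ∈ Y ∧ 0 < (v - ∑ z ∈ T \ st, ee z) l := by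
      by_cases hTs : (T ∩ st).Nonempty
      · obtain ⟨z, hz⟩ := hTs
        rw [Finset.mem_inter, hmem] at hz
        refine ⟨z.2, by rw [← hz.2.2]; exact hz.2.1, ?_⟩
        have h1 := SY_nonneg hs z.2
        rw [hsplit T hT, Finset.sum_apply] at h1
        have h2 := Finset.single_le_sum (f := fun y => ee y z.2) (fun y _ => ee_nonneg y z.2)
          (Finset.mem_inter.2 ⟨hz.1, (hmem _).2 hz.2⟩)
        have h3 : 1 ≤ ee z z.2 := by rw [ee_apply, if_pos (rfl : z.2 = z.2)]; split_ifs <;> simp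
        omega
      · rw [Finset.not_nonempty_iff_eq_empty] at hTs
        have h1 := hx' T hT
        rw [hTs, Finset.card_empty] at h1
        have : 0 < st.card := Finset.card_pos.2 ⟨(x, j0), (hmem _).2 ⟨hj0, rfl⟩⟩
        obtain ⟨⟨x', l⟩, hy, h2, h3⟩ := SY_use hs x (by rw [h1]; push_cast; omega)
        have hx' : x' = x := by
          rcases h2 with h | h
          · exact h
          · exact absurd h.symm (hb _ hj0 _ hy)
        subst hx'
        refine ⟨l, hy, ?_⟩
        have h4 := SY_nonneg h3 l
        rw [Pi.sub_apply, hsplit T hT, hTs, ee_apply] at h4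
        simp only [if_true, Finset.sum_empty, Pi.zero_apply] at h4
        split_ifs at h4 <;> omega
    obtain ⟨l, hl, hl'⟩ := hlt
    exact ⟨(x, l), Finset.mem_filter.2 ⟨(hmem _).2 ⟨hl, rfl⟩, hl'⟩⟩
  · intro T hT h
    rw [Finset.mem_powerset] at hT
    have h1 := (hyy (J T) h).1
    have h2 : yy (J T) ∈ st := (Finset.mem_filter.1 h1).1
    have h3 : symmDiff T {yy (J T)} \ st = T \ st := by
      ext z
      simp only [Finset.mem_sdiff, Finset.mem_symmDiff, Finset.mem_singleton]
      by_cases hz : z = yy (J T)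
      · subst hz; simp [h2]
      · simp [hz]
    have h4 : J (symmDiff T {yy (J T)}) = J T := by
      simp only [J]
      rw [h3]
    refine ⟨?_, by rw [h4]; exact h, by rw [h4]⟩
    rw [Finset.mem_powerset]
    intro z hz
    simp only [Finset.mem_symmDiff, Finset.mem_singleton] at hz
    rcases hz with hz | hz
    · exact hT hz.1
    · rw [hz.1]; exact ((hmem _).1 h2).1
  · intro T hT h hn
    rw [Finset.mem_powerset] at hT
    obtain ⟨h1, hmx⟩ := hyy (J T) h
    set y := yy (J T) with hy
    have h2 : y ∈ st := (Finset.mem_filter.1 h1).1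
    have hyY := ((hmem _).1 h2).1
    have hyx := ((hmem _).1 h2).2
    have hyx' : y = (x, y.2) := by rw [← hyx]
    rw [Finset.card_insert_of_notMem hn, sum_ee_insert_sub T y hn]
    have hiff : v - ∑ z ∈ T, ee z - ee y ∈ SY Y ↔ v - ∑ z ∈ T, ee z ∈ SY Y := by
      constructor
      · intro hs
        have := add_mem hs (ee_mem hyY)
        rwa [sub_add_cancel] at this
      · intro hs
        rw [hyx']
        apply SY_exchange hb hs
        · rw [← hyx']; exact hyY
        · rw [hx' T hT]
          have : (T ∩ st).card < st.card := by
            apply Finset.card_lt_card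
            refine ⟨Finset.inter_subset_right, fun hc => hn ?_⟩
            exact (Finset.mem_inter.1 (hc h2)).1
          omega
        · rw [hsplit T hT]
          have h5 : (∑ z ∈ T ∩ st, ee z) y.2 = 0 := by
            rw [Finset.sum_apply]
            refine Finset.sum_eq_zero fun z hz => ?_
            rw [Finset.mem_inter, hmem] at hz
            rw [ee_apply, if_neg (fun h => hb _ hz.2.1 _ hyY h.symm), zero_add, if_neg]
            intro h6
            apply hn
            have : y = z := Prod.ext (hyx.trans hz.2.2.symm) h6
            rw [this]; exact hz.1
          rw [h5, sub_zero]
          exact (Finset.mem_filter.1 h1).2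
        · intro i l hi hl hsl
          refine hnest y.2 l (by rw [← hyx']; exact hyY) hl ?_ i hi
          refine hmx (x, l) (Finset.mem_filter.2 ⟨(hmem _).2 ⟨hl, rfl⟩, ?_⟩)
          rw [hsplit T hT] at hsl
          have := sum_ee_nonneg (T ∩ st) l
          change 0 < (v - ∑ z ∈ T \ st, ee z) l
          omega
    rw [if_congr hiff rfl rfl, pow_succ]
    ring

end KPoly

section KPoly2
variable {σ : Type} [Fintype σ] [DecidableEq σ]

lemma Bip.mono {Y Y' : Finset (σ × σ)} (hb : Bip Y) (h : Y' ⊆ Y) : Bip Y' :=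
  fun y hy y' hy' => hb y (h hy) y' (h hy')

lemma sum_ee_col (Y : Finset (σ × σ)) (hb : Bip Y) (x : σ) (j : σ) (hxj : (x, j) ∈ Y)
    (T : Finset (σ × σ)) (hT : T ⊆ Y) :
    (∑ y ∈ T, ee y) j = (T.filter fun y => y.2 = j).card := by
  rw [Finset.sum_apply, Finset.card_filter]
  push_cast
  refine Finset.sum_congr rfl fun y hy => ?_
  rw [ee_apply, if_neg (fun h => hb _ (hT hy) _ hxj h.symm), zero_add]
  by_cases h : j = y.2
  · rw [if_pos h, if_pos h.symm]
  · rw [if_neg h, if_neg (Ne.symm h)]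

/-- the special exponent -/
def vsp (x x' : σ) (N : Finset σ) : σ → ℤ :=
  Pi.single x' 1 + Pi.single x ((N.card : ℤ) - 1) + ∑ j ∈ N, Pi.single j 1

lemma KY_coef_rect (x x' : σ) (hxx : x ≠ x') (N : Finset σ) (hN : 2 ≤ N.card)
    (hxN : x ∉ N) (hxN' : x' ∉ N) : KY (({x, x'} : Finset σ) ×ˢ N) (vsp x x' N) ≠ 0 := by
  classical
  set Y := ({x, x'} : Finset σ) ×ˢ N with hY
  have hmem : ∀ i j, (i, j) ∈ Y ↔ (i = x ∨ i = x') ∧ j ∈ N := by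
    intro i j
    rw [hY, Finset.mem_product]; simp
  have hmem' : ∀ z, z ∈ Y ↔ (z.1 = x ∨ z.1 = x') ∧ z.2 ∈ N := fun z => hmem z.1 z.2
  have hb : Bip Y := by
    intro y hy y' hy' he
    rw [hmem'] at hy hy'
    rcases hy.1 with h | h
    · exact hxN (by rw [← h, he]; exact hy'.2)
    · exact hxN' (by rw [← h, he]; exact hy'.2)
  obtain ⟨a, ha, b, hbN, hab⟩ := Finset.one_lt_card.1 hN
  set v := vsp x x' N with hv
  have hvx : v x = (N.card : ℤ) - 1 := by
    simp only [hv, vsp, Pi.add_apply, Finset.sum_apply, Pi.single_apply, if_neg hxx, if_true]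
    rw [Finset.sum_eq_zero]
    · ring
    · intro j hj
      rw [if_neg]; rintro rfl; exact hxN hj
  have hvx' : v x' = 1 := by
    simp only [hv, vsp, Pi.add_apply, Finset.sum_apply, Pi.single_apply, if_neg hxx.symm, if_true]
    rw [Finset.sum_eq_zero]
    · ring
    · intro j hj
      rw [if_neg]; rintro rfl; exact hxN' hj
  have hvN : ∀ j ∈ N, v j = 1 := by
    intro j hj
    have h1 : j ≠ x := by rintro rfl; exact hxN hj
    have h2 : j ≠ x' := by rintro rfl; exact hxN' hj
    simp only [hv, vsp, Pi.add_apply, Finset.sum_apply, Pi.single_apply, if_neg h1, if_neg h2]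
    simp [hj]
  let T0 : Finset (σ × σ) := (N.erase a).image (fun j => (x, j))
  let T1 : Finset (σ × σ) := N.image (fun j => (x, j))
  have hinj : Function.Injective (fun j : σ => ((x, j) : σ × σ)) := fun i j h => (Prod.ext_iff.1 h).2
  have hT0 : ∀ z, z ∈ T0 ↔ z.1 = x ∧ z.2 ∈ N ∧ z.2 ≠ a := by
    rintro ⟨i, j⟩
    simp only [T0, Finset.mem_image, Finset.mem_erase, Prod.mk.injEq]
    constructor
    · rintro ⟨l, ⟨h1, h2⟩, rfl, rfl⟩; exact ⟨rfl, h2, h1⟩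
    · rintro ⟨h3, h2, h1⟩; exact ⟨j, ⟨h1, h2⟩, h3.symm, rfl⟩
  have hT1 : ∀ z, z ∈ T1 ↔ z.1 = x ∧ z.2 ∈ N := by
    rintro ⟨i, j⟩
    simp only [T1, Finset.mem_image, Prod.mk.injEq]
    constructor
    · rintro ⟨l, h1, rfl, rfl⟩; exact ⟨rfl, h1⟩
    · rintro ⟨h3, h2⟩; exact ⟨j, h2, h3.symm, rfl⟩
  have hT0Y : T0 ⊆ Y := fun z hz => (hmem' z).2 ⟨Or.inl ((hT0 z).1 hz).1, ((hT0 z).1 hz).2.1⟩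
  have hT01 : T0 ≠ T1 := by
    intro h
    have : (x, a) ∈ T0 := by rw [h, hT1]; exact ⟨rfl, ha⟩
    exact ((hT0 _).1 this).2.2 rfl
  have hxa : (x, a) ∈ Y := (hmem _ _).2 ⟨Or.inl rfl, ha⟩
  have hx'a : (x', a) ∈ Y := (hmem _ _).2 ⟨Or.inr rfl, ha⟩
  have hxb : (x, b) ∈ Y := (hmem _ _).2 ⟨Or.inl rfl, hbN⟩
  let f : Finset (σ × σ) → ℤ := fun T => (-1) ^ T.card * (if v - ∑ y ∈ T, ee y ∈ SY Y then 1 else 0)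
  have hsum0 : ∑ z ∈ T0, ee z = Pi.single x ((N.card : ℤ) - 1) + ∑ j ∈ N.erase a, Pi.single j 1 := by
    simp only [T0]
    rw [Finset.sum_image (fun i _ j _ h => hinj h)]
    simp only [ee]
    rw [Finset.sum_add_distrib, Finset.sum_const, Finset.card_erase_of_mem ha]
    congr 1
    funext i
    rw [Pi.smul_apply, Pi.single_apply, Pi.single_apply, nsmul_eq_mul]
    rw [Nat.cast_sub (by omega)]
    split_ifs <;> simp
  have hf0 : f T0 ≠ 0 := by
    have : v - ∑ y ∈ T0, ee y = ee (x', a) := by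
      rw [hsum0, hv, vsp, ← Finset.add_sum_erase N _ ha, ee]
      abel
    simp only [f]
    rw [this, if_pos (ee_mem hx'a), mul_one]
    exact pow_ne_zero _ (by norm_num)
  have hf1 : f T1 = 0 := by
    simp only [f]
    rw [if_neg, mul_zero]
    intro hs
    have h1 := SY_nonneg hs x
    have h2 := sum_ee_row Y hb x a hxa T1 (fun z hz => (hmem' z).2 ⟨Or.inl ((hT1 z).1 hz).1, ((hT1 z).1 hz).2⟩)
    rw [Pi.sub_apply, h2, hvx, Finset.filter_true_of_mem (fun z hz => ((hT1 z).1 hz).1)] at h1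
    rw [Finset.card_image_of_injective _ hinj] at h1
    omega
  have key : ∑ T ∈ Y.powerset.erase T0, f T = 0 := by
    refine toggle_sum _ f (fun T => T ≠ T1) (fun T => if (x', a) ∈ T then (x, b) else (x, a)) ?_ ?_ ?_
    · intro T _ h
      push Not at h
      rw [h, hf1]
    · intro T hT hne
      rw [Finset.mem_erase, Finset.mem_powerset] at hT
      have hsame : ∀ j, j ∈ N → ((x', a) ∈ symmDiff T {(x, j)} ↔ (x', a) ∈ T) := by
        intro j hj
        have : ((x', a) : σ × σ) ≠ (x, j) := fun h => hxx (Prod.ext_iff.1 h).1.symm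
        simp [Finset.mem_symmDiff, this]
      have hsub : ∀ j, j ∈ N → symmDiff T {(x, j)} ⊆ Y := by
        intro j hj z hz
        simp only [Finset.mem_symmDiff, Finset.mem_singleton] at hz
        rcases hz with hz | hz
        · exact hT.2 hz.1
        · rw [hz.1]; exact (hmem _ _).2 ⟨Or.inl rfl, hj⟩
      by_cases h : (x', a) ∈ T
      · simp only [if_pos h, if_pos ((hsame b hbN).2 h)]
        refine ⟨?_, ?_, trivial⟩
        · rw [Finset.mem_erase, Finset.mem_powerset]
          refine ⟨fun he => ?_, hsub b hbN⟩
          have := (hsame b hbN).2 h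
          rw [he, hT0] at this
          exact hxx this.1.symm
        · intro he
          have := (hsame b hbN).2 h
          rw [he, hT1] at this
          exact hxx this.1.symm
      · have hn : (x', a) ∉ symmDiff T {(x, a)} := fun h' => h ((hsame a ha).1 h')
        simp only [if_neg h, if_neg hn]
        have hTT : ∀ A : Finset (σ × σ), symmDiff T {(x, a)} = A → T = symmDiff A {(x, a)} := by
          rintro A rfl
          rw [symmDiff_symmDiff_cancel_right]
        have hTT1 : T1 = symmDiff T0 {(x, a)} := by
          ext z
          rw [Finset.mem_symmDiff, hT0, hT1, Finset.mem_singleton]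
          constructor
          · rintro ⟨h1, h2⟩
            by_cases h3 : z.2 = a
            · right; exact ⟨Prod.ext h1 h3, fun h => h.2.2 h3⟩
            · left; exact ⟨⟨h1, h2, h3⟩, fun h => h3 (by rw [h])⟩
          · rintro (h | h)
            · exact ⟨h.1.1, h.1.2.1⟩
            · rw [h.1]; exact ⟨rfl, ha⟩
        refine ⟨?_, ?_, trivial⟩
        · rw [Finset.mem_erase, Finset.mem_powerset]
          refine ⟨fun he => ?_, hsub a ha⟩
          exact hne ((hTT _ he).trans hTT1.symm)
        · intro he
          apply hT.1
          rw [hTT _ he, hTT1, symmDiff_symmDiff_cancel_right]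
    · intro T hT hne hyT
      rw [Finset.mem_erase, Finset.mem_powerset] at hT
      set y := (if (x', a) ∈ T then (x, b) else (x, a)) with hy
      have hyY : y ∈ Y := by rw [hy]; split_ifs <;> assumption
      have hyx : y.1 = x := by rw [hy]; split_ifs <;> rfl
      simp only [f]
      rw [Finset.card_insert_of_notMem hyT, sum_ee_insert_sub T y hyT]
      have hiff : v - ∑ z ∈ T, ee z - ee y ∈ SY Y ↔ v - ∑ z ∈ T, ee z ∈ SY Y := by
        constructor
        · intro hs
          have := add_mem hs (ee_mem hyY)
          rwa [sub_add_cancel] at this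
        · intro hs
          have hyx' : y = (x, y.2) := by rw [← hyx]
          have hrow := SY_nonneg hs x'
          rw [Pi.sub_apply, sum_ee_row Y hb x' a hx'a T hT.2, hvx'] at hrow
          have hcol : ∀ j ∈ N, ((T.filter fun y => y.2 = j).card : ℤ) ≤ 1 := by
            intro j hj
            have := SY_nonneg hs j
            rw [Pi.sub_apply, sum_ee_col Y hb x j ((hmem _ _).2 ⟨Or.inl rfl, hj⟩) T hT.2, hvN j hj] at this
            omega
          have hrow1 : ∀ i j, (x', i) ∈ T → (x', j) ∈ T → i = j := by
            intro i j hi hj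
            have h1 : (T.filter fun y => y.1 = x').card ≤ 1 := by omega
            have := Finset.card_le_one.1 h1 _ (Finset.mem_filter.2 ⟨hi, rfl⟩) _ (Finset.mem_filter.2 ⟨hj, rfl⟩)
            exact (Prod.ext_iff.1 this).2
          have hcol1 : ∀ j ∈ N, (x, j) ∈ T → (x', j) ∈ T → False := by
            intro j hj hi hj'
            have h1 : (T.filter fun y => y.2 = j).card ≤ 1 := by
              have := hcol j hj; omega
            have := Finset.card_le_one.1 h1 _ (Finset.mem_filter.2 ⟨hi, rfl⟩) _ (Finset.mem_filter.2 ⟨hj', rfl⟩)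
            exact hxx (Prod.ext_iff.1 this).1
          have hyN : y.2 ∈ N := ((hmem' _).1 hyY).2
          rw [hyx']
          apply SY_exchange hb hs
          · rw [← hyx']; exact hyY
          · -- the row count
            rw [Pi.sub_apply, sum_ee_row Y hb x a hxa T hT.2, hvx]
            have himg : (T.filter fun y => y.1 = x).card = ((T.filter fun y => y.1 = x).image Prod.snd).card := by
              rw [Finset.card_image_of_injOn]
              intro p hp q hq hpq
              have hp' := (Finset.mem_filter.1 hp).2
              have hq' := (Finset.mem_filter.1 hq).2
              exact Prod.ext (hp'.trans hq'.symm) hpq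
            rw [himg]
            have hss : (T.filter fun y => y.1 = x).image Prod.snd ⊆ N.erase a := by
              intro j hj
              obtain ⟨z, hz, rfl⟩ := Finset.mem_image.1 hj
              rw [Finset.mem_filter] at hz
              rw [Finset.mem_erase]
              refine ⟨fun h => ?_, ((hmem' _).1 (hT.2 hz.1)).2⟩
              have hz' : z = (x, a) := Prod.ext hz.2 h
              rw [hz'] at hz
              by_cases h' : (x', a) ∈ T
              · exact hcol1 a ha hz.1 h'
              · apply hyT
                rw [hy, if_neg h']; exact hz.1
            have hss' : (T.filter fun y => y.1 = x).image Prod.snd ≠ N.erase a := by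
              intro he
              by_cases h' : (x', a) ∈ T
              · have : b ∈ (T.filter fun y => y.1 = x).image Prod.snd := by
                  rw [he]; exact Finset.mem_erase.2 ⟨hab.symm, hbN⟩
                obtain ⟨z, hz, hzb⟩ := Finset.mem_image.1 this
                rw [Finset.mem_filter] at hz
                have hz' : z = (x, b) := Prod.ext hz.2 hzb
                apply hyT
                rw [hy, if_pos h', ← hz']; exact hz.1
              · apply hT.1
                ext z
                rw [hT0]
                constructor
                · intro hz
                  have hzY := (hmem' _).1 (hT.2 hz)
                  have hza : ∀ j ∈ N, j ≠ a → (x, j) ∈ T := by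
                    intro j hj hja
                    have : j ∈ (T.filter fun y => y.1 = x).image Prod.snd := by
                      rw [he]; exact Finset.mem_erase.2 ⟨hja, hj⟩
                    obtain ⟨z, hz, hzb⟩ := Finset.mem_image.1 this
                    rw [Finset.mem_filter] at hz
                    have hz' : z = (x, j) := Prod.ext hz.2 hzb
                    rw [← hz']; exact hz.1
                  rcases hzY.1 with h1 | h1
                  · refine ⟨h1, hzY.2, fun h2 => ?_⟩
                    have : a ∈ (T.filter fun y => y.1 = x).image Prod.snd :=
                      Finset.mem_image.2 ⟨z, Finset.mem_filter.2 ⟨hz, h1⟩, h2⟩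
                    rw [he] at this
                    exact (Finset.mem_erase.1 this).1 rfl
                  · exfalso
                    have hz' : z = (x', z.2) := Prod.ext h1 rfl
                    by_cases h2 : z.2 = a
                    · rw [h2] at hz'; rw [hz'] at hz; exact h' hz
                    · rw [hz'] at hz
                      exact hcol1 _ hzY.2 (hza _ hzY.2 h2) hz
                · rintro ⟨h1, h2, h3⟩
                  have : z.2 ∈ (T.filter fun y => y.1 = x).image Prod.snd := by
                    rw [he]; exact Finset.mem_erase.2 ⟨h3, h2⟩
                  obtain ⟨w, hw, hwb⟩ := Finset.mem_image.1 this
                  rw [Finset.mem_filter] at hw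
                  have : z = w := Prod.ext (h1.trans hw.2.symm) hwb.symm
                  rw [this]; exact hw.1
            have hlt := Finset.card_lt_card (Finset.ssubset_iff_subset_ne.2 ⟨hss, hss'⟩)
            rw [Finset.card_erase_of_mem ha] at hlt
            omega
          · rw [Pi.sub_apply, hvN _ hyN, sum_ee_col Y hb x y.2 (by rw [← hyx']; exact hyY) T hT.2]
            rw [Finset.filter_false_of_mem]
            · simp
            · intro z hz hz2
              have hzY := (hmem' _).1 (hT.2 hz)
              rcases hzY.1 with h1 | h1
              · apply hyT
                have : y = z := Prod.ext (hyx.trans h1.symm) hz2.symm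
                rw [this]; exact hz
              · have hz' : z = (x', y.2) := Prod.ext h1 hz2
                rw [hz'] at hz
                by_cases h' : (x', a) ∈ T
                · have := hrow1 _ _ hz h'
                  rw [hy, if_pos h'] at this
                  exact hab this.symm
                · have : y.2 = a := by rw [hy, if_neg h']
                  rw [this] at hz
                  exact h' hz
          · intro i l hi hl _
            rw [hmem] at hi hl ⊢
            exact ⟨hi.1, hl.2⟩
      rw [if_congr hiff rfl rfl, pow_succ]
      ring
  have hdef : KY Y v = ∑ T ∈ Y.powerset, f T := rfl
  rw [hdef, ← Finset.add_sum_erase _ f (Finset.mem_powerset.2 hT0Y), key, add_zero]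
  exact hf0

/-- a nonzero coefficient coming from a subrectangle -/
lemma KY_coef (Y : Finset (σ × σ)) (hb : Bip Y) (x x' : σ) (hxx : x ≠ x') (N : Finset σ)
    (hN : 2 ≤ N.card) (h1 : ∀ j ∈ N, (x, j) ∈ Y) (h2 : ∀ j ∈ N, (x', j) ∈ Y) :
    KY Y (vsp x x' N) ≠ 0 := by
  classical
  obtain ⟨j0, hj0⟩ : N.Nonempty := Finset.card_pos.1 (by omega)
  have hxN : x ∉ N := fun h => hb _ (h1 j0 hj0) _ (h1 x h) rfl
  have hxN' : x' ∉ N := fun h => hb _ (h2 j0 hj0) _ (h2 x' h) rfl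
  have hz : ∀ i, (i ≠ x ∧ i ≠ x' ∧ i ∉ N) → vsp x x' N i = 0 := by
    rintro i ⟨ha, hb', hc⟩
    simp [vsp, Pi.single_apply, ha, hb', hc]
  rw [KY_restrict Y (fun i => i ≠ x ∧ i ≠ x' ∧ i ∉ N) _ hz]
  have : (Y.filter fun y => ¬ (y.1 ≠ x ∧ y.1 ≠ x' ∧ y.1 ∉ N) ∧ ¬ (y.2 ≠ x ∧ y.2 ≠ x' ∧ y.2 ∉ N)) =
      ({x, x'} : Finset σ) ×ˢ N := by
    ext ⟨i, j⟩
    rw [Finset.mem_filter, Finset.mem_product]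
    simp only [Finset.mem_insert, Finset.mem_singleton]
    constructor
    · rintro ⟨h3, h4, h5⟩
      have a1 : i ∉ N := fun h => hb _ h3 _ (h1 i h) rfl
      have a2 : j ≠ x := fun h => hb _ (h1 j0 hj0) _ h3 h.symm
      have a3 : j ≠ x' := fun h => hb _ (h2 j0 hj0) _ h3 h.symm
      tauto
    · rintro ⟨h3 | h3, h4⟩
      · subst h3; exact ⟨h1 j h4, by tauto, by tauto⟩
      · subst h3; exact ⟨h2 j h4, by tauto, by tauto⟩
  rw [this]
  exact KY_coef_rect x x' hxx N hN hxN hxN'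

end KPoly2

section KPoly3
variable {σ : Type} [Fintype σ] [DecidableEq σ]

/-- cast exponents -/
def cs (m : σ →₀ ℕ) : σ → ℤ := fun i => (m i : ℤ)

lemma cs_inj : Function.Injective (cs : (σ →₀ ℕ) → σ → ℤ) := by
  intro a b h
  ext i
  have := congrFun h i
  change (a i : ℤ) = (b i : ℤ) at this
  exact_mod_cast this

lemma exists_cs (v : σ → ℤ) (hv : ∀ i, 0 ≤ v i) : ∃ m : σ →₀ ℕ, cs m = v := by
  refine ⟨Finsupp.equivFunOnFinite.symm fun i => (v i).toNat, ?_⟩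
  funext i
  change (((v i).toNat : ℕ) : ℤ) = v i
  exact Int.toNat_of_nonneg (hv i)

open Classical in
/-- the polynomial with given coefficient function -/
noncomputable def polyOf (f : (σ → ℤ) → ℤ) : MvPolynomial σ ℤ :=
  if h : (Function.support f).Finite then
    ∑ m ∈ (h.preimage (cs_inj.injOn)).toFinset, MvPolynomial.monomial m (f (cs m)) else 0

lemma coeff_polyOf (f : (σ → ℤ) → ℤ) (h : (Function.support f).Finite) (m : σ →₀ ℕ) :
    MvPolynomial.coeff m (polyOf f) = f (cs m) := by
  classical
  unfold polyOf
  rw [dif_pos h, MvPolynomial.coeff_sum]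
  simp only [MvPolynomial.coeff_monomial]
  rw [Finset.sum_ite_eq']
  split_ifs with hm
  · rfl
  · by_contra hc
    apply hm
    rw [Set.Finite.mem_toFinset]
    exact fun h => hc h.symm

lemma SY_eq_range (Y : Finset (σ × σ)) :
    SY Y = AddSubmonoid.closure (Set.range fun y : {y // y ∈ Y} => ee y.1) := by
  unfold SY
  congr 1
  ext s
  constructor
  · rintro ⟨y, hy, rfl⟩; exact ⟨⟨y, hy⟩, rfl⟩
  · rintro ⟨y, rfl⟩; exact ⟨y.1, y.2, rfl⟩

lemma KF_eq_KY (Y : Finset (σ × σ)) (v : σ → ℤ) :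
    KF (fun y : {y // y ∈ Y} => ee y.1) (SY Y : Set (σ → ℤ)) v = KY Y v := by
  classical
  unfold KF KY
  refine Finset.sum_bij (fun T _ => T.map (Function.Embedding.subtype _)) ?_ ?_ ?_ ?_
  · intro T _
    rw [Finset.mem_powerset]
    intro z hz
    obtain ⟨y, _, rfl⟩ := Finset.mem_map.1 hz
    exact y.2
  · intro T _ T' _ h
    exact Finset.map_injective _ h
  · intro T hT
    rw [Finset.mem_powerset] at hT
    refine ⟨T.subtype (· ∈ Y), Finset.mem_univ _, ?_⟩
    rw [Finset.subtype_map_of_mem]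
    exact fun x hx => hT hx
  · intro T _
    rw [Finset.card_map, Finset.sum_map]
    rfl

/-- some linear order -/
@[reducible] noncomputable def someOrder (κ : Type) [Finite κ] : LinearOrder κ :=
  LinearOrder.lift' (Finite.equivFin κ) (Finite.equivFin κ).injective

lemma KF_support_finite {κ L : Type} [Fintype κ] [Nonempty κ] [AddCommGroup L] (e : κ → L) (U : Set L)
    (hUS : ∀ v ∈ U, v ∈ AddSubmonoid.closure (Set.range e))
    (hU : ∀ v ∈ U, ∀ s ∈ AddSubmonoid.closure (Set.range e), v + s ∈ U) :
    (Function.support (KF e U)).Finite := by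
  letI := someOrder κ
  refine (bad_finite e U hUS hU).subset fun w hw => ?_
  by_contra hc
  exact hw (KF_eq_zero e U hU w hc)

lemma KY_finite (Y : Finset (σ × σ)) : (Function.support (KY Y)).Finite := by
  classical
  rcases Y.eq_empty_or_nonempty with rfl | ⟨y0, hy0⟩
  · refine (Set.finite_singleton (0 : σ → ℤ)).subset fun v hv => ?_
    rw [Function.mem_support, KY_empty] at hv
    by_contra hc
    exact hv (if_neg hc)
  · haveI : Nonempty {y // y ∈ Y} := ⟨⟨y0, hy0⟩⟩
    have h := KF_support_finite (fun y : {y // y ∈ Y} => ee y.1) (SY Y : Set (σ → ℤ))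
      (by rw [← SY_eq_range]; exact fun v hv => hv)
      (by rw [← SY_eq_range]; exact fun v hv s hs => add_mem hv hs)
    have h2 : KF (fun y : {y // y ∈ Y} => ee y.1) (SY Y : Set (σ → ℤ)) = KY Y := funext (KF_eq_KY Y)
    rwa [h2] at h

/-- the K-polynomial -/
noncomputable def PK (Y : Finset (σ × σ)) : MvPolynomial σ ℤ := polyOf (KY Y)

lemma coeff_PK (Y : Finset (σ × σ)) (m : σ →₀ ℕ) : MvPolynomial.coeff m (PK Y) = KY Y (cs m) :=
  coeff_polyOf _ (KY_finite Y) m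

lemma PK_ext {Y Y' : Finset (σ × σ)} (h : ∀ v, KY Y v = KY Y' v) : PK Y = PK Y' := by
  have : KY Y = KY Y' := funext h
  unfold PK; rw [this]

lemma PK_empty : PK (∅ : Finset (σ × σ)) = 1 := by
  ext m
  rw [coeff_PK, KY_empty, MvPolynomial.coeff_one]
  apply if_congr _ rfl rfl
  constructor
  · intro h; exact (cs_inj (h.trans (by funext i; simp [cs] : (0 : σ → ℤ) = cs 0))).symm
  · rintro rfl; funext i; simp [cs]

/-- setting a variable to zero -/
noncomputable def zx (x : σ) : MvPolynomial σ ℤ →ₐ[ℤ] MvPolynomial σ ℤ :=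
  MvPolynomial.aeval fun i => if i = x then 0 else MvPolynomial.X i

lemma zx_monomial (x : σ) (m : σ →₀ ℕ) (a : ℤ) :
    zx x (MvPolynomial.monomial m a) = if m x = 0 then MvPolynomial.monomial m a else 0 := by
  unfold zx
  rw [MvPolynomial.aeval_monomial]
  split_ifs with h
  · rw [MvPolynomial.monomial_eq, MvPolynomial.algebraMap_eq]
    congr 1
    refine Finsupp.prod_congr fun i hi => ?_
    rw [if_neg]
    rintro rfl
    exact (Finsupp.mem_support_iff.1 hi) h
  · rw [Finsupp.prod, Finset.prod_eq_zero (Finsupp.mem_support_iff.2 h), mul_zero]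
    rw [if_pos rfl, zero_pow h]

lemma coeff_zx (x : σ) (p : MvPolynomial σ ℤ) (m : σ →₀ ℕ) :
    MvPolynomial.coeff m (zx x p) = if m x = 0 then MvPolynomial.coeff m p else 0 := by
  induction p using MvPolynomial.induction_on' with
  | monomial u a =>
    rw [zx_monomial]
    by_cases h : u x = 0
    · rw [if_pos h]
      split_ifs with hm
      · rfl
      · rw [MvPolynomial.coeff_monomial, if_neg]
        rintro rfl; exact hm h
    · rw [if_neg h, MvPolynomial.coeff_zero]
      split_ifs with hm
      · rw [MvPolynomial.coeff_monomial, if_neg]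
        rintro rfl; exact h hm
      · rfl
  | add p q hp hq =>
    rw [map_add, MvPolynomial.coeff_add, hp, hq, MvPolynomial.coeff_add]
    split_ifs <;> simp

lemma zx_degree_le (x y : σ) (p : MvPolynomial σ ℤ) :
    MvPolynomial.degreeOf y (zx x p) ≤ MvPolynomial.degreeOf y p := by
  rw [MvPolynomial.degreeOf_le_iff]
  intro m hm
  apply MvPolynomial.monomial_le_degreeOf
  rw [MvPolynomial.mem_support_iff, coeff_zx] at hm
  rw [MvPolynomial.mem_support_iff]
  intro h
  rw [h] at hm
  simp at hm

lemma zx_eq_self (x : σ) (p : MvPolynomial σ ℤ) (h : MvPolynomial.degreeOf x p = 0) : zx x p = p := by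
  ext m
  rw [coeff_zx]
  split_ifs with hm
  · rfl
  · by_contra hc
    have := MvPolynomial.monomial_le_degreeOf x (MvPolynomial.mem_support_iff.2 (fun h => hc h.symm))
    omega

lemma zx_PK (x : σ) (Y : Finset (σ × σ)) :
    zx x (PK Y) = PK (Y.filter fun y => ¬ y.1 = x ∧ ¬ y.2 = x) := by
  ext m
  rw [coeff_zx, coeff_PK, coeff_PK]
  split_ifs with h
  · apply KY_restrict Y (fun i => i = x)
    rintro i rfl
    simp [cs, h]
  · symm
    by_contra hc
    obtain ⟨T, hT, hT'⟩ := Finset.exists_ne_zero_of_sum_ne_zero hc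
    rw [Finset.mem_powerset] at hT
    have h1 : cs m - ∑ y ∈ T, ee y ∈ SY (Y.filter fun y => ¬ y.1 = x ∧ ¬ y.2 = x) := by
      by_contra hc
      rw [if_neg hc, mul_zero] at hT'
      exact hT' rfl
    have h2 : (∑ y ∈ T, ee y) x = 0 := by
      rw [Finset.sum_apply]
      refine Finset.sum_eq_zero fun y hy => ?_
      have := (Finset.mem_filter.1 (hT hy)).2
      rw [ee_apply, if_neg (Ne.symm this.1), if_neg (Ne.symm this.2), add_zero]
    obtain ⟨y, hy, hy', -⟩ := SY_use h1 x (by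
      rw [Pi.sub_apply, h2, sub_zero]
      simp only [cs]
      omega)
    have := (Finset.mem_filter.1 hy).2
    tauto

lemma PK_ne_zero (Y : Finset (σ × σ)) : PK Y ≠ 0 := by
  intro h
  have h1 : MvPolynomial.coeff 0 (PK Y) = 1 := by
    rw [coeff_PK]
    have h0 : cs (0 : σ →₀ ℕ) = 0 := by funext i; simp [cs]
    rw [h0, KY_restrict Y (fun _ => True) 0 (fun _ _ => rfl)]
    have : (Y.filter fun y => ¬ True ∧ ¬ True) = ∅ := by simp
    rw [this, KY_empty, if_pos rfl]
  rw [h, MvPolynomial.coeff_zero] at h1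
  exact zero_ne_one h1

/-- vanishing when a variable does not occur -/
lemma KY_untouched (Y : Finset (σ × σ)) (x : σ) (h : ∀ y ∈ Y, y.1 ≠ x ∧ y.2 ≠ x) (v : σ → ℤ)
    (hv : 0 < v x) : KY Y v = 0 := by
  by_contra hc
  obtain ⟨m, rfl⟩ := exists_cs v (fun i => KY_nonneg Y v hc i)
  have h1 := zx_PK x Y
  have h2 : (Y.filter fun y => ¬ y.1 = x ∧ ¬ y.2 = x) = Y := Finset.filter_true_of_mem h
  rw [h2] at h1
  have h3 := congrArg (MvPolynomial.coeff m) h1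
  rw [coeff_zx, if_neg, coeff_PK] at h3
  · exact hc h3.symm
  · simp only [cs] at hv
    omega

lemma KY_solo (Y : Finset (σ × σ)) (hb : Bip Y) (Z : σ → Prop) [DecidablePred Z]
    (hZ : ∀ c, Z c → ∃ x, (x, c) ∈ Y ∧ ∀ i, (i, c) ∈ Y → i = x) (v : σ → ℤ) :
    KY Y v = KY (Y.filter fun y => ¬ Z y.1 ∧ ¬ Z y.2) v := by
  classical
  by_cases h : ∀ x, Z x → v x = 0
  · exact KY_restrict Y Z v h
  push Not at h
  obtain ⟨c, hc, hvc⟩ := h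
  rcases lt_or_gt_of_ne hvc with hneg | hpos
  · have h1 : ∀ Y' : Finset (σ × σ), KY Y' v = 0 := by
      intro Y'
      by_contra h1
      have := KY_nonneg Y' v h1 c
      omega
    rw [h1, h1]
  · obtain ⟨x, hx, hx'⟩ := hZ c hc
    rw [KY_untouched (Y.filter _) c _ v hpos, ← KY_swap]
    · have hmem : ∀ i j, (i, j) ∈ Y.map (Equiv.prodComm σ σ).toEmbedding ↔ (j, i) ∈ Y := by
        intro i j
        rw [Finset.mem_map_equiv]; rfl
      apply KY_rowdeg _ _ c (fun _ => 0) ⟨x, (hmem _ _).2 hx⟩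
      · intro j l hj hl _ i hi
        rw [hmem] at *
        rw [hx' l hl, ← hx' j hj]; exact hi
      · have : (Finset.filter (fun y => y.1 = c) (Y.map (Equiv.prodComm σ σ).toEmbedding)).card ≤ 1 := by
          rw [Finset.card_le_one]
          rintro ⟨a, b⟩ ha ⟨a', b'⟩ ha'
          rw [Finset.mem_filter, hmem] at ha ha'
          obtain ⟨h1, h2⟩ := ha
          obtain ⟨h3, h4⟩ := ha'
          simp only at h2 h4
          subst h2; subst h4
          rw [hx' _ h1, hx' _ h3]
        have h2 : ((Finset.filter (fun y => y.1 = c)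
          (Y.map (Equiv.prodComm σ σ).toEmbedding)).card : ℤ) ≤ 1 := by exact_mod_cast this
        omega
      · intro y hy y' hy' he
        obtain ⟨a, b⟩ := y
        obtain ⟨a', b'⟩ := y'
        rw [hmem] at hy hy'
        exact hb _ hy' _ hy he.symm
    · intro y hy
      have := (Finset.mem_filter.1 hy).2
      constructor
      · rintro rfl; exact this.1 hc
      · rintro rfl; exact this.2 hc

/-- a star has trivial K-polynomial -/
lemma PK_star (Y : Finset (σ × σ)) (hb : Bip Y) (x : σ) (h : ∀ y ∈ Y, y.1 = x) : PK Y = 1 := by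
  classical
  rw [← PK_empty]
  apply PK_ext
  intro v
  rw [KY_solo Y hb (fun c => (x, c) ∈ Y)]
  · congr 1
    rw [Finset.filter_eq_empty_iff]
    rintro ⟨a, b⟩ hy ⟨-, h2⟩
    apply h2
    have := h _ hy
    simp only at this
    rw [← this]; exact hy
  · intro c hc
    exact ⟨x, hc, fun i hi => h _ hi⟩

lemma degree_lt_of (Y : Finset (σ × σ)) (x : σ) (d : ℕ) (hd : 0 < d)
    (h : ∀ v : σ → ℤ, (d : ℤ) ≤ v x → KY Y v = 0) : MvPolynomial.degreeOf x (PK Y) < d := by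
  rw [MvPolynomial.degreeOf_lt_iff hd]
  intro m hm
  rw [MvPolynomial.mem_support_iff, coeff_PK] at hm
  by_contra hc
  apply hm
  apply h
  simp only [cs]
  omega

lemma le_degree_of (Y : Finset (σ × σ)) (x : σ) (v : σ → ℤ) (h : KY Y v ≠ 0) :
    v x ≤ MvPolynomial.degreeOf x (PK Y) := by
  obtain ⟨m, rfl⟩ := exists_cs v (fun i => KY_nonneg Y v h i)
  have := MvPolynomial.monomial_le_degreeOf (f := PK Y) x (m := m)
    (MvPolynomial.mem_support_iff.2 (by rw [coeff_PK]; exact h))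
  simp only [cs]
  exact_mod_cast this

lemma degree_unit (x : σ) (f : MvPolynomial σ ℤ) (h : IsUnit f) : MvPolynomial.degreeOf x f = 0 := by
  obtain ⟨g, hg⟩ := h.exists_right_inv
  have h1 : f ≠ 0 := by rintro rfl; simp at hg
  have h2 : g ≠ 0 := by rintro rfl; simp at hg
  have := MvPolynomial.degreeOf_mul_eq (n := x) h1 h2
  rw [hg] at this
  have h3 : MvPolynomial.degreeOf x (1 : MvPolynomial σ ℤ) = 0 := by
    rw [← MvPolynomial.C_1, MvPolynomial.degreeOf_C]
  omega

end KPoly3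

section KPoly4
variable {σ : Type} [Fintype σ] [DecidableEq σ]

lemma PK_swap (Y : Finset (σ × σ)) : PK (Y.map (Equiv.prodComm σ σ).toEmbedding) = PK Y :=
  PK_ext (KY_swap Y)

lemma mem_swapY (Y : Finset (σ × σ)) (a b : σ) :
    (a, b) ∈ Y.map (Equiv.prodComm σ σ).toEmbedding ↔ (b, a) ∈ Y := by
  rw [Finset.mem_map]
  constructor
  · rintro ⟨⟨c, d⟩, h, h'⟩
    simp at h'
    rw [← h'.1, ← h'.2]; exact h
  · intro h
    exact ⟨(b, a), h, rfl⟩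

lemma Bip.swap {Y : Finset (σ × σ)} (hb : Bip Y) : Bip (Y.map (Equiv.prodComm σ σ).toEmbedding) := by
  rintro ⟨a, b⟩ hy ⟨c, d⟩ hy' h
  rw [mem_swapY] at hy hy'
  exact hb _ hy' _ hy h.symm

/-- two-row rectangle -/
noncomputable def QR (x x' : σ) (N : Finset σ) : MvPolynomial σ ℤ := PK (({x, x'} : Finset σ) ×ˢ N)

lemma bip_rect (x x' : σ) (N : Finset σ) (h : x ∉ N) (h' : x' ∉ N) :
    Bip (({x, x'} : Finset σ) ×ˢ N) := by
  rintro ⟨a, b⟩ hy ⟨c, d⟩ hy' e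
  simp only [Finset.mem_product, Finset.mem_insert, Finset.mem_singleton] at hy hy' e
  rcases hy.1 with h1 | h1
  · exact h (h1 ▸ e ▸ hy'.2)
  · exact h' (h1 ▸ e ▸ hy'.2)

lemma QR_degree_le (x x' : σ) (N : Finset σ) (h : x ∉ N) (h' : x' ∉ N) (j : σ) (hj : j ∈ N) :
    MvPolynomial.degreeOf j (QR x x' N) < 2 := by
  unfold QR
  rw [← PK_swap]
  apply degree_lt_of _ _ _ (by norm_num)
  intro v hv
  apply KY_rowdeg _ (bip_rect x x' N h h').swap j (fun _ => 0)
  · exact ⟨x, by rw [mem_swapY]; simp [hj]⟩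
  · intro a b ha hb _ i hi
    rw [mem_swapY] at *
    simp only [Finset.mem_product] at *
    exact ⟨hb.1, hi.2⟩
  · refine le_trans ?_ hv
    have : ((Finset.map (Equiv.prodComm σ σ).toEmbedding (({x, x'} : Finset σ) ×ˢ N)).filter
        fun y => y.1 = j) ⊆ {(j, x), (j, x')} := by
      rintro ⟨a, b⟩ hab
      rw [Finset.mem_filter, mem_swapY] at hab
      simp only [Finset.mem_product, Finset.mem_insert, Finset.mem_singleton] at hab
      simp only [Finset.mem_insert, Finset.mem_singleton, Prod.mk.injEq]
      tauto
    exact_mod_cast (Finset.card_le_card this).trans Finset.card_le_two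

lemma zx_QR (x x' : σ) (N : Finset σ) (j : σ) (h : j ≠ x) (h' : j ≠ x') :
    zx j (QR x x' N) = QR x x' (N.erase j) := by
  unfold QR
  rw [zx_PK]
  congr 1
  ext ⟨a, b⟩
  simp only [Finset.mem_filter, Finset.mem_product, Finset.mem_insert, Finset.mem_singleton,
    Finset.mem_erase]
  constructor
  · tauto
  · rintro ⟨h1, h2, h3⟩
    refine ⟨⟨h1, h3⟩, ?_, h2⟩
    rcases h1 with rfl | rfl
    · exact h.symm
    · exact h'.symm

lemma sum_single_mem (N : Finset σ) (j : σ) :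
    (∑ i ∈ N, (Pi.single i 1 : σ → ℤ)) j = if j ∈ N then 1 else 0 := by
  rw [Finset.sum_apply]
  simp [Pi.single_apply]

lemma vsp_col (x x' : σ) (N : Finset σ) (j : σ) (hx : x ∉ N) (hx' : x' ∉ N) (hj : j ∈ N) :
    vsp x x' N j = 1 := by
  have h1 : j ≠ x := fun h => hx (h ▸ hj)
  have h2 : j ≠ x' := fun h => hx' (h ▸ hj)
  unfold vsp
  rw [Pi.add_apply, Pi.add_apply, sum_single_mem, if_pos hj, Pi.single_eq_of_ne h2,
    Pi.single_eq_of_ne h1]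
  norm_num

lemma vsp_row (x x' : σ) (hxx : x ≠ x') (N : Finset σ) (hx : x ∉ N) :
    vsp x x' N x = (N.card : ℤ) - 1 := by
  unfold vsp
  rw [Pi.add_apply, Pi.add_apply, sum_single_mem, if_neg hx, Pi.single_eq_of_ne hxx,
    Pi.single_eq_same]
  ring

lemma QR_degree_ge (x x' : σ) (hxx : x ≠ x') (N : Finset σ) (h : x ∉ N) (h' : x' ∉ N) (hN : 2 ≤ N.card)
    (j : σ) (hj : j ∈ N) : 1 ≤ MvPolynomial.degreeOf j (QR x x' N) := by
  have h1 := le_degree_of (({x, x'} : Finset σ) ×ˢ N) j _ (KY_coef_rect x x' hxx N hN h h')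
  rw [vsp_col x x' N j h h' hj] at h1
  unfold QR
  exact_mod_cast h1

lemma QR_one (x x' : σ) (N : Finset σ) (h : x ∉ N) (h' : x' ∉ N) (hN : N.card = 1) :
    QR x x' N = 1 := by
  obtain ⟨c, rfl⟩ := Finset.card_eq_one.1 hN
  unfold QR
  rw [← PK_swap]
  apply PK_star _ (bip_rect x x' _ h h').swap c
  rintro ⟨a, b⟩ hy
  rw [mem_swapY] at hy
  simp only [Finset.mem_product, Finset.mem_singleton] at hy
  exact hy.2

lemma QR_irred (x x' : σ) (hxx : x ≠ x') : ∀ (n : ℕ) (N : Finset σ), N.card = n → 2 ≤ n →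
    x ∉ N → x' ∉ N → Irreducible (QR x x' N) := by
  intro n
  induction n with
  | zero => intro N _ h; omega
  | succ n ih =>
    intro N hc hn hx hx'
    have hne : ∀ j ∈ N, j ≠ x ∧ j ≠ x' := fun j hj =>
      ⟨fun h => hx (h ▸ hj), fun h => hx' (h ▸ hj)⟩
    have hcN : 2 ≤ N.card := by omega
    obtain ⟨j, hj⟩ : N.Nonempty := Finset.card_pos.1 (by omega)
    have hQ0 : QR x x' N ≠ 0 := PK_ne_zero _
    have key : ∀ f g, QR x x' N = f * g → MvPolynomial.degreeOf j g = 0 → IsUnit f ∨ IsUnit g := by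
      intro f g hfg hg
      have hf0 : f ≠ 0 := by rintro rfl; rw [zero_mul] at hfg; exact hQ0 hfg
      have hg0 : g ≠ 0 := by rintro rfl; rw [mul_zero] at hfg; exact hQ0 hfg
      have hxe : x ∉ N.erase j := fun h => hx (Finset.mem_of_mem_erase h)
      have hxe' : x' ∉ N.erase j := fun h => hx' (Finset.mem_of_mem_erase h)
      have h1 : QR x x' (N.erase j) = zx j f * g := by
        rw [← zx_QR x x' N j (hne j hj).1 (hne j hj).2, hfg, map_mul, zx_eq_self j g hg]
      have hce : (N.erase j).card = n := by rw [Finset.card_erase_of_mem hj]; omega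
      by_cases h2 : n = 1
      · rw [QR_one x x' _ hxe hxe' (by omega)] at h1
        right
        exact isUnit_iff_exists_inv.2 ⟨zx j f, by rw [mul_comm]; exact h1.symm⟩
      · have hir := ih (N.erase j) hce (by omega) hxe hxe'
        rcases hir.isUnit_or_isUnit h1 with hu | hu
        swap
        · exact Or.inr hu
        left
        have hdf : ∀ i ∈ N.erase j, MvPolynomial.degreeOf i f = 0 := by
          intro i hi
          have h3 := QR_degree_ge x x' hxx _ hxe hxe' (by omega) i hi
          have hz0 : zx j f ≠ 0 := by
            intro h0; rw [h0, zero_mul] at h1; exact PK_ne_zero _ h1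
          rw [h1, MvPolynomial.degreeOf_mul_eq hz0 hg0, degree_unit i _ hu] at h3
          have h4 := QR_degree_le x x' N hx hx' i (Finset.mem_of_mem_erase hi)
          rw [hfg, MvPolynomial.degreeOf_mul_eq hf0 hg0] at h4
          omega
        obtain ⟨i, hi⟩ : (N.erase j).Nonempty := Finset.card_pos.1 (by omega)
        have hiN := Finset.mem_of_mem_erase hi
        have hxi : x ∉ N.erase i := fun h => hx (Finset.mem_of_mem_erase h)
        have hxi' : x' ∉ N.erase i := fun h => hx' (Finset.mem_of_mem_erase h)
        have hci : (N.erase i).card = n := by rw [Finset.card_erase_of_mem hiN]; omega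
        have h5 : QR x x' (N.erase i) = f * zx i g := by
          rw [← zx_QR x x' N i (hne i hiN).1 (hne i hiN).2, hfg, map_mul, zx_eq_self i f (hdf i hi)]
        rcases (ih (N.erase i) hci (by omega) hxi hxi').isUnit_or_isUnit h5 with hu' | hu'
        · exact hu'
        exfalso
        obtain ⟨l, hl⟩ : ((N.erase j).erase i).Nonempty := Finset.card_pos.1 (by
          rw [Finset.card_erase_of_mem hi]; omega)
        have hlj := Finset.mem_of_mem_erase hl
        have hli : l ∈ N.erase i := Finset.mem_erase.2
          ⟨(Finset.mem_erase.1 hl).1, Finset.mem_of_mem_erase hlj⟩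
        have h6 := QR_degree_ge x x' hxx _ hxi hxi' (by omega) l hli
        have hz0 : zx i g ≠ 0 := by
          intro h0; rw [h0, mul_zero] at h5; exact PK_ne_zero _ h5
        rw [h5, MvPolynomial.degreeOf_mul_eq hf0 hz0, degree_unit l _ hu', hdf l hlj] at h6
        omega
    refine ⟨?_, ?_⟩
    · intro hu
      have h3 := QR_degree_ge x x' hxx N hx hx' hcN j hj
      rw [degree_unit j _ hu] at h3
      omega
    · intro f g hfg
      have hf0 : f ≠ 0 := by rintro rfl; rw [zero_mul] at hfg; exact hQ0 hfg
      have hg0 : g ≠ 0 := by rintro rfl; rw [mul_zero] at hfg; exact hQ0 hfg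
      have h4 := QR_degree_le x x' N hx hx' j hj
      rw [hfg, MvPolynomial.degreeOf_mul_eq hf0 hg0] at h4
      by_cases h0 : MvPolynomial.degreeOf j g = 0
      · exact key f g hfg h0
      · exact (key g f (by rw [hfg, mul_comm]) (by omega)).symm

end KPoly4

section KPoly5
variable {σ : Type} [Fintype σ] [DecidableEq σ]

/-- common neighbours of two rows -/
def NN (Y : Finset (σ × σ)) (x x' : σ) : Finset σ :=
  Finset.univ.filter fun j => (x, j) ∈ Y ∧ (x', j) ∈ Y

lemma mem_NN (Y : Finset (σ × σ)) (x x' j : σ) : j ∈ NN Y x x' ↔ (x, j) ∈ Y ∧ (x', j) ∈ Y := by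
  simp [NN]

lemma NN_comm (Y : Finset (σ × σ)) (x x' : σ) : NN Y x x' = NN Y x' x := by
  ext j; rw [mem_NN, mem_NN, and_comm]

lemma two_le_NN {Y : Finset (σ × σ)} {x x' j l : σ} (hjl : j ≠ l) (h1 : (x, j) ∈ Y) (h2 : (x, l) ∈ Y)
    (h3 : (x', j) ∈ Y) (h4 : (x', l) ∈ Y) : 2 ≤ (NN Y x x').card := by
  rw [← Finset.card_pair hjl]
  apply Finset.card_le_card
  intro i hi
  rw [mem_NN]
  simp only [Finset.mem_insert, Finset.mem_singleton] at hi
  rcases hi with rfl | rfl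
  · exact ⟨h1, h3⟩
  · exact ⟨h2, h4⟩

lemma row_degree (Y : Finset (σ × σ)) (hb : Bip Y) (x x' : σ) (hxx : x ≠ x') (key : σ → ℤ)
    (hN : 2 ≤ (NN Y x x').card)
    (hsolo : ∀ j, (x, j) ∈ Y → (x', j) ∉ Y → ∀ i, (i, j) ∈ Y → i = x)
    (hnest : ∀ j l, (x, j) ∈ Y → (x, l) ∈ Y → key l ≤ key j → ∀ i, (i, j) ∈ Y → (i, l) ∈ Y) :
    MvPolynomial.degreeOf x (PK Y) + 1 = (NN Y x x').card := by
  classical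
  obtain ⟨j0, hj0⟩ : (NN Y x x').Nonempty := Finset.card_pos.1 (by omega)
  have hj0' := (mem_NN _ _ _ _).1 hj0
  have hup : MvPolynomial.degreeOf x (PK Y) < (NN Y x x').card := by
    apply degree_lt_of _ _ _ (by omega)
    intro v hv
    let Z : σ → Prop := fun c => (x, c) ∈ Y ∧ (x', c) ∉ Y
    rw [KY_solo Y hb Z (fun c hc => ⟨x, hc.1, hsolo c hc.1 hc.2⟩) v]
    have hsub : (Y.filter fun y => ¬ Z y.1 ∧ ¬ Z y.2) ⊆ Y := Finset.filter_subset _ _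
    have hmem : ∀ i j, (i, j) ∈ (Y.filter fun y => ¬ Z y.1 ∧ ¬ Z y.2) ↔ (i, j) ∈ Y ∧ ¬ Z j := by
      intro i j
      rw [Finset.mem_filter]
      constructor
      · exact fun h => ⟨h.1, h.2.2⟩
      · exact fun h => ⟨h.1, fun hz => hb _ h.1 _ hz.1 rfl, h.2⟩
    apply KY_rowdeg _ (hb.mono hsub) x key
    · exact ⟨j0, (hmem _ _).2 ⟨hj0'.1, fun h => h.2 hj0'.2⟩⟩
    · intro j l hj hl hk i hi
      rw [hmem] at *
      exact ⟨hnest j l hj.1 hl.1 hk i hi.1, hl.2⟩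
    · refine le_trans ?_ hv
      have : ((Y.filter fun y => ¬ Z y.1 ∧ ¬ Z y.2).filter fun y => y.1 = x) ⊆
          (NN Y x x').image fun j => (x, j) := by
        rintro ⟨a, b⟩ hab
        rw [Finset.mem_filter, hmem] at hab
        obtain ⟨⟨h1, h2⟩, rfl⟩ := hab
        rw [Finset.mem_image]
        refine ⟨b, ?_, rfl⟩
        rw [mem_NN]
        refine ⟨h1, ?_⟩
        by_contra hc
        exact h2 ⟨h1, hc⟩
      exact_mod_cast (Finset.card_le_card this).trans Finset.card_image_le
  have hlo := le_degree_of Y x _ (KY_coef Y hb x x' hxx (NN Y x x') hN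
    (fun j hj => ((mem_NN _ _ _ _).1 hj).1) (fun j hj => ((mem_NN _ _ _ _).1 hj).2))
  rw [vsp_row x x' hxx _ (fun h => hb _ hj0'.1 _ ((mem_NN _ _ _ _).1 h).1 rfl)] at hlo
  omega

/-- systems of rows -/
structure RowSys (Y : Finset (σ × σ)) (r : ℕ → σ) (m : ℕ) (key : σ → ℤ) : Prop where
  bip : Bip Y
  rinj : ∀ i j, 1 ≤ i → i ≤ m → 1 ≤ j → j ≤ m → r i = r j → i = j
  rcol : ∀ y ∈ Y, ∀ i, y.2 ≠ r i
  H1 : ∀ i, 1 ≤ i → i + 1 ≤ m → 2 ≤ (NN Y (r i) (r (i + 1))).card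
  H2 : ∀ i, 1 ≤ i → i + 2 ≤ m → 2 ≤ (NN Y (r i) (r (i + 2))).card
  H3 : ∀ p i q j, 1 ≤ p → p ≤ i → i ≤ q → q ≤ m → (r p, j) ∈ Y → (r q, j) ∈ Y → (r i, j) ∈ Y
  H4 : ∀ p i j l, 1 ≤ p → p ≤ i → i ≤ m → (r p, j) ∈ Y → (r p, l) ∈ Y → key l ≤ key j →
    (r i, j) ∈ Y → (r i, l) ∈ Y
  H5 : ∀ p i j l, 1 ≤ i → i ≤ p → p ≤ m → (r p, j) ∈ Y → (r p, l) ∈ Y → key j ≤ key l →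
    (r i, j) ∈ Y → (r i, l) ∈ Y

open Classical in
/-- rows from `p` to `q` -/
noncomputable def FF (Y : Finset (σ × σ)) (r : ℕ → σ) (p q : ℕ) : Finset (σ × σ) :=
  Y.filter fun y => ∃ i, p ≤ i ∧ i ≤ q ∧ y.1 = r i

lemma mem_FF (Y : Finset (σ × σ)) (r : ℕ → σ) (p q : ℕ) (y : σ × σ) :
    y ∈ FF Y r p q ↔ y ∈ Y ∧ ∃ i, p ≤ i ∧ i ≤ q ∧ y.1 = r i := by
  classical
  unfold FF; rw [Finset.mem_filter]

variable {Y : Finset (σ × σ)} {r : ℕ → σ} {m : ℕ} {key : σ → ℤ}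

lemma RowSys.mem_row (_ : RowSys Y r m key) (p q i : ℕ) (h1 : p ≤ i) (h2 : i ≤ q) (j : σ) :
    (r i, j) ∈ FF Y r p q ↔ (r i, j) ∈ Y := by
  rw [mem_FF]
  exact ⟨fun h => h.1, fun h => ⟨h, i, h1, h2, rfl⟩⟩

lemma RowSys.NN_FF (hs : RowSys Y r m key) (p q i i' : ℕ) (h1 : p ≤ i) (h2 : i ≤ q) (h3 : p ≤ i')
    (h4 : i' ≤ q) : NN (FF Y r p q) (r i) (r i') = NN Y (r i) (r i') := by
  ext j
  rw [mem_NN, mem_NN, hs.mem_row p q i h1 h2, hs.mem_row p q i' h3 h4]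

lemma RowSys.bipFF (hs : RowSys Y r m key) (p q : ℕ) : Bip (FF Y r p q) :=
  hs.bip.mono fun y hy => ((mem_FF _ _ _ _ _).1 hy).1

lemma RowSys.zx_last (hs : RowSys Y r m key) (p q : ℕ) (hp : 1 ≤ p) (hpq : p ≤ q) (hq : q + 1 ≤ m) :
    zx (r (q + 1)) (PK (FF Y r p (q + 1))) = PK (FF Y r p q) := by
  rw [zx_PK]
  congr 1
  ext y
  rw [Finset.mem_filter, mem_FF, mem_FF]
  constructor
  · rintro ⟨⟨h1, i, h2, h3, h4⟩, h5, h6⟩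
    refine ⟨h1, i, h2, ?_, h4⟩
    rcases Nat.lt_or_ge q i with h | h
    · exact absurd (by rw [h4]; congr 1; omega) h5
    · exact h
  · rintro ⟨h1, i, h2, h3, h4⟩
    refine ⟨⟨h1, i, h2, by omega, h4⟩, ?_, hs.rcol y h1 _⟩
    intro h
    have := hs.rinj i (q + 1) (by omega) (by omega) (by omega) hq (h4.symm.trans h)
    omega

lemma RowSys.zx_first (hs : RowSys Y r m key) (p q : ℕ) (hp : 1 ≤ p) (hpq : p < q) (hq : q ≤ m) :
    zx (r p) (PK (FF Y r p q)) = PK (FF Y r (p + 1) q) := by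
  rw [zx_PK]
  congr 1
  ext y
  rw [Finset.mem_filter, mem_FF, mem_FF]
  constructor
  · rintro ⟨⟨h1, i, h2, h3, h4⟩, h5, h6⟩
    refine ⟨h1, i, ?_, h3, h4⟩
    rcases Nat.lt_or_ge p i with h | h
    · exact h
    · exact absurd (by rw [h4]; congr 1; omega) h5
  · rintro ⟨h1, i, h2, h3, h4⟩
    refine ⟨⟨h1, i, by omega, h3, h4⟩, ?_, hs.rcol y h1 _⟩
    intro h
    have := hs.rinj i p (by omega) (by omega) (by omega) (by omega) (h4.symm.trans h)
    omega

lemma RowSys.rne (hs : RowSys Y r m key) (i j : ℕ) (h1 : 1 ≤ i) (h2 : i < j) (h3 : j ≤ m) : r i ≠ r j := by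
  intro h
  have := hs.rinj i j (by omega) (by omega) (by omega) (by omega) h
  omega

lemma RowSys.deg_first (hs : RowSys Y r m key) (p q : ℕ) (hp : 1 ≤ p) (hpq : p < q) (hq : q ≤ m) :
    MvPolynomial.degreeOf (r p) (PK (FF Y r p q)) + 1 = (NN Y (r p) (r (p + 1))).card := by
  rw [← hs.NN_FF p q p (p + 1) (by omega) (by omega) (by omega) (by omega)]
  apply row_degree _ (hs.bipFF p q) _ _ (hs.rne p (p + 1) hp (by omega) (by omega)) key
  · rw [hs.NN_FF p q p (p + 1) (by omega) (by omega) (by omega) (by omega)]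
    exact hs.H1 p hp (by omega)
  · intro j h1 h2 i h3
    rw [hs.mem_row p q _ (by omega) (by omega)] at h1 h2
    rw [mem_FF] at h3
    obtain ⟨h3, i', h4, h5, h6⟩ := h3
    simp only at h6
    subst h6
    rcases Nat.lt_or_ge p i' with h | h
    · exact absurd (hs.H3 p (p + 1) i' j hp (by omega) (by omega) (by omega) h1 h3) h2
    · congr 1; omega
  · intro j l h1 h2 hk i h3
    rw [mem_FF] at *
    obtain ⟨h3, i', h4, h5, h6⟩ := h3
    simp only at h6
    subst h6
    exact ⟨hs.H4 p i' j l hp h4 (by omega) h1.1 h2.1 hk h3, i', h4, h5, rfl⟩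

lemma RowSys.deg_last (hs : RowSys Y r m key) (p q : ℕ) (hp : 1 ≤ p) (hpq : p ≤ q) (hq : q + 1 ≤ m) :
    MvPolynomial.degreeOf (r (q + 1)) (PK (FF Y r p (q + 1))) + 1 =
      (NN Y (r (q + 1)) (r q)).card := by
  rw [← hs.NN_FF p (q + 1) (q + 1) q (by omega) (by omega) (by omega) (by omega)]
  apply row_degree _ (hs.bipFF p (q + 1)) _ _ (hs.rne q (q + 1) (by omega) (by omega) (by omega)).symm
    (fun j => - key j)
  · rw [hs.NN_FF p (q + 1) _ _ (by omega) (by omega) (by omega) (by omega), NN_comm]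
    exact hs.H1 q (by omega) (by omega)
  · intro j h1 h2 i h3
    rw [hs.mem_row p (q + 1) _ (by omega) (by omega)] at h1 h2
    rw [mem_FF] at h3
    obtain ⟨h3, i', h4, h5, h6⟩ := h3
    simp only at h6
    subst h6
    rcases Nat.lt_or_ge q i' with h | h
    · congr 1; omega
    · exact absurd (hs.H3 i' q (q + 1) j (by omega) (by omega) (by omega) (by omega) h3 h1) h2
  · intro j l h1 h2 hk i h3
    rw [mem_FF] at *
    obtain ⟨h3, i', h4, h5, h6⟩ := h3
    simp only at h6
    subst h6
    exact ⟨hs.H5 (q + 1) i' j l (by omega) h5 (by omega) h1.1 h2.1 (by linarith) h3, i', h4, h5, rfl⟩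

lemma RowSys.one (hs : RowSys Y r m key) (p : ℕ) : PK (FF Y r p p) = 1 := by
  apply PK_star _ (hs.bipFF p p) (r p)
  intro y hy
  obtain ⟨_, i, h1, h2, h3⟩ := (mem_FF _ _ _ _ _).1 hy
  rw [h3]; congr 1; omega

lemma RowSys.base (hs : RowSys Y r m key) (p : ℕ) (hp : 1 ≤ p) (hq : p + 1 ≤ m) :
    Irreducible (PK (FF Y r p (p + 1))) := by
  classical
  have hN := hs.H1 p hp hq
  have hne := hs.rne p (p + 1) hp (by omega) hq
  have hb := hs.bipFF p (p + 1)
  have hx : r p ∉ NN Y (r p) (r (p + 1)) := fun h =>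
    hs.rcol _ ((mem_NN _ _ _ _).1 h).1 p rfl
  have hx' : r (p + 1) ∉ NN Y (r p) (r (p + 1)) := fun h =>
    hs.rcol _ ((mem_NN _ _ _ _).1 h).1 (p + 1) rfl
  have key : PK (FF Y r p (p + 1)) = QR (r p) (r (p + 1)) (NN Y (r p) (r (p + 1))) := by
    apply PK_ext
    intro v
    have hrow : ∀ i j, (i, j) ∈ FF Y r p (p + 1) ↔ (i, j) ∈ Y ∧ (i = r p ∨ i = r (p + 1)) := by
      intro i j
      rw [mem_FF]
      constructor
      · rintro ⟨h1, i', h2, h3, h4⟩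
        refine ⟨h1, ?_⟩
        rcases (by omega : i' = p ∨ i' = p + 1) with rfl | rfl
        · exact Or.inl h4
        · exact Or.inr h4
      · rintro ⟨h1, rfl | rfl⟩
        · exact ⟨h1, p, by omega, by omega, rfl⟩
        · exact ⟨h1, p + 1, by omega, by omega, rfl⟩
    let Z : σ → Prop := fun c => ((r p, c) ∈ Y ∧ (r (p + 1), c) ∉ Y) ∨ ((r p, c) ∉ Y ∧ (r (p + 1), c) ∈ Y)
    rw [KY_solo _ hb Z]
    · congr 1
      ext ⟨i, j⟩
      rw [Finset.mem_filter, hrow, Finset.mem_product, mem_NN]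
      simp only [Finset.mem_insert, Finset.mem_singleton, Z]
      constructor
      · rintro ⟨⟨h1, h2⟩, h3, h4⟩
        refine ⟨h2, ?_⟩
        rcases h2 with rfl | rfl <;> tauto
      · rintro ⟨h1, h2, h3⟩
        refine ⟨⟨?_, h1⟩, ?_, ?_⟩
        · rcases h1 with rfl | rfl <;> assumption
        · have h5 : ∀ c, (c, i) ∉ Y := by
            intro c hc
            rcases h1 with rfl | rfl
            · exact hs.rcol _ hc _ rfl
            · exact hs.rcol _ hc _ rfl
          have := h5 (r p)
          have := h5 (r (p + 1))
          tauto
        · tauto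
    · rintro c (⟨h1, h2⟩ | ⟨h1, h2⟩)
      · refine ⟨r p, (hrow _ _).2 ⟨h1, Or.inl rfl⟩, ?_⟩
        intro i hi
        rw [hrow] at hi
        rcases hi with ⟨h3, rfl | rfl⟩
        · rfl
        · exact absurd h3 h2
      · refine ⟨r (p + 1), (hrow _ _).2 ⟨h2, Or.inr rfl⟩, ?_⟩
        intro i hi
        rw [hrow] at hi
        rcases hi with ⟨h3, rfl | rfl⟩
        · exact absurd h3 h1
        · rfl
  rw [key]
  exact QR_irred _ _ hne _ _ rfl hN hx hx'

lemma RowSys.skip (hs : RowSys Y r m key) (p : ℕ) (hp : 1 ≤ p) (hq : p + 2 ≤ m) :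
    1 ≤ MvPolynomial.degreeOf (r (p + 2)) (zx (r (p + 1)) (PK (FF Y r p (p + 2)))) := by
  classical
  rw [zx_PK]
  set W := (FF Y r p (p + 2)).filter fun y => ¬ y.1 = r (p + 1) ∧ ¬ y.2 = r (p + 1) with hW
  have hN := hs.H2 p hp hq
  have hb : Bip W := (hs.bipFF p (p + 2)).mono (Finset.filter_subset _ _)
  have hne := (hs.rne p (p + 2) hp (by omega) hq).symm
  have hmem : ∀ i j, i = p ∨ i = p + 2 → (r i, j) ∈ Y → (r i, j) ∈ W := by
    intro i j hi h
    rw [hW, Finset.mem_filter, mem_FF]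
    refine ⟨⟨h, i, by omega, by omega, rfl⟩, ?_, hs.rcol _ h _⟩
    intro he
    have := hs.rinj i (p + 1) (by omega) (by omega) (by omega) (by omega) he
    omega
  have h := le_degree_of W (r (p + 2)) _ (KY_coef W hb (r (p + 2)) (r p) hne (NN Y (r p) (r (p + 2))) hN
    (fun j hj => hmem _ j (Or.inr rfl) ((mem_NN _ _ _ _).1 hj).2)
    (fun j hj => hmem _ j (Or.inl rfl) ((mem_NN _ _ _ _).1 hj).1))
  rw [vsp_row _ _ hne _ (fun h => hs.rcol _ ((mem_NN _ _ _ _).1 h).1 (p + 2) rfl)] at h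
  omega

theorem RowSys.irred (hs : RowSys Y r m key) : ∀ (d p : ℕ), 1 ≤ p → p + d + 1 ≤ m →
    Irreducible (PK (FF Y r p (p + d + 1))) := by
  intro d
  induction d with
  | zero => intro p hp hq; exact hs.base p hp hq
  | succ d ih =>
    intro p hp hq
    have I1 : Irreducible (PK (FF Y r p (p + d + 1))) := ih p hp (by omega)
    have I2 : Irreducible (PK (FF Y r (p + 1) (p + d + 1 + 1))) := by
      have := ih (p + 1) (by omega) (by omega)
      rwa [show p + 1 + d + 1 = p + d + 1 + 1 by omega] at this
    change Irreducible (PK (FF Y r p (p + d + 1 + 1)))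
    have hK0 : PK (FF Y r p (p + d + 1 + 1)) ≠ 0 := PK_ne_zero _
    have E1 := hs.zx_last p (p + d + 1) hp (by omega) (by omega)
    have E2 := hs.zx_first p (p + d + 1 + 1) hp (by omega) (by omega)
    have key : ∀ f g, PK (FF Y r p (p + d + 1 + 1)) = f * g → IsUnit (zx (r (p + d + 1 + 1)) g) →
        IsUnit f ∨ IsUnit g := by
      intro f g hfg hu
      have hf0 : f ≠ 0 := by rintro rfl; rw [zero_mul] at hfg; exact hK0 hfg
      have hg0 : g ≠ 0 := by rintro rfl; rw [mul_zero] at hfg; exact hK0 hfg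
      rw [hfg, map_mul] at E1 E2
      have hf'0 : zx (r (p + d + 1 + 1)) f ≠ 0 := by
        intro h; rw [h, zero_mul] at E1; exact PK_ne_zero _ E1.symm
      have hg'0 : zx (r (p + d + 1 + 1)) g ≠ 0 := hu.ne_zero
      have D1 := hs.deg_first p (p + d + 1 + 1) hp (by omega) (by omega)
      have D2 := hs.deg_first p (p + d + 1) hp (by omega) (by omega)
      rw [hfg, MvPolynomial.degreeOf_mul_eq hf0 hg0] at D1
      rw [← E1, MvPolynomial.degreeOf_mul_eq hf'0 hg'0, degree_unit _ _ hu] at D2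
      have D3 := zx_degree_le (r (p + d + 1 + 1)) (r p) f
      have D4 : MvPolynomial.degreeOf (r p) g = 0 := by omega
      rw [zx_eq_self _ g D4] at E2
      rcases I2.isUnit_or_isUnit E2.symm with hu2 | hu2
      swap
      · exact Or.inr hu2
      exfalso
      rcases Nat.eq_zero_or_pos d with rfl | hd
      · have D5 := hs.deg_last p (p + 0 + 1) hp (by omega) (by omega)
        have D6 := hs.deg_last (p + 1) (p + 0 + 1) (by omega) (by omega) (by omega)
        rw [hfg, MvPolynomial.degreeOf_mul_eq hf0 hg0] at D5
        rw [← E2, MvPolynomial.degreeOf_mul_eq hu2.ne_zero hg0, degree_unit _ _ hu2] at D6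
        have D7 : MvPolynomial.degreeOf (r (p + 0 + 1 + 1)) f = 0 := by omega
        have E3 := hs.zx_first (p + 1) (p + 0 + 1 + 1) (by omega) (by omega) (by omega)
        rw [← E2, map_mul, hs.one (p + 1 + 1)] at E3
        have hu3 : IsUnit (zx (r (p + 1)) g) := isUnit_iff_exists_inv.2 ⟨_, by rw [mul_comm]; exact E3⟩
        have D8 := hs.skip p hp (by omega)
        change 1 ≤ MvPolynomial.degreeOf (r (p + 0 + 1 + 1)) (zx (r (p + 1)) (PK (FF Y r p (p + 0 + 1 + 1)))) at D8
        rw [hfg, map_mul] at D8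
        by_cases h0 : zx (r (p + 1)) f = 0
        · rw [h0, zero_mul] at D8; simp at D8
        · rw [MvPolynomial.degreeOf_mul_eq h0 hu3.ne_zero, degree_unit _ _ hu3] at D8
          have D9 := zx_degree_le (r (p + 1)) (r (p + 0 + 1 + 1)) f
          omega
      · obtain ⟨d, rfl⟩ : ∃ d', d = d' + 1 := ⟨d - 1, by omega⟩
        have E3 := hs.zx_last (p + 1) (p + (d + 1) + 1) (by omega) (by omega) (by omega)
        rw [← E2, map_mul] at E3
        have hK : IsUnit (PK (FF Y r (p + 1) (p + (d + 1) + 1))) := by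
          rw [← E3]
          exact (hu2.map _).mul hu
        have D5 := hs.deg_first (p + 1) (p + (d + 1) + 1) (by omega) (by omega) (by omega)
        rw [degree_unit _ _ hK] at D5
        have := hs.H1 (p + 1) (by omega) (by omega)
        omega
    refine ⟨?_, ?_⟩
    · intro hu
      apply I1.not_isUnit
      rw [← E1]
      exact hu.map _
    · intro f g hfg
      have E1' := E1
      rw [hfg, map_mul] at E1'
      rcases I1.isUnit_or_isUnit E1'.symm with hu | hu
      · exact (key g f (by rw [hfg, mul_comm]) hu).symm
      · exact key f g hfg hu

end KPoly5

section LadderComb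
variable {m n : ℕ} {Y : Set (ℕ × ℕ)}

lemma col_conv (hY : StdLadder m n Y) {p i q j : ℕ} (h1 : p ≤ i) (h2 : i ≤ q) (h3 : (p, j) ∈ Y)
    (h4 : (q, j) ∈ Y) : (i, j) ∈ Y := by
  obtain ⟨hL, _, _, hrow, _⟩ := hY
  have g1 := hL.1 _ h3
  have g2 := hL.1 _ h4
  obtain ⟨l, hl⟩ := hrow i (by have := g1.1; simp only at this; omega)
    (by have := g2.2.1; simp only at this; omega)
  rcases le_total j l with h | h
  · exact (hL.2 p j i l h3 hl h1 h).2
  · exact (hL.2 i l q j hl h4 h2 h).1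

lemma row_conv (hY : StdLadder m n Y) {i j c l : ℕ} (h1 : j ≤ c) (h2 : c ≤ l) (h3 : (i, j) ∈ Y)
    (h4 : (i, l) ∈ Y) : (i, c) ∈ Y := by
  obtain ⟨hL, _, _, _, hcol⟩ := hY
  have g1 := hL.1 _ h3
  have g2 := hL.1 _ h4
  obtain ⟨p, hp⟩ := hcol c (by have := g1.2.2.1; simp only at this; omega)
    (by have := g2.2.2.2; simp only at this; omega)
  rcases le_total i p with h | h
  · exact (hL.2 i j p c h3 hp h h1).1
  · exact (hL.2 p c i l hp h4 h h2).2

/-- rows `i` and `p` share two columns -/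
def Share2 (Y : Set (ℕ × ℕ)) (i p : ℕ) : Prop :=
  ∃ j l, j < l ∧ (i, j) ∈ Y ∧ (i, l) ∈ Y ∧ (p, j) ∈ Y ∧ (p, l) ∈ Y

lemma minor_two {M : Set (ℕ × ℕ)} (h : IsMinor 2 Y M) : ∃ r0 r1 c0 c1, r0 < r1 ∧ c0 < c1 ∧
    (r0, c0) ∈ Y ∧ (r0, c1) ∈ Y ∧ (r1, c0) ∈ Y ∧ (r1, c1) ∈ Y ∧
    M ⊆ {(r0, c0), (r0, c1), (r1, c0), (r1, c1)} := by
  obtain ⟨r, c, hr, hc, h1, rfl⟩ := h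
  refine ⟨r 0, r 1, c 0, c 1, hr (by decide), hc (by decide), h1 0 0, h1 0 1, h1 1 0, h1 1 1, ?_⟩
  rintro p ⟨u, v, rfl⟩
  fin_cases u <;> fin_cases v <;> simp

lemma share_succ (hY : StdLadder m n Y) (hconn : TConnected m n 2 Y) (i : ℕ) (hi : 1 ≤ i)
    (him : i + 1 ≤ m) : Share2 Y i (i + 1) := by
  by_contra hs
  apply hconn
  have hL := hY.1
  obtain ⟨j1, hj1⟩ := hY.2.2.2.1 i hi (by omega)
  obtain ⟨j2, hj2⟩ := hY.2.2.2.1 (i + 1) (by omega) him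
  refine ⟨{y | y ∈ Y ∧ y.1 ≤ i}, {y | y ∈ Y ∧ i < y.1}, ⟨(i, j1), hj1, le_rfl⟩,
    ⟨(i + 1, j2), hj2, Nat.lt_succ_self i⟩, ?_, ?_, ?_, ?_, ?_⟩
  · refine ⟨fun p hp => hL.1 p hp.1, ?_⟩
    intro a b c d h1 h2 h3 h4
    have := hL.2 a b c d h1.1 h2.1 h3 h4
    exact ⟨⟨this.1, h1.2⟩, ⟨this.2, h2.2⟩⟩
  · refine ⟨fun p hp => hL.1 p hp.1, ?_⟩
    intro a b c d h1 h2 h3 h4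
    have := hL.2 a b c d h1.1 h2.1 h3 h4
    exact ⟨⟨this.1, h1.2⟩, ⟨this.2, h2.2⟩⟩
  · ext y
    simp only [Set.mem_inter_iff, Set.mem_setOf_eq, Set.mem_empty_iff_false, iff_false]
    rintro ⟨⟨_, h1⟩, _, h2⟩
    omega
  · ext y
    simp only [Set.mem_union, Set.mem_setOf_eq]
    constructor
    · rintro (h | h) <;> exact h.1
    · intro h
      rcases Nat.lt_or_ge i y.1 with h1 | h1
      · exact Or.inr ⟨h, h1⟩
      · exact Or.inl ⟨h, h1⟩
  · intro M hM
    obtain ⟨r0, r1, c0, c1, hr, hc, h00, h01, h10, h11, hsub⟩ := minor_two hM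
    rcases Nat.lt_or_ge i r0 with h | h
    · right
      intro y hy
      have := hsub hy
      simp only [Set.mem_insert_iff, Set.mem_singleton_iff] at this
      rcases this with rfl | rfl | rfl | rfl
      · exact ⟨h00, h⟩
      · exact ⟨h01, h⟩
      · exact ⟨h10, h.trans hr⟩
      · exact ⟨h11, h.trans hr⟩
    · rcases Nat.lt_or_ge i r1 with h' | h'
      · exfalso
        apply hs
        exact ⟨c0, c1, hc, col_conv hY h (by omega) h00 h10, col_conv hY h (by omega) h01 h11,
          col_conv hY (by omega) h' h00 h10, col_conv hY (by omega) h' h01 h11⟩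
      · left
        intro y hy
        have := hsub hy
        simp only [Set.mem_insert_iff, Set.mem_singleton_iff] at this
        rcases this with rfl | rfl | rfl | rfl
        · exact ⟨h00, h⟩
        · exact ⟨h01, h⟩
        · exact ⟨h10, h'⟩
        · exact ⟨h11, h'⟩

lemma share_zero (hY : StdLadder m n Y) (hconn : TConnected m n 2 Y) (i : ℕ) (hi : 1 ≤ i)
    (him : i + 2 ≤ m) : ∃ b, (i, b) ∈ Y ∧ (i + 2, b) ∈ Y := by
  by_contra hs
  apply hconn
  have hL := hY.1
  obtain ⟨j1, hj1⟩ := hY.2.2.2.1 i hi (by omega)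
  obtain ⟨j2, hj2⟩ := hY.2.2.2.1 (i + 2) (by omega) him
  have A : ∀ p c q l, (p, c) ∈ Y → p ≤ i → (q, l) ∈ Y → i + 2 ≤ q → l < c := by
    intro p c q l h1 h2 h3 h4
    by_contra hc
    apply hs
    have h5 := (hL.2 p c q l h1 h3 (by omega) (by omega)).1
    exact ⟨l, col_conv hY h2 (by omega) h5 h3, col_conv hY (by omega) h4 h5 h3⟩
  have B : ∀ q l, (q, l) ∈ Y → i + 2 ≤ q → ∃ s, (i + 2, s) ∈ Y ∧ l ≤ s := by
    intro q l h1 h2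
    rcases le_total l j2 with h | h
    · exact ⟨j2, hj2, h⟩
    · exact ⟨l, (hL.2 _ _ q l hj2 h1 h2 h).1, le_rfl⟩
  let Q : ℕ × ℕ → Prop := fun y => i + 2 ≤ y.1 ∨ (y.1 = i + 1 ∧ ∃ s, (i + 2, s) ∈ Y ∧ y.2 ≤ s)
  refine ⟨{y | y ∈ Y ∧ ¬ Q y}, {y | y ∈ Y ∧ Q y}, ⟨(i, j1), hj1, ?_⟩,
    ⟨(i + 2, j2), hj2, Or.inl le_rfl⟩, ?_, ?_, ?_, ?_, ?_⟩
  · rintro (h | ⟨h, _⟩) <;> simp only at h <;> omega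
  · refine ⟨fun p hp => hL.1 p hp.1, ?_⟩
    intro a b c d h1 h2 h3 h4
    have h5 := hL.2 a b c d h1.1 h2.1 h3 h4
    refine ⟨⟨h5.1, ?_⟩, ⟨h5.2, ?_⟩⟩
    · rintro (h | ⟨h, s, hs1, hs2⟩)
      · exact h1.2 (Or.inl h)
      · exact h1.2 (Or.inr ⟨h, s, hs1, h4.trans hs2⟩)
    · rintro (h | ⟨h, s, hs1, hs2⟩)
      · exact h2.2 (Or.inl h)
      · simp only at h hs2
        rcases Nat.lt_or_ge i a with ha | ha
        · exact h1.2 (Or.inr ⟨by simp only; omega, s, hs1, hs2⟩)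
        · have := A a b (i + 2) s h1.1 ha hs1 le_rfl
          omega
  · refine ⟨fun p hp => hL.1 p hp.1, ?_⟩
    intro a b c d h1 h2 h3 h4
    have h5 := hL.2 a b c d h1.1 h2.1 h3 h4
    refine ⟨⟨h5.1, ?_⟩, ⟨h5.2, ?_⟩⟩
    · rcases h1.2 with h | ⟨h, s, hs1, hs2⟩
      · exact Or.inl h
      · right
        simp only at h
        refine ⟨h, ?_⟩
        rcases h2.2 with h' | ⟨h', s', hs1', hs2'⟩
        · exact B c d h2.1 h'
        · exact ⟨s', hs1', hs2'⟩
    · rcases h2.2 with h | ⟨h, s, hs1, hs2⟩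
      · exact Or.inl h
      · exact Or.inr ⟨h, s, hs1, h4.trans hs2⟩
  · ext y
    simp only [Set.mem_inter_iff, Set.mem_setOf_eq, Set.mem_empty_iff_false, iff_false]
    rintro ⟨⟨_, h1⟩, _, h2⟩
    exact h1 h2
  · ext y
    simp only [Set.mem_union, Set.mem_setOf_eq]
    constructor
    · rintro (h | h) <;> exact h.1
    · intro h
      by_cases h1 : Q y
      · exact Or.inr ⟨h, h1⟩
      · exact Or.inl ⟨h, h1⟩
  · intro M hM
    obtain ⟨r0, r1, c0, c1, hr, hc, h00, h01, h10, h11, hsub⟩ := minor_two hM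
    have hin : M ⊆ Y := by
      intro y hy
      have := hsub hy
      simp only [Set.mem_insert_iff, Set.mem_singleton_iff] at this
      rcases this with rfl | rfl | rfl | rfl <;> assumption
    rcases Nat.lt_or_ge i r0 with h | h
    · right
      intro y hy
      refine ⟨hin hy, ?_⟩
      have hy' := hsub hy
      simp only [Set.mem_insert_iff, Set.mem_singleton_iff] at hy'
      have hrow : ∀ c, (r0, c) ∈ Y → (r1, c) ∈ Y → Q (r0, c) := by
        intro c _ h2
        rcases Nat.lt_or_ge (i + 1) r0 with h' | h'
        · exact Or.inl h'
        · exact Or.inr ⟨by simp only; omega, B r1 c h2 (by omega)⟩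
      rcases hy' with rfl | rfl | rfl | rfl
      · exact hrow _ h00 h10
      · exact hrow _ h01 h11
      · left; simp only; omega
      · left; simp only; omega
    · left
      intro y hy
      refine ⟨hin hy, ?_⟩
      have hy' := hsub hy
      simp only [Set.mem_insert_iff, Set.mem_singleton_iff] at hy'
      have hr0 : ∀ c, ¬ Q (r0, c) := by
        rintro c (h' | ⟨h', _⟩) <;> simp only at h' <;> omega
      have hr1 : ∀ c, (r0, c) ∈ Y → (r1, c) ∈ Y → ¬ Q (r1, c) := by
        rintro c h1 h2 (h' | ⟨h', s, hs1, hs2⟩)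
        · have := A r0 c r1 c h1 h h2 h'
          omega
        · have := A r0 c (i + 2) s h1 h hs1 le_rfl
          simp only at hs2
          omega
      rcases hy' with rfl | rfl | rfl | rfl
      · exact hr0 _
      · exact hr0 _
      · exact hr1 _ h00 h10
      · exact hr1 _ h01 h11

lemma share_skip (hY : StdLadder m n Y) (hconn : TConnected m n 2 Y)
    (hnc : ∀ p q : ℕ × ℕ, IsLowerCorner Y p → IsUpperCorner Y q → p ≠ q) (i : ℕ) (hi : 1 ≤ i)
    (him : i + 2 ≤ m) : Share2 Y i (i + 2) := by
  by_contra hs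
  obtain ⟨b, hb1, hb2⟩ := share_zero hY hconn i hi him
  have hL := hY.1
  have huniq : ∀ c, (i, c) ∈ Y → (i + 2, c) ∈ Y → c = b := by
    intro c h1 h2
    by_contra hne
    rcases Nat.lt_or_gt_of_ne hne with h | h
    · exact hs ⟨c, b, h, h1, hb1, h2, hb2⟩
    · exact hs ⟨b, c, h, hb1, h1, hb2, h2⟩
  have hb : (i + 1, b) ∈ Y := col_conv hY (by omega) (by omega) hb1 hb2
  obtain ⟨c, hc1, hc2, hc3⟩ : ∃ c, c < b ∧ (i + 1, c) ∈ Y ∧ (i + 2, c) ∈ Y := by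
    obtain ⟨j, l, hjl, h1, h2, h3, h4⟩ := share_succ hY hconn (i + 1) (by omega) (by omega)
    refine ⟨j, ?_, h1, h3⟩
    by_contra hc
    have := huniq l (hL.2 i b (i + 2) l hb1 h4 (by omega) (by omega)).1 h4
    omega
  obtain ⟨d, hd1, hd2, hd3⟩ : ∃ d, b < d ∧ (i, d) ∈ Y ∧ (i + 1, d) ∈ Y := by
    obtain ⟨j, l, hjl, h1, h2, h3, h4⟩ := share_succ hY hconn i (by omega) (by omega)
    refine ⟨l, ?_, h2, h4⟩
    by_contra hc
    have := huniq j h1 (hL.2 i j (i + 2) b h1 hb2 (by omega) (by omega)).2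
    omega
  apply hnc (i + 1, b) (i + 1, b) _ _ rfl
  · refine ⟨hb, hb1, row_conv hY (by omega : c ≤ b - 1) (by omega) hc2 hb, ?_⟩
    intro h
    have := huniq (b - 1) h (row_conv hY (by omega : c ≤ b - 1) (by omega) hc3 hb2)
    omega
  · refine ⟨hb, hb2, row_conv hY (by omega) (by omega : b + 1 ≤ d) hb hd3, ?_⟩
    intro h
    have := huniq (b + 1) (row_conv hY (by omega) (by omega : b + 1 ≤ d) hb1 hd2) h
    omega

end LadderComb

section LadderGraph
variable (m n : ℕ) (Y : Set (ℕ × ℕ))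

/-- the edge attached to a position -/
def edg (y : ℕ × ℕ) : (Fin (m + 1) ⊕ Fin (n + 1)) × (Fin (m + 1) ⊕ Fin (n + 1)) :=
  (Sum.inl (Fin.ofNat (m + 1) y.1), Sum.inr (Fin.ofNat (n + 1) y.2))

open Classical in
/-- the bipartite graph of a ladder -/
noncomputable def gr : Finset ((Fin (m + 1) ⊕ Fin (n + 1)) × (Fin (m + 1) ⊕ Fin (n + 1))) :=
  Finset.univ.filter fun z => ∃ y ∈ Y, z = edg m n y

/-- the columns key -/
def gkey : Fin (m + 1) ⊕ Fin (n + 1) → ℤ := Sum.elim (fun _ => 0) (fun j => ((j : ℕ) : ℤ))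

variable {m n Y}

lemma mem_gr (z) : z ∈ gr m n Y ↔ ∃ y ∈ Y, z = edg m n y := by
  classical
  unfold gr; rw [Finset.mem_filter]; simp

lemma ofNat_inj' {m i j : ℕ} (hi : i ≤ m) (hj : j ≤ m) (h : Fin.ofNat (m + 1) i = Fin.ofNat (m + 1) j) :
    i = j := by
  have := congrArg Fin.val h
  simp only [Fin.ofNat] at this
  rwa [Nat.mod_eq_of_lt (by omega), Nat.mod_eq_of_lt (by omega)] at this

lemma mem_gr_row (hY : StdLadder m n Y) (i : ℕ) (hi : i ≤ m) (c : Fin (m + 1) ⊕ Fin (n + 1)) :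
    ((Sum.inl (Fin.ofNat (m + 1) i) : Fin (m + 1) ⊕ Fin (n + 1)), c) ∈ gr m n Y ↔
      ∃ j, (i, j) ∈ Y ∧ j ≤ n ∧ c = Sum.inr (Fin.ofNat (n + 1) j) := by
  rw [mem_gr]
  constructor
  · rintro ⟨⟨a, b⟩, h, h'⟩
    have hg := hY.1.1 _ h
    simp only [edg, Prod.mk.injEq, Sum.inl.injEq] at h'
    have := ofNat_inj' hi hg.2.1 h'.1
    simp only at this
    subst this
    exact ⟨b, h, hg.2.2.2, h'.2⟩
  · rintro ⟨j, h, _, rfl⟩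
    exact ⟨(i, j), h, rfl⟩

lemma mem_gr_pair (hY : StdLadder m n Y) (i j : ℕ) (hi : i ≤ m) (hj : j ≤ n) :
    ((Sum.inl (Fin.ofNat (m + 1) i) : Fin (m + 1) ⊕ Fin (n + 1)), Sum.inr (Fin.ofNat (n + 1) j)) ∈ gr m n Y ↔
      (i, j) ∈ Y := by
  rw [mem_gr_row hY i hi]
  constructor
  · rintro ⟨j', h, h1, h2⟩
    have := ofNat_inj' hj h1 (Sum.inr_injective h2)
    subst this
    exact h
  · intro h
    exact ⟨j, h, hj, rfl⟩

lemma gkey_inr (j : ℕ) (hj : j ≤ n) : gkey m n (Sum.inr (Fin.ofNat (n + 1) j)) = (j : ℤ) := by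
  simp only [gkey, Sum.elim_inr, Fin.ofNat]
  rw [Nat.mod_eq_of_lt (by omega)]

lemma gr_rowSys (hY : StdLadder m n Y) (hconn : TConnected m n 2 Y)
    (hnc : ∀ p q : ℕ × ℕ, IsLowerCorner Y p → IsUpperCorner Y q → p ≠ q) :
    RowSys (gr m n Y) (fun i => Sum.inl (Fin.ofNat (m + 1) i)) m (gkey m n) := by
  have hL := hY.1
  have share : ∀ i p, i ≤ m → p ≤ m → Share2 Y i p →
      2 ≤ (NN (gr m n Y) (Sum.inl (Fin.ofNat (m + 1) i)) (Sum.inl (Fin.ofNat (m + 1) p))).card := by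
    rintro i p hi hp ⟨j, l, hjl, h1, h2, h3, h4⟩
    have g1 := (hL.1 _ h1).2.2.2
    have g2 := (hL.1 _ h2).2.2.2
    refine two_le_NN (j := Sum.inr (Fin.ofNat (n + 1) j)) (l := Sum.inr (Fin.ofNat (n + 1) l)) ?_
      ((mem_gr_pair hY i j hi g1).2 h1) ((mem_gr_pair hY i l hi g2).2 h2)
      ((mem_gr_pair hY p j hp g1).2 h3) ((mem_gr_pair hY p l hp g2).2 h4)
    intro h
    have := ofNat_inj' g1 g2 (Sum.inr_injective h)
    omega
  refine ⟨?_, ?_, ?_, ?_, ?_, ?_, ?_, ?_⟩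
  · intro y hy y' hy'
    obtain ⟨_, _, rfl⟩ := (mem_gr y).1 hy
    obtain ⟨_, _, rfl⟩ := (mem_gr y').1 hy'
    simp [edg]
  · intro i j _ hi _ hj h
    exact ofNat_inj' hi hj (Sum.inl_injective h)
  · intro y hy i
    obtain ⟨_, _, rfl⟩ := (mem_gr y).1 hy
    simp [edg]
  · intro i hi him
    exact share i (i + 1) (by omega) him (share_succ hY hconn i hi him)
  · intro i hi him
    exact share i (i + 2) (by omega) him (share_skip hY hconn hnc i hi him)
  · intro p i q j hp hpi hiq hq h1 h2
    rw [mem_gr_row hY _ (by omega)] at h1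
    obtain ⟨j, h1, hj, rfl⟩ := h1
    rw [mem_gr_pair hY _ _ (by omega) hj] at h2 ⊢
    exact col_conv hY hpi hiq h1 h2
  · intro p i j l hp hpi hi h1 h2 hk h3
    rw [mem_gr_row hY _ (by omega)] at h1 h2
    obtain ⟨j, h1, hj, rfl⟩ := h1
    obtain ⟨l, h2, hl, rfl⟩ := h2
    rw [gkey_inr j hj, gkey_inr l hl] at hk
    rw [mem_gr_pair hY _ _ (by omega) (by omega)] at h3 ⊢
    exact (hL.2 p l i j h2 h3 hpi (by omega)).2
  · intro p i j l hi hip hp h1 h2 hk h3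
    rw [mem_gr_row hY _ (by omega)] at h1 h2
    obtain ⟨j, h1, hj, rfl⟩ := h1
    obtain ⟨l, h2, hl, rfl⟩ := h2
    rw [gkey_inr j hj, gkey_inr l hl] at hk
    rw [mem_gr_pair hY _ _ (by omega) (by omega)] at h3 ⊢
    exact (hL.2 i j p l h3 h2 hip (by omega)).1

theorem gr_irred (hY : StdLadder m n Y) (hconn : TConnected m n 2 Y)
    (hnc : ∀ p q : ℕ × ℕ, IsLowerCorner Y p → IsUpperCorner Y q → p ≠ q) :
    PK (gr m n Y) = 1 ∨ Irreducible (PK (gr m n Y)) := by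
  have hs := gr_rowSys hY hconn hnc
  have hm : 1 ≤ m := by have := (hY.1.1 _ hY.2.1).2.1; exact this
  have hF : FF (gr m n Y) (fun i => Sum.inl (Fin.ofNat (m + 1) i)) 1 m = gr m n Y := by
    ext z
    rw [mem_FF]
    refine ⟨fun h => h.1, fun h => ⟨h, ?_⟩⟩
    obtain ⟨y, hy, rfl⟩ := (mem_gr z).1 h
    have hg := hY.1.1 _ hy
    exact ⟨y.1, hg.1, hg.2.1, rfl⟩
  rcases Nat.lt_or_ge 1 m with h | h
  · right
    have := hs.irred (m - 2) 1 le_rfl (by omega)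
    rwa [show 1 + (m - 2) + 1 = m by omega, hF] at this
  · left
    have := hs.one 1
    have hm1 : m = 1 := by omega
    rw [← hF]
    convert this using 3

end LadderGraph

section Reversal
open MvPolynomial
variable {σ : Type} [Fintype σ] [DecidableEq σ]

/-- reversal of a polynomial -/
noncomputable def rv (N : σ →₀ ℕ) : MvPolynomial σ ℤ →ₗ[ℤ] MvPolynomial σ ℤ :=
  (MvPolynomial.basisMonomials σ ℤ).constr ℤ fun m => monomial (N - m) 1

lemma rv_monomial (N m : σ →₀ ℕ) (a : ℤ) : rv N (monomial m a) = monomial (N - m) a := by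
  have h : (monomial m a : MvPolynomial σ ℤ) = a • (MvPolynomial.basisMonomials σ ℤ) m := by
    rw [MvPolynomial.coe_basisMonomials, MvPolynomial.smul_monomial, smul_eq_mul, mul_one]
  rw [h, map_smul]
  unfold rv
  rw [Module.Basis.constr_basis, MvPolynomial.smul_monomial, smul_eq_mul, mul_one]

lemma rv_eq_sum (N : σ →₀ ℕ) (p : MvPolynomial σ ℤ) :
    rv N p = ∑ m ∈ p.support, monomial (N - m) (coeff m p) := by
  conv_lhs => rw [p.as_sum]
  rw [map_sum]
  exact Finset.sum_congr rfl fun m _ => rv_monomial _ _ _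

/-- bounded exponents -/
def Bd (N : σ →₀ ℕ) (p : MvPolynomial σ ℤ) : Prop := ∀ m ∈ p.support, m ≤ N

lemma exists_Bd (p : MvPolynomial σ ℤ) : ∃ N, Bd N p :=
  ⟨∑ m ∈ p.support, m, fun m hm => Finset.single_le_sum (f := fun m => m) (fun _ _ => zero_le) hm⟩

lemma rv_mul (N M : σ →₀ ℕ) (p c : MvPolynomial σ ℤ) (hp : Bd N p) (hc : Bd M c) :
    rv (N + M) (p * c) = rv N p * rv M c := by
  rw [rv_eq_sum N p, rv_eq_sum M c]
  conv_lhs => rw [p.as_sum, c.as_sum]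
  rw [Finset.sum_mul_sum, Finset.sum_mul_sum, map_sum]
  refine Finset.sum_congr rfl fun m hm => ?_
  rw [map_sum]
  refine Finset.sum_congr rfl fun l hl => ?_
  rw [monomial_mul, rv_monomial, monomial_mul]
  congr 1
  congr 1
  have h1 := hp m hm
  have h2 := hc l hl
  ext i
  have h1 := h1 i
  have h2 := h2 i
  simp only [Finsupp.coe_tsub, Finsupp.coe_add, Pi.sub_apply, Pi.add_apply]
  omega

lemma rv_shift (N M : σ →₀ ℕ) (p : MvPolynomial σ ℤ) (hp : Bd N p) :
    rv (N + M) p = rv N p * monomial M 1 := by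
  have h := rv_mul N M p 1 hp (by
    intro m hm
    have : m = 0 := by
      by_contra hc
      rw [mem_support_iff, coeff_one, if_neg (Ne.symm hc)] at hm
      exact hm rfl
    rw [this]; exact zero_le)
  rw [mul_one] at h
  rw [h]
  congr 1
  change rv M (monomial 0 1) = _
  rw [rv_monomial, tsub_zero]

lemma coeff_rv (N : σ →₀ ℕ) (p : MvPolynomial σ ℤ) (hp : Bd N p) (m : σ →₀ ℕ) :
    coeff m (rv N p) = if m ≤ N then coeff (N - m) p else 0 := by
  classical
  rw [rv_eq_sum, coeff_sum]
  simp only [coeff_monomial]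
  split_ifs with h
  · by_cases h2 : coeff (N - m) p = 0
    · rw [h2]
      apply Finset.sum_eq_zero
      intro l hl
      split_ifs with h3
      · rw [← h3, tsub_tsub_cancel_of_le (hp l hl)] at h2
        exact h2
      · rfl
    · rw [Finset.sum_eq_single (N - m)]
      · rw [if_pos (tsub_tsub_cancel_of_le h)]
      · intro l hl hne
        rw [if_neg]
        rintro rfl
        exact hne (tsub_tsub_cancel_of_le (hp l hl)).symm
      · intro h3
        exact absurd (mem_support_iff.2 h2) h3
  · apply Finset.sum_eq_zero
    intro l hl
    rw [if_neg]
    rintro rfl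
    exact h tsub_le_self

lemma Bd_rv (N : σ →₀ ℕ) (p : MvPolynomial σ ℤ) (hp : Bd N p) : Bd N (rv N p) := by
  intro m hm
  rw [mem_support_iff, coeff_rv N p hp] at hm
  by_contra h
  rw [if_neg h] at hm
  exact hm rfl

lemma rv_rv (N : σ →₀ ℕ) (p : MvPolynomial σ ℤ) (hp : Bd N p) : rv N (rv N p) = p := by
  ext m
  rw [coeff_rv N _ (Bd_rv N p hp)]
  split_ifs with h
  · rw [coeff_rv N p hp, if_pos tsub_le_self, tsub_tsub_cancel_of_le h]
  · by_contra hc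
    exact h (hp m (mem_support_iff.2 (Ne.symm hc)))

lemma coeff_mul_rv (N : σ →₀ ℕ) (p : MvPolynomial σ ℤ) (t : σ →₀ ℕ) :
    coeff t (p * rv N p) = ∑ m ∈ p.support, ∑ l ∈ p.support,
      if m + (N - l) = t then coeff m p * coeff l p else 0 := by
  classical
  rw [rv_eq_sum]
  conv_lhs => rw [p.as_sum]
  rw [Finset.sum_mul, coeff_sum]
  have hs : (∑ v ∈ p.support, (monomial v) (coeff v p)) = p := p.as_sum.symm
  rw [hs]
  refine Finset.sum_congr rfl fun m _ => ?_
  rw [Finset.mul_sum, coeff_sum]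
  refine Finset.sum_congr rfl fun l _ => ?_
  rw [monomial_mul, coeff_monomial]

lemma unit_monomial (M : σ →₀ ℕ) (c : MvPolynomial σ ℤ) (hc : Bd M c)
    (h : c * rv M c = monomial M 1) : ∃ (w : σ →₀ ℕ) (s : ℤ), (s = 1 ∨ s = -1) ∧ c = monomial w s := by
  classical
  have h1 := congrArg (coeff M) h
  rw [coeff_mul_rv, coeff_monomial, if_pos rfl] at h1
  have h2 : ∀ m ∈ c.support, (∑ l ∈ c.support, if m + (M - l) = M then coeff m c * coeff l c else 0) =
      coeff m c ^ 2 := by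
    intro m hm
    rw [Finset.sum_eq_single m]
    · rw [if_pos (add_tsub_cancel_of_le (hc m hm)), sq]
    · intro l hl hne
      rw [if_neg]
      intro h3
      apply hne
      have h4 : m + (M - l) = l + (M - l) := h3.trans (add_tsub_cancel_of_le (hc l hl)).symm
      exact (add_right_cancel h4).symm
    · intro h3; exact absurd hm h3
  rw [Finset.sum_congr rfl h2] at h1
  have hne : c.support.Nonempty := by
    by_contra h3
    rw [Finset.not_nonempty_iff_eq_empty] at h3
    rw [h3] at h1
    simp at h1
  obtain ⟨w, hw⟩ := hne
  have hpos : ∀ m ∈ c.support, 1 ≤ coeff m c ^ 2 := by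
    intro m hm
    have := mem_support_iff.1 hm
    have h3 : 0 < coeff m c ^ 2 := by positivity
    omega
  have hcard : (c.support.card : ℤ) ≤ 1 := by
    rw [← h1, Finset.card_eq_sum_ones, Nat.cast_sum]
    exact Finset.sum_le_sum fun m hm => by simpa using hpos m hm
  have hsub : c.support = {w} := by
    symm
    apply Finset.eq_of_subset_of_card_le
    · simpa using hw
    · rw [Finset.card_singleton]; exact_mod_cast hcard
  rw [hsub, Finset.sum_singleton] at h1
  refine ⟨w, coeff w c, mul_self_eq_one_iff.1 (by rw [← sq]; exact h1), ?_⟩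
  conv_lhs => rw [c.as_sum, hsub, Finset.sum_singleton]

lemma dich_aux (N : σ →₀ ℕ) (p q : MvPolynomial σ ℤ) (hp : Bd N p) (hq : Bd N q) (hq0 : q ≠ 0)
    (h : p * rv N p = q * rv N q) (hd : q ∣ p) :
    ∃ (w : σ →₀ ℕ) (s : ℤ), (s = 1 ∨ s = -1) ∧ p = q * monomial w s := by
  obtain ⟨c, rfl⟩ := hd
  obtain ⟨M, hM⟩ := exists_Bd c
  have h1 := rv_mul N M q c hq hM
  rw [rv_shift N M _ hp] at h1
  have hr0 : rv N q ≠ 0 := by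
    intro h0
    have := rv_rv N q hq
    rw [h0, map_zero] at this
    exact hq0 this.symm
  have h2 : q * rv N q * (c * rv M c) = q * rv N q * monomial M 1 := by
    calc q * rv N q * (c * rv M c) = q * c * (rv N q * rv M c) := by ring
      _ = q * c * (rv N (q * c) * monomial M 1) := by rw [h1]
      _ = (q * c * rv N (q * c)) * monomial M 1 := by ring
      _ = _ := by rw [h]
  have h3 := mul_left_cancel₀ (mul_ne_zero hq0 hr0) h2
  obtain ⟨w, s, hs, rfl⟩ := unit_monomial M c hM h3
  exact ⟨w, s, hs, rfl⟩

lemma dichotomy (N : σ →₀ ℕ) (p q : MvPolynomial σ ℤ) (hp : Bd N p) (hq : Bd N q)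
    (hqi : q = 1 ∨ Irreducible q) (h : p * rv N p = q * rv N q) :
    ∃ (w : σ →₀ ℕ) (s : ℤ), (s = 1 ∨ s = -1) ∧
      (p = q * monomial w s ∨ rv N p = q * monomial w s) := by
  have hq0 : q ≠ 0 := by
    rcases hqi with rfl | hi
    · exact one_ne_zero
    · exact hi.ne_zero
  have hor : q ∣ p ∨ q ∣ rv N p := by
    rcases hqi with rfl | hi
    · exact Or.inl (one_dvd _)
    · exact hi.prime.dvd_or_dvd (h ▸ dvd_mul_right _ _)
  rcases hor with hd | hd
  · obtain ⟨w, s, hs, h1⟩ := dich_aux N p q hp hq hq0 h hd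
    exact ⟨w, s, hs, Or.inl h1⟩
  · obtain ⟨w, s, hs, h1⟩ := dich_aux N (rv N p) q (Bd_rv N p hp) hq hq0
      (by rw [rv_rv N p hp, mul_comm]; exact h) hd
    exact ⟨w, s, hs, Or.inr h1⟩

lemma coeff_mul_monomial_cs (f : (σ → ℤ) → ℤ) (q : MvPolynomial σ ℤ) (w : σ →₀ ℕ) (s : ℤ)
    (hf : ∀ m, coeff m q = f (cs m)) (hf0 : ∀ v, f v ≠ 0 → ∀ i, 0 ≤ v i) (m : σ →₀ ℕ) :
    coeff m (q * monomial w s) = s * f (cs m - cs w) := by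
  rw [coeff_mul_monomial']
  split_ifs with h
  · rw [hf, mul_comm]
    congr 2
    funext i
    have := h i
    simp only [cs, Finsupp.coe_tsub, Pi.sub_apply]
    omega
  · by_contra hc
    apply h
    intro i
    have h1 : f (cs m - cs w) ≠ 0 := by
      intro h0; rw [h0, mul_zero] at hc; exact hc rfl
    have := hf0 _ h1 i
    simp only [cs, Pi.sub_apply] at this
    omega

/-- function version of the dichotomy -/
theorem fun_dichotomy (f g : (σ → ℤ) → ℤ) (hf : (Function.support f).Finite)
    (hg : (Function.support g).Finite) (hf0 : ∀ v, f v ≠ 0 → ∀ i, 0 ≤ v i)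
    (hg0 : ∀ v, g v ≠ 0 → ∀ i, 0 ≤ v i) (hgi : polyOf g = 1 ∨ Irreducible (polyOf g))
    (h : ∀ A B : Finset (σ → ℤ), (∀ w, f w ≠ 0 → w ∈ A) → (∀ w, g w ≠ 0 → w ∈ B) →
      ∀ u, ∑ w ∈ A, f w * f (w - u) = ∑ w ∈ B, g w * g (w - u)) :
    ∃ (w : σ → ℤ) (s : ℤ), (s = 1 ∨ s = -1) ∧
      ((∀ v, f v = s * g (v + w)) ∨ (∀ v, f v = s * g (w - v))) := by
  classical
  have main : ∀ (f : (σ → ℤ) → ℤ), (Function.support f).Finite →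
      (∀ v, f v ≠ 0 → ∀ i, 0 ≤ v i) → ∀ N, Bd N (polyOf f) → ∀ t,
      coeff t (polyOf f * rv N (polyOf f)) =
        ∑ w ∈ (polyOf f).support.image cs, f w * f (w - (cs t - cs N)) := by
    intro f hf hf0 N hN t
    rw [coeff_mul_rv, Finset.sum_image (fun a _ b _ h => cs_inj h)]
    refine Finset.sum_congr rfl fun m hm => ?_
    rw [← coeff_polyOf f hf m]
    by_cases h0 : f (cs m - (cs t - cs N)) = 0
    · rw [h0, mul_zero]
      apply Finset.sum_eq_zero
      intro l hl
      rw [if_neg]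
      intro h1
      apply mem_support_iff.1 hl
      rw [coeff_polyOf f hf, ← h0]
      congr 1
      funext i
      have h2 := DFunLike.congr_fun h1 i
      have h3 := hN l hl i
      simp only [cs, Finsupp.coe_add, Finsupp.coe_tsub, Pi.sub_apply, Pi.add_apply] at h2 ⊢
      omega
    · obtain ⟨l, hl⟩ := exists_cs _ (hf0 _ h0)
      rw [← hl] at h0 ⊢
      have hls : l ∈ (polyOf f).support := by rw [mem_support_iff, coeff_polyOf f hf]; exact h0
      rw [Finset.sum_eq_single l]
      · rw [if_pos, ← coeff_polyOf f hf l]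
        ext i
        have h2 := congrFun hl i
        have h3 := hN l hls i
        simp only [cs, Finsupp.coe_add, Finsupp.coe_tsub, Pi.sub_apply, Pi.add_apply] at h2 ⊢
        omega
      · intro l' hl' hne
        rw [if_neg]
        intro h1
        apply hne
        apply cs_inj
        rw [hl]
        funext i
        have h2 := DFunLike.congr_fun h1 i
        have h3 := hN l' hl' i
        simp only [cs, Finsupp.coe_add, Finsupp.coe_tsub, Pi.sub_apply, Pi.add_apply] at h2 ⊢
        omega
      · intro h1; exact absurd hls h1
  obtain ⟨N1, hN1⟩ := exists_Bd (polyOf f)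
  obtain ⟨N2, hN2⟩ := exists_Bd (polyOf g)
  have hNf : Bd (N1 + N2) (polyOf f) := fun m hm => (hN1 m hm).trans le_self_add
  have hNg : Bd (N1 + N2) (polyOf g) := fun m hm => (hN2 m hm).trans le_add_self
  set N := N1 + N2
  have hsup : ∀ (f : (σ → ℤ) → ℤ), (Function.support f).Finite →
      (∀ v, f v ≠ 0 → ∀ i, 0 ≤ v i) → ∀ w, f w ≠ 0 → w ∈ (polyOf f).support.image cs := by
    intro f hf hf0 w hw
    obtain ⟨m, rfl⟩ := exists_cs w (hf0 w hw)
    exact Finset.mem_image_of_mem _ (by rw [mem_support_iff, coeff_polyOf f hf]; exact hw)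
  have heq : polyOf f * rv N (polyOf f) = polyOf g * rv N (polyOf g) := by
    ext t
    rw [main f hf hf0 N hNf, main g hg hg0 N hNg]
    exact h _ _ (hsup f hf hf0) (hsup g hg hg0) _
  obtain ⟨w, s, hs, h1 | h1⟩ := dichotomy N _ _ hNf hNg hgi heq
  · refine ⟨- cs w, s, hs, Or.inl fun v => ?_⟩
    by_cases hv : ∀ i, 0 ≤ v i
    · obtain ⟨m, rfl⟩ := exists_cs v hv
      rw [← coeff_polyOf f hf, h1, coeff_mul_monomial_cs g _ w s (coeff_polyOf g hg) hg0, sub_eq_add_neg]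
    · have h2 : f v = 0 := by
        by_contra hc; exact hv (hf0 v hc)
      rw [h2]
      by_contra hc
      apply hv
      intro i
      have h3 : g (v + - cs w) ≠ 0 := by
        intro h0; rw [h0, mul_zero] at hc; exact hc rfl
      have := hg0 _ h3 i
      simp only [cs, Pi.add_apply, Pi.neg_apply] at this
      omega
  · refine ⟨cs N - cs w, s, hs, Or.inr fun v => ?_⟩
    by_cases hv : ∀ i, 0 ≤ (cs N - v) i
    · obtain ⟨m, hm⟩ := exists_cs _ hv
      have h2 := congrArg (coeff m) h1
      rw [coeff_mul_monomial_cs g _ w s (coeff_polyOf g hg) hg0, coeff_rv N _ hNf] at h2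
      have h4 : cs m - cs w = cs N - cs w - v := by rw [hm]; abel
      rw [h4] at h2
      rw [← h2]
      split_ifs with h5
      · rw [coeff_polyOf f hf]
        congr 1
        funext i
        have h6 := congrFun hm i
        have h7 := h5 i
        simp only [cs, Pi.sub_apply, Finsupp.coe_tsub] at h6 ⊢
        omega
      · by_contra hc
        apply h5
        intro i
        have h6 := congrFun hm i
        have h7 := hf0 v hc i
        simp only [cs, Pi.sub_apply] at h6
        omega
    · have h2 : f v = 0 := by
        by_contra hc
        apply hv
        obtain ⟨m, hm⟩ := exists_cs v (hf0 v hc)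
        intro i
        have h3 := hNf m (by rw [mem_support_iff, coeff_polyOf f hf, hm]; exact hc) i
        have h4 := congrFun hm i
        simp only [cs, Pi.sub_apply] at h4 ⊢
        omega
      rw [h2]
      by_contra hc
      apply hv
      intro i
      have h3 : g (cs N - cs w - v) ≠ 0 := by
        intro h0; rw [h0, mul_zero] at hc; exact hc rfl
      have := hg0 _ h3 i
      simp only [cs, Pi.sub_apply] at this ⊢
      omega

end Reversal

section Determine
variable {κ L : Type} [Fintype κ] [AddCommGroup L]

lemma KF_det (e : κ → L) (deg : L →+ ℤ) (he : ∀ y, 1 ≤ deg (e y)) (h : L → ℤ) (c : ℤ)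
    (hb : ∀ v, h v ≠ 0 → c ≤ deg v)
    (h0 : ∀ v, ∑ T : Finset κ, (-1) ^ T.card * h (v - eT e T) = 0) (v : L) : h v = 0 := by
  classical
  have key : ∀ n : ℕ, ∀ v, deg v < c + n → h v = 0 := by
    intro n
    induction n with
    | zero =>
      intro v hv
      by_contra hc
      have := hb v hc
      push_cast at hv
      omega
    | succ n ih =>
      intro v hv
      have h1 := h0 v
      rw [Finset.sum_eq_single (∅ : Finset κ)] at h1
      · simpa [eT] using h1
      · intro T _ hT
        rw [ih, mul_zero]
        obtain ⟨y, hy⟩ := Finset.nonempty_iff_ne_empty.2 hT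
        have h2 : 1 ≤ deg (eT e T) := by
          unfold eT
          rw [map_sum]
          refine (he y).trans ?_
          exact Finset.single_le_sum (f := fun y => deg (e y))
            (fun z _ => zero_le_one.trans (he z)) hy
        rw [map_sub]
        push_cast at hv
        omega
      · intro h2; exact absurd (Finset.mem_univ _) h2
  refine key (deg v - c + 1).toNat v ?_
  omega

lemma translate_of_KF (e : κ → L) (deg : L →+ ℤ) (he : ∀ y, 1 ≤ deg (e y)) (U U' : Set L)
    (hU : ∀ v ∈ U, 0 ≤ deg v) (hU' : ∀ v ∈ U', 0 ≤ deg v) (hne : U'.Nonempty) (s : ℤ)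
    (hs : s = 1 ∨ s = -1) (t : L) (h : ∀ v, KF e U' v = s * KF e U (v + t)) (v : L) :
    v ∈ U' ↔ v + t ∈ U := by
  classical
  have key : ∀ v, (if v ∈ U' then (1 : ℤ) else 0) - s * (if v + t ∈ U then 1 else 0) = 0 := by
    apply KF_det e deg he _ (min 0 (- deg t))
    · intro v hv
      by_cases h1 : v ∈ U'
      · exact (min_le_left _ _).trans (hU' v h1)
      · by_cases h2 : v + t ∈ U
        · have := hU _ h2
          rw [map_add] at this
          exact (min_le_right _ _).trans (by omega)
        · simp [h1, h2] at hv
    · intro v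
      have h1 := h v
      unfold KF at h1
      rw [Finset.mul_sum, ← sub_eq_zero, ← Finset.sum_sub_distrib] at h1
      rw [← h1]
      refine Finset.sum_congr rfl fun T _ => ?_
      rw [show v + t - eT e T = v - eT e T + t by abel, mul_sub]
      congr 1
      · congr 1
        congr
      · rw [mul_left_comm]
        congr 2
        congr
  have hs1 : s = 1 := by
    obtain ⟨v0, hv0⟩ := hne
    have := key v0
    rw [if_pos hv0] at this
    rcases hs with rfl | rfl
    · rfl
    · split_ifs at this
      · norm_num at this
      · norm_num at this
  have := key v
  rw [hs1] at this
  by_cases h1 : v ∈ U' <;> by_cases h2 : v + t ∈ U <;> simp [h1, h2] at this ⊢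

end Determine

section Final

variable {σ : Type} [Fintype σ] [DecidableEq σ]

lemma cs_add (p q : σ →₀ ℕ) : cs (p + q) = cs p + cs q := by
  funext i; simp [cs]

lemma cs_nonneg (p : σ →₀ ℕ) (i : σ) : 0 ≤ cs p i := by simp [cs]

/-- The degree on the lattice. -/
def degL (σ : Type) [Fintype σ] : (σ → ℤ) →+ ℤ where
  toFun v := ∑ i, v i
  map_zero' := by simp
  map_add' v w := by simp [Finset.sum_add_distrib]

lemma degL_apply (v : σ → ℤ) : degL σ v = ∑ i, v i := rfl

lemma degL_ee (y : σ × σ) : degL σ (ee y) = 2 := by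
  rw [ee, map_add, degL_apply, degL_apply]
  simp

lemma degL_nonneg {v : σ → ℤ} (hv : ∀ i, 0 ≤ v i) : 0 ≤ degL σ v :=
  Finset.sum_nonneg fun i _ => hv i

lemma degL_pos {v : σ → ℤ} (hv : ∀ i, 0 ≤ v i) (h0 : v ≠ 0) : 1 ≤ degL σ v := by
  by_contra hlt
  apply h0
  have h1 : ∑ i, v i = 0 := by
    have := degL_nonneg hv
    rw [degL_apply] at this hlt
    omega
  rw [Finset.sum_eq_zero_iff_of_nonneg (fun i _ => hv i)] at h1
  funext i
  exact h1 i (Finset.mem_univ i)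

open Classical in
/-- Coefficient at an integer exponent. -/
noncomputable def zcoef {k : Type} [Field k] (t : MvPolynomial σ k) (v : σ → ℤ) : k :=
  if h : ∃ p, cs p = v then MvPolynomial.coeff h.choose t else 0

lemma zcoef_cs {k : Type} [Field k] (t : MvPolynomial σ k) (p : σ →₀ ℕ) :
    zcoef t (cs p) = MvPolynomial.coeff p t := by
  have h : ∃ q, cs q = cs p := ⟨p, rfl⟩
  unfold zcoef
  rw [dif_pos h]
  rw [cs_inj h.choose_spec]

lemma zcoef_none {k : Type} [Field k] (t : MvPolynomial σ k) (v : σ → ℤ)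
    (h : ¬ ∃ p, cs p = v) : zcoef t v = 0 := by
  unfold zcoef
  rw [dif_neg h]

lemma zcoef_ne {k : Type} [Field k] (t : MvPolynomial σ k) (v : σ → ℤ) (h : zcoef t v ≠ 0) :
    ∃ p ∈ t.support, cs p = v := by
  by_cases hp : ∃ p, cs p = v
  · obtain ⟨p, rfl⟩ := hp
    rw [zcoef_cs] at h
    exact ⟨p, MvPolynomial.mem_support_iff.2 h, rfl⟩
  · exact absurd (zcoef_none t v hp) h

variable {k R : Type} [Field k] [CommRing R]

open Classical in
/-- The graded ring structure on a monoid algebra. -/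
noncomputable def grRingOf (G : Finset (σ × σ)) (φ : R →+* MvPolynomial σ k)
    (hinj : Function.Injective φ)
    (hr : ∀ t, (∃ r, φ r = t) ↔ ∀ v ∈ t.support, cs v ∈ SY G) : GrRing k R (SY G) where
  c :=
    { toFun := fun r => zcoef (φ r)
      map_zero' := by
        funext v
        by_cases hp : ∃ p, cs p = v
        · obtain ⟨p, rfl⟩ := hp
          rw [zcoef_cs, map_zero]; simp
        · rw [zcoef_none _ _ hp]; rfl
      map_add' := by
        intro a b
        funext v
        by_cases hp : ∃ p, cs p = v
        · obtain ⟨p, rfl⟩ := hp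
          rw [Pi.add_apply, zcoef_cs, zcoef_cs, zcoef_cs, map_add, MvPolynomial.coeff_add]
        · rw [Pi.add_apply, zcoef_none _ _ hp, zcoef_none _ _ hp, zcoef_none _ _ hp, add_zero] }
  mon s a := if h : ∃ r, ∃ p, cs p = s ∧ φ r = MvPolynomial.monomial p a then h.choose else 0
  inj r h := by
    apply hinj
    rw [map_zero]
    ext p
    have := congrFun h (cs p)
    change zcoef (φ r) (cs p) = 0 at this
    rw [zcoef_cs] at this
    rw [this]; simp
  fin r := by
    refine Set.Finite.subset ((φ r).support.finite_toSet.image cs) ?_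
    intro v hv
    obtain ⟨p, hp, rfl⟩ := zcoef_ne _ _ hv
    exact ⟨p, hp, rfl⟩
  supp r v hv := by
    obtain ⟨p, hp, rfl⟩ := zcoef_ne _ _ hv
    exact (hr (φ r)).1 ⟨r, rfl⟩ p hp
  c_mon_self s hs a := by
    have h : ∃ r, ∃ p, cs p = s ∧ φ r = MvPolynomial.monomial p a := by
      obtain ⟨p, rfl⟩ := exists_cs s (SY_nonneg hs)
      obtain ⟨r, hr'⟩ := (hr (MvPolynomial.monomial p a)).2 (by
        intro v hv
        have := MvPolynomial.support_monomial_subset hv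
        rw [Finset.mem_singleton] at this
        rwa [this])
      exact ⟨r, p, rfl, hr'⟩
    rw [dif_pos h]
    obtain ⟨p, hp, hφ⟩ := h.choose_spec
    change zcoef (φ h.choose) s = a
    rw [hφ, ← hp, zcoef_cs, MvPolynomial.coeff_monomial, if_pos rfl]
  c_mon_ne s hs a w hw := by
    have h : ∃ r, ∃ p, cs p = s ∧ φ r = MvPolynomial.monomial p a := by
      obtain ⟨p, rfl⟩ := exists_cs s (SY_nonneg hs)
      obtain ⟨r, hr'⟩ := (hr (MvPolynomial.monomial p a)).2 (by
        intro v hv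
        have := MvPolynomial.support_monomial_subset hv
        rw [Finset.mem_singleton] at this
        rwa [this])
      exact ⟨r, p, rfl, hr'⟩
    rw [dif_pos h]
    obtain ⟨p, hp, hφ⟩ := h.choose_spec
    change zcoef (φ h.choose) w = 0
    rw [hφ]
    by_contra hne
    obtain ⟨q, hq, rfl⟩ := zcoef_ne _ _ hne
    have := MvPolynomial.support_monomial_subset hq
    rw [Finset.mem_singleton] at this
    apply hw
    rw [this, hp]
  mon_mul s hs a r v := by
    have h : ∃ r, ∃ p, cs p = s ∧ φ r = MvPolynomial.monomial p a := by
      obtain ⟨p, rfl⟩ := exists_cs s (SY_nonneg hs)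
      obtain ⟨r, hr'⟩ := (hr (MvPolynomial.monomial p a)).2 (by
        intro v hv
        have := MvPolynomial.support_monomial_subset hv
        rw [Finset.mem_singleton] at this
        rwa [this])
      exact ⟨r, p, rfl, hr'⟩
    rw [dif_pos h]
    obtain ⟨p, hp, hφ⟩ := h.choose_spec
    change zcoef (φ (h.choose * r)) v = a * zcoef (φ r) (v - s)
    rw [map_mul, hφ]
    by_cases hv : ∃ q, cs q = v
    · obtain ⟨q, rfl⟩ := hv
      rw [zcoef_cs, MvPolynomial.coeff_monomial_mul']
      by_cases hle : p ≤ q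
      · rw [if_pos hle]
        obtain ⟨d, rfl⟩ := exists_add_of_le hle
        rw [← hp, cs_add, add_sub_cancel_left, zcoef_cs, add_tsub_cancel_left]
      · rw [if_neg hle, zcoef_none, mul_zero]
        rintro ⟨d, hd⟩
        apply hle
        have : q = p + d := by
          apply cs_inj
          rw [cs_add, hd, hp]
          abel
        rw [this]
        exact le_self_add
    · rw [zcoef_none _ _ hv, zcoef_none, mul_zero]
      rintro ⟨d, hd⟩
      apply hv
      refine ⟨d + p, ?_⟩
      rw [cs_add, hd, hp]
      abel

lemma grRingOf_c (G : Finset (σ × σ)) (φ : R →+* MvPolynomial σ k)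
    (hinj : Function.Injective φ)
    (hr : ∀ t, (∃ r, φ r = t) ↔ ∀ v ∈ t.support, cs v ∈ SY G) (r : R) (v : σ → ℤ) :
    (grRingOf G φ hinj hr).c r v = zcoef (φ r) v := rfl

/-- The combinatorial data attached to a semidualizing module. -/
lemma semidual_data (G : Finset (σ × σ)) (hGne : G.Nonempty)
    (hG : PK G = 1 ∨ Irreducible (PK G)) [IsDomain R] [IsNoetherianRing R]
    (φ : R →+* MvPolynomial σ k) (𝓕 : Finset ((σ →₀ ℕ) →+ ℤ)) (u : σ →₀ ℕ)
    (hd : ConeData φ 𝓕 u) (hcl : ∀ v, (∀ F ∈ 𝓕, 0 ≤ F v) ↔ cs v ∈ SY G)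
    (C : ModuleCat.{0} R) (hC : IsSemidualizing C) :
    ∃ (U : Set (σ → ℤ)) (J : Ideal R), U.Nonempty ∧ (∀ v ∈ U, v ∈ SY G) ∧
      (∀ r, r ∈ J ↔ ∀ v ∈ (φ r).support, cs v ∈ U) ∧ Nonempty (C ≃ₗ[R] J) ∧
      ∃ (w : σ → ℤ) (s : ℤ), (s = 1 ∨ s = -1) ∧
        ((∀ v, KF (fun y : {y // y ∈ G} => ee y.1) U v = s * KY G (v + w)) ∨
          (∀ v, KF (fun y : {y // y ∈ G} => ee y.1) U v = s * KY G (w - v))) := by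
  classical
  obtain ⟨I, hI, ⟨e1⟩, hP⟩ := semidual_ideal C hC
  obtain ⟨U0, J, hne0, hUS0, hU0, hJ0, ⟨e2⟩⟩ := hd.exists_monomial_ideal I hI hP
  have hr : ∀ t, (∃ r, φ r = t) ↔ ∀ v ∈ t.support, cs v ∈ SY G := by
    intro t
    rw [hd.range t]
    exact forall₂_congr fun v _ => hcl v
  let GR := grRingOf G φ hd.inj hr
  let U : Set (σ → ℤ) := cs '' U0
  have hmemU : ∀ p, cs p ∈ U ↔ p ∈ U0 := by
    intro p
    constructor
    · rintro ⟨q, hq, hqp⟩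
      rwa [← cs_inj hqp]
    · intro h; exact ⟨p, h, rfl⟩
  have hUS : ∀ v ∈ U, v ∈ SY G := by
    rintro v ⟨p, hp, rfl⟩
    exact (hcl p).1 (hUS0 p hp)
  have hU : ∀ v ∈ U, ∀ s ∈ SY G, v + s ∈ U := by
    rintro v ⟨p, hp, rfl⟩ s hs
    obtain ⟨q, rfl⟩ := exists_cs s (SY_nonneg hs)
    rw [← cs_add, hmemU]
    exact hU0 p hp q ((hcl q).2 hs)
  have hne : U.Nonempty := hne0.image _
  have hJ' : ∀ r, r ∈ J ↔ ∀ v ∈ (φ r).support, cs v ∈ U := by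
    intro r
    rw [hJ0 r]
    exact forall₂_congr fun v _ => (hmemU v).symm
  have hJ : ∀ r, r ∈ J ↔ ∀ v, GR.c r v ≠ 0 → v ∈ U := by
    intro r
    rw [hJ' r]
    constructor
    · intro h v hv
      obtain ⟨p, hp, rfl⟩ := zcoef_ne _ _ hv
      exact h p hp
    · intro h v hv
      apply h
      change zcoef (φ r) (cs v) ≠ 0
      rw [zcoef_cs]
      exact MvPolynomial.mem_support_iff.1 hv
  have hdeg0 : ∀ s ∈ SY G, 0 ≤ degL σ s := fun s hs => degL_nonneg (SY_nonneg hs)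
  obtain ⟨D⟩ := exists_minRes GR (U := U) (degL σ)
    (fun s hs h0 => degL_pos (SY_nonneg hs) h0) hUS hU
  let e : C ≃ₗ[R] J := e1.trans e2
  have hD : D.DualExact := by
    intro i v x hx
    obtain ⟨z, hz1, hz2⟩ := D.dual_exact GR J hJ hUS hU C hC e i v x hx.1 hx.2
    exact ⟨z, hz1, hz2⟩
  have hD0 : ∀ v (x : D.ι 0 → k), x ∈ D.ZZ 0 v → ∃ a : k, (a ≠ 0 → v ∈ SY G) ∧ x = a • D.g := by
    intro v x hx
    exact D.dual_exact0 GR J hJ hUS hU C hC e v x hx.1 hx.2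
  obtain ⟨y0, hy0⟩ := hGne
  haveI : Nonempty {y // y ∈ G} := ⟨⟨y0, hy0⟩⟩
  letI : LinearOrder {y // y ∈ G} := someOrder _
  have hcorr := corr_eq D (fun y : {y // y ∈ G} => ee y.1) (SY_eq_range G) hUS hU hne hdeg0 hD hD0
  have hKK : KF (fun y : {y // y ∈ G} => ee y.1) (SY G : Set (σ → ℤ)) = KY G :=
    funext (KF_eq_KY G)
  rw [hKK] at hcorr
  have hfin : (Function.support (KF (fun y : {y // y ∈ G} => ee y.1) U)).Finite :=
    KF_support_finite _ U (by rw [← SY_eq_range]; exact hUS) (by rw [← SY_eq_range]; exact hU)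
  have hnn : ∀ v, KF (fun y : {y // y ∈ G} => ee y.1) U v ≠ 0 → ∀ i, 0 ≤ v i := by
    intro v hv i
    unfold KF at hv
    obtain ⟨T, _, hT⟩ := Finset.exists_ne_zero_of_sum_ne_zero hv
    have hmem : v - eT (fun y : {y // y ∈ G} => ee y.1) T ∈ U := by
      by_contra hc
      apply hT
      rw [if_neg hc, mul_zero]
    have hTS : eT (fun y : {y // y ∈ G} => ee y.1) T ∈ SY G := by
      rw [SY_eq_range]
      exact sum_mem fun y _ => AddSubmonoid.subset_closure ⟨y, rfl⟩
    have h3 := SY_nonneg (add_mem (hUS _ hmem) hTS) i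
    rwa [sub_add_cancel] at h3
  obtain ⟨w, s, hs, hws⟩ := fun_dichotomy _ _ hfin (KY_finite G) hnn (KY_nonneg G) hG hcorr
  exact ⟨U, J, hne, hUS, hJ', ⟨e⟩, w, s, hs, hws⟩

/-- Translation of monomial ideals gives isomorphic modules. -/
lemma iso_of_translate (G : Finset (σ × σ))
    (φ : R →+* MvPolynomial σ k) (hinj : Function.Injective φ)
    (hr : ∀ t, (∃ r, φ r = t) ↔ ∀ v ∈ t.support, cs v ∈ SY G)
    (U U' : Set (σ → ℤ)) (hU : ∀ v ∈ U, v ∈ SY G) (hU' : ∀ v ∈ U', v ∈ SY G)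
    (J J' : Ideal R)
    (hJ : ∀ r, r ∈ J ↔ ∀ v ∈ (φ r).support, cs v ∈ U)
    (hJ' : ∀ r, r ∈ J' ↔ ∀ v ∈ (φ r).support, cs v ∈ U')
    (t : σ → ℤ) (ht : ∀ v, v ∈ U' ↔ v + t ∈ U) : Nonempty (J' ≃ₗ[R] J) := by
  classical
  -- decompose t = p - q
  obtain ⟨p, hp⟩ := exists_cs (fun i => max (t i) 0) (fun i => le_max_right _ _)
  obtain ⟨q, hq⟩ := exists_cs (fun i => max (-t i) 0) (fun i => le_max_right _ _)
  have hpq : cs p - cs q = t := by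
    rw [hp, hq]
    funext i
    simp only [Pi.sub_apply]
    rcases le_total (t i) 0 with h | h
    · rw [max_eq_right h, max_eq_left (by omega)]; ring
    · rw [max_eq_left h, max_eq_right (by omega)]; ring
  have key : ∀ (p q : σ →₀ ℕ) (V V' : Set (σ → ℤ)) (K K' : Ideal R),
      (∀ v ∈ V, v ∈ SY G) →
      (∀ r, r ∈ K ↔ ∀ v ∈ (φ r).support, cs v ∈ V) →
      (∀ r, r ∈ K' ↔ ∀ v ∈ (φ r).support, cs v ∈ V') →
      (∀ v, v ∈ V' → v + (cs p - cs q) ∈ V) →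
      ∀ i ∈ K', ∃ j ∈ K, MvPolynomial.monomial p (1 : k) * φ i
        = MvPolynomial.monomial q (1 : k) * φ j := by
    intro p q V V' K K' hV hK hK' ht i hi
    have h1 := (hK' i).1 hi
    have h2 : MvPolynomial.monomial q (1 : k) ∣ MvPolynomial.monomial p (1 : k) * φ i := by
      rw [MvPolynomial.monomial_one_dvd_iff_modMonomial_eq_zero]
      ext v
      rw [MvPolynomial.coeff_zero]
      by_cases hqv : q ≤ v
      · exact MvPolynomial.coeff_modMonomial_of_le _ hqv
      · rw [MvPolynomial.coeff_modMonomial_of_not_le _ hqv]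
        by_contra hne
        obtain ⟨w, hw, rfl⟩ :=
          (support_monomial_mul_mem _ _ _).1 (MvPolynomial.mem_support_iff.2 hne)
        obtain ⟨d, hd⟩ := exists_cs _ (SY_nonneg (hV _ (ht _ (h1 w hw))))
        apply hqv
        have : p + w = q + d := by
          apply cs_inj
          rw [cs_add, cs_add, hd]; abel
        rw [this]
        exact le_self_add
    obtain ⟨f, hf⟩ := h2
    have hfs : ∀ v ∈ f.support, cs v ∈ V := by
      intro v hv
      have h3 : q + v ∈ (MvPolynomial.monomial q (1 : k) * f).support :=
        (support_monomial_mul_mem _ _ _).2 ⟨v, hv, rfl⟩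
      rw [← hf] at h3
      obtain ⟨w, hw, hwv⟩ := (support_monomial_mul_mem _ _ _).1 h3
      have h4 := ht _ (h1 w hw)
      have h5 := congrArg cs hwv
      rw [cs_add, cs_add] at h5
      have h6 : cs w + (cs p - cs q) = cs v := by
        rw [add_comm, sub_add_eq_add_sub, ← h5]; abel
      rwa [h6] at h4
    obtain ⟨j, rfl⟩ := (hr f).2 (fun v hv => hV _ (hfs v hv))
    exact ⟨j, (hK j).2 hfs, hf⟩
  have hne : ∀ p : σ →₀ ℕ, MvPolynomial.monomial p (1 : k) ≠ 0 := by
    intro p h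
    rw [MvPolynomial.monomial_eq_zero] at h
    exact one_ne_zero h
  refine iso_of_corr φ hinj J' J (MvPolynomial.monomial p 1) (MvPolynomial.monomial q 1)
    (hne p) (hne q) ?_ ?_
  · refine key p q U U' J J' hU hJ hJ' ?_
    intro v hv
    rw [hpq]
    exact (ht v).1 hv
  · intro j hj
    obtain ⟨i, hi, h⟩ := key q p U' U J' J hU' hJ' hJ (by
      intro v hv
      rw [← neg_sub, hpq, ht]
      rwa [neg_add_cancel_right]) j hj
    exact ⟨i, hi, h.symm⟩

end Final

/-- **Two-Sided Ladder Theorem, `t = 2`, no coincidental corners.** Let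
`Y` be a `2`-connected ladder in which no lower inside corner equals an upper inside
corner. Then `R_2(Y)` has at most two semidualizing modules up to isomorphism: among any
three semidualizing modules, two are isomorphic. -/
theorem twoConnected_noCoincidentalCorners_semidualizing (m n : ℕ) (k : Type) [Field k]
    (Y : Set (ℕ × ℕ)) (hY : StdLadder m n Y) (hconn : TConnected m n 2 Y)
    (hnc : ∀ p q : ℕ × ℕ, IsLowerCorner Y p → IsUpperCorner Y q → p ≠ q)
    (C : Fin 3 → ModuleCat.{0} (LadderRing k 2 Y))
    (hC : ∀ i, IsSemidualizing (C i)) :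
    ∃ i j, i ≠ j ∧ Nonempty (C i ≅ C j) := by
  classical
  have hin : ∀ y ∈ Y, y.1 ≤ m ∧ y.2 ≤ n := fun y hy =>
    ⟨(hY.1.1 y hy).2.1, (hY.1.1 y hy).2.2.2⟩
  have hfin : Y.Finite := by
    refine Set.Finite.subset (Set.finite_Iic ((m, n) : ℕ × ℕ)) ?_
    intro y hy
    exact ⟨(hin y hy).1, (hin y hy).2⟩
  haveI : Finite Y := hfin
  obtain ⟨φ, 𝓕, u, hd, hcl0⟩ := toric_coneData k (Y := Y) (ρ := fun i => Fin.ofNat (m + 1) i)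
    (κ := fun i => Fin.ofNat (n + 1) i) m n hY.1
    (fun y hy y' hy' h => ofNat_inj' (hin y hy).1 (hin y' hy').1 h)
    (fun y hy y' hy' h => ofNat_inj' (hin y hy).2 (hin y' hy').2 h)
  let G := gr m n Y
  have hcst : ∀ y, cs (tev (fun i => Fin.ofNat (m + 1) i) (fun i => Fin.ofNat (n + 1) i) y)
      = ee (edg m n y) := by
    intro y
    funext i
    rcases i with i | i <;>
      simp [cs, tev, ev, ee, edg, Finsupp.single_apply, Pi.single_apply, eq_comm]
  have hcl1 : ∀ v, v ∈ AddSubmonoid.closure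
      (tev (fun i => Fin.ofNat (m + 1) i) (fun i => Fin.ofNat (n + 1) i) '' Y) →
      cs v ∈ SY G := by
    intro v hv
    induction hv using AddSubmonoid.closure_induction with
    | mem x hx =>
      obtain ⟨y, hy, rfl⟩ := hx
      rw [hcst]
      exact AddSubmonoid.subset_closure ⟨edg m n y, (mem_gr _).2 ⟨y, hy, rfl⟩, rfl⟩
    | zero =>
      have : cs (0 : Fin (m + 1) ⊕ Fin (n + 1) →₀ ℕ) = 0 := by funext i; simp [cs]
      rw [this]; exact zero_mem _
    | add x y _ _ hx hy => rw [cs_add]; exact add_mem hx hy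
  have hcl2 : ∀ s ∈ SY G, ∃ v ∈ AddSubmonoid.closure
      (tev (fun i => Fin.ofNat (m + 1) i) (fun i => Fin.ofNat (n + 1) i) '' Y), cs v = s := by
    intro s hs
    unfold SY at hs
    induction hs using AddSubmonoid.closure_induction with
    | mem x hx =>
      obtain ⟨z, hz, rfl⟩ := hx
      obtain ⟨y, hy, rfl⟩ := (mem_gr z).1 hz
      exact ⟨_, AddSubmonoid.subset_closure ⟨y, hy, rfl⟩, hcst y⟩
    | zero => exact ⟨0, zero_mem _, by funext i; simp [cs]⟩
    | add x y _ _ hx hy =>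
      obtain ⟨v, hv, rfl⟩ := hx
      obtain ⟨w, hw, rfl⟩ := hy
      exact ⟨v + w, add_mem hv hw, cs_add v w⟩
  have hcl : ∀ v, (∀ F ∈ 𝓕, 0 ≤ F v) ↔ cs v ∈ SY G := by
    intro v
    rw [hcl0 v]
    refine ⟨hcl1 v, fun h => ?_⟩
    obtain ⟨w, hw, hwv⟩ := hcl2 _ h
    rwa [← cs_inj hwv]
  haveI : IsDomain (LadderRing k 2 Y) := hd.inj.isDomain φ
  haveI : IsNoetherianRing (LadderRing k 2 Y) := inferInstance
  have hGne : G.Nonempty := ⟨edg m n (1, n), (mem_gr _).2 ⟨(1, n), hY.2.1, rfl⟩⟩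
  have hr : ∀ t, (∃ r, φ r = t) ↔ ∀ v ∈ t.support, cs v ∈ SY G := by
    intro t
    rw [hd.range t]
    exact forall₂_congr fun v _ => hcl v
  choose U J hne hUS hJ hiso w s hs hty using fun i =>
    semidual_data G hGne (gr_irred hY hconn hnc) φ 𝓕 u hd hcl (C i) (hC i)
  have main : ∀ i j : Fin 3,
      ((∀ v, KF (fun y : {y // y ∈ G} => ee y.1) (U i) v = s i * KY G (v + w i)) ∧
        (∀ v, KF (fun y : {y // y ∈ G} => ee y.1) (U j) v = s j * KY G (v + w j)) ∨
      (∀ v, KF (fun y : {y // y ∈ G} => ee y.1) (U i) v = s i * KY G (w i - v)) ∧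
        (∀ v, KF (fun y : {y // y ∈ G} => ee y.1) (U j) v = s j * KY G (w j - v))) →
      Nonempty (C i ≅ C j) := by
    intro i j hij
    have hsq : s j * s j = 1 := by
      rcases hs j with h | h <;> rw [h] <;> norm_num
    have hss : s i * s j = 1 ∨ s i * s j = -1 := by
      rcases hs i with h | h <;> rcases hs j with h' | h' <;> rw [h, h'] <;> norm_num
    have htr : ∃ t, ∀ v, KF (fun y : {y // y ∈ G} => ee y.1) (U i) v
        = (s i * s j) * KF (fun y : {y // y ∈ G} => ee y.1) (U j) (v + t) := by
      rcases hij with ⟨h1, h2⟩ | ⟨h1, h2⟩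
      · refine ⟨w i - w j, fun v => ?_⟩
        rw [h1, h2, show v + (w i - w j) + w j = v + w i by abel, mul_assoc,
          ← mul_assoc (s j), hsq, one_mul]
      · refine ⟨w j - w i, fun v => ?_⟩
        rw [h1, h2, show w j - (v + (w j - w i)) = w i - v by abel, mul_assoc,
          ← mul_assoc (s j), hsq, one_mul]
    obtain ⟨t, ht⟩ := htr
    have hdeg : ∀ l, ∀ v ∈ U l, 0 ≤ degL _ v := fun l v hv =>
      degL_nonneg (SY_nonneg (hUS l v hv))
    have htrans := translate_of_KF (fun y : {y // y ∈ G} => ee y.1) (degL _)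
      (fun y => by rw [degL_ee]; norm_num) (U j) (U i) (hdeg j) (hdeg i) (hne i) _ hss t ht
    obtain ⟨f⟩ := iso_of_translate G φ hd.inj hr (U j) (U i) (hUS j) (hUS i) (J j) (J i)
      (hJ j) (hJ i) t htrans
    obtain ⟨ei⟩ := hiso i
    obtain ⟨ej⟩ := hiso j
    exact ⟨((ei.trans f).trans ej.symm).toModuleIso⟩
  rcases hty 0 with h0 | h0 <;> rcases hty 1 with h1 | h1 <;> rcases hty 2 with h2 | h2
  · exact ⟨0, 1, by decide, main 0 1 (Or.inl ⟨h0, h1⟩)⟩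
  · exact ⟨0, 1, by decide, main 0 1 (Or.inl ⟨h0, h1⟩)⟩
  · exact ⟨0, 2, by decide, main 0 2 (Or.inl ⟨h0, h2⟩)⟩
  · exact ⟨1, 2, by decide, main 1 2 (Or.inr ⟨h1, h2⟩)⟩
  · exact ⟨1, 2, by decide, main 1 2 (Or.inl ⟨h1, h2⟩)⟩
  · exact ⟨0, 2, by decide, main 0 2 (Or.inr ⟨h0, h2⟩)⟩
  · exact ⟨0, 1, by decide, main 0 1 (Or.inr ⟨h0, h1⟩)⟩
  · exact ⟨0, 1, by decide, main 0 1 (Or.inr ⟨h0, h1⟩)⟩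

end LadderDet
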